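/- arXiv:1305.6746 — 12 statements merged into one kernel-verified Lean document; each statement's English description precedes it below -/
import Mathlib

section
/- Let t₀ < t₁ be real numbers and let x : [t₀,t₁] → ℝ be continuously differentiable with x'(t) ≠ 0 of constant sign on [t₀,t₁]. Set x₀ = x(t₀), x₁ = x(t₁), |x'|_min = min_{t∈[t₀,t₁]} |x'(t)|, |x'|_max = max_{t∈[t₀,t₁]} |x'(t)|, and osc(x') = |x'|_max − |x'|_min. Then for every bounded measurable function ψ : ℝ → ℝ one has | (1/(t₁−t₀)) ∫_{t₀}^{t₁} ψ(x(t)) dt − (1/(x₁−x₀)) ∫_{x₀}^{x₁} ψ(x) dx | ≤ (osc(x') / |x'|_min) · sup_{x∈ℝ} |ψ(x)|. -/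
open Real MeasureTheory Set intervalIntegral

/-- Change of variables along a trajectory whose derivative has constant sign. -/
theorem integral_comp_mul_deriv_of_constant_sign {a b : ℝ} (hab : a ≤ b) {f f' : ℝ → ℝ}
    (hderiv : ∀ t ∈ Icc a b, HasDerivAt f (f' t) t)
    (hsign : (∀ t ∈ Icc a b, 0 < f' t) ∨ (∀ t ∈ Icc a b, f' t < 0)) (g : ℝ → ℝ) :
    ∫ t in a..b, g (f t) * f' t = ∫ u in f a..f b, g u := by
  have hf : ContinuousOn f (uIcc a b) := by
    rw [uIcc_of_le hab]
    exact fun t ht => (hderiv t ht).continuousAt.continuousWithinAt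
  have hff' : ∀ t ∈ Ioo (min a b) (max a b), HasDerivAt f (f' t) t := by
    rw [min_eq_left hab, max_eq_right hab]
    exact fun t ht => hderiv t (Ioo_subset_Icc_self ht)
  rcases hsign with h | h
  · refine integral_comp_mul_deriv_of_deriv_nonneg hf hff' ?_
    rw [min_eq_left hab, max_eq_right hab]
    exact fun t ht => (h t (Ioo_subset_Icc_self ht)).le
  · refine integral_comp_mul_deriv_of_deriv_nonpos hf hff' ?_
    rw [min_eq_left hab, max_eq_right hab]
    exact fun t ht => (h t (Ioo_subset_Icc_self ht)).le

/-- A bounded measurable function of a continuous trajectory is interval integrable. -/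
theorem intervalIntegrable_comp_of_bounded {a b C : ℝ} (hab : a ≤ b) {f g : ℝ → ℝ}
    (hf : ContinuousOn f (Icc a b)) (hg : Measurable g) (hC : ∀ u, |g u| ≤ C) :
    IntervalIntegrable (fun t => g (f t)) volume a b := by
  rw [intervalIntegrable_iff_integrableOn_Icc_of_le hab]
  exact Integrable.of_bound
    (hg.comp_aemeasurable (hf.aemeasurable measurableSet_Icc)).aestronglyMeasurable C
    (Filter.Eventually.of_forall fun t => hC (f t))

/-- Comparison of the time average of `ψ` along a monotone trajectory `x(t)`
with the space average of `ψ` over the traversed interval `[x₀, x₁]`. -/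
theorem time_average_vs_space_average
    (t₀ t₁ : ℝ) (ht : t₀ < t₁) (x x' : ℝ → ℝ)
    (hderiv : ∀ t ∈ Set.Icc t₀ t₁, HasDerivAt x (x' t) t)
    (hcont : ContinuousOn x' (Set.Icc t₀ t₁))
    (hsign : (∀ t ∈ Set.Icc t₀ t₁, 0 < x' t) ∨ (∀ t ∈ Set.Icc t₀ t₁, x' t < 0))
    (ψ : ℝ → ℝ) (hmeas : Measurable ψ)
    (hbdd : BddAbove (Set.range fun u => |ψ u|)) :
    |(1 / (t₁ - t₀)) * (∫ t in t₀..t₁, ψ (x t))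
        - (1 / (x t₁ - x t₀)) * ∫ u in (x t₀)..(x t₁), ψ u|
      ≤ ((sSup ((fun t => |x' t|) '' Set.Icc t₀ t₁)
            - sInf ((fun t => |x' t|) '' Set.Icc t₀ t₁))
          / sInf ((fun t => |x' t|) '' Set.Icc t₀ t₁)) * ⨆ u, |ψ u| := by
  set A := (fun t => |x' t|) '' Icc t₀ t₁
  set S := ⨆ u, |ψ u|
  have hS (u : ℝ) : |ψ u| ≤ S := le_ciSup hbdd u
  have hS0 : 0 ≤ S := (abs_nonneg _).trans (hS 0)
  have hAc : IsCompact A := isCompact_Icc.image_of_continuousOn hcont.abs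
  have hAne : A.Nonempty := (nonempty_Icc.2 ht.le).image _
  have hmin : ∀ t ∈ Icc t₀ t₁, sInf A ≤ |x' t| := fun t h =>
    csInf_le hAc.bddBelow (mem_image_of_mem _ h)
  have hmax : ∀ t ∈ Icc t₀ t₁, |x' t| ≤ sSup A := fun t h =>
    le_csSup hAc.bddAbove (mem_image_of_mem _ h)
  have hm : 0 < sInf A := by
    obtain ⟨t, h, hmt⟩ := hAc.sInf_mem hAne
    rw [← hmt]
    exact abs_pos.2 (hsign.elim (fun hs => (hs t h).ne') fun hs => (hs t h).ne)
  have hxc : ContinuousOn x (Icc t₀ t₁) := fun t h =>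
    (hderiv t h).continuousAt.continuousWithinAt
  obtain ⟨ξ, hξ, hslope⟩ := exists_hasDerivAt_eq_slope x x' ht hxc
    fun t h => hderiv t (Ioo_subset_Icc_self h)
  replace hξ := Ioo_subset_Icc_self hξ
  have hT : 0 < t₁ - t₀ := sub_pos.2 ht
  have hξpos : 0 < |x' ξ| := hm.trans_le (hmin ξ hξ)
  have hξ0 : x' ξ ≠ 0 := abs_pos.1 hξpos
  have hD : x t₁ - x t₀ = x' ξ * (t₁ - t₀) := by
    rw [hslope, div_mul_cancel₀ _ hT.ne']
  have hosc : ∀ t ∈ Icc t₀ t₁, |x' ξ - x' t| ≤ sSup A - sInf A := by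
    intro t h
    have h1 := hmin t h
    have h2 := hmax t h
    have h3 := hmin ξ hξ
    have h4 := hmax ξ hξ
    rcases hsign with hs | hs
    · rw [abs_of_pos (hs t h)] at h1 h2
      rw [abs_of_pos (hs ξ hξ)] at h3 h4
      exact abs_le.2 ⟨by linarith, by linarith⟩
    · rw [abs_of_neg (hs t h)] at h1 h2
      rw [abs_of_neg (hs ξ hξ)] at h3 h4
      exact abs_le.2 ⟨by linarith, by linarith⟩
  have hint := intervalIntegrable_comp_of_bounded ht.le hxc hmeas hS
  have hcont' : ContinuousOn x' (uIcc t₀ t₁) := by rwa [uIcc_of_le ht.le]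
  have heq : (1 / (t₁ - t₀)) * (∫ t in t₀..t₁, ψ (x t))
        - (1 / (x t₁ - x t₀)) * ∫ u in (x t₀)..(x t₁), ψ u
      = (∫ t in t₀..t₁, ψ (x t) * (x' ξ - x' t)) / (x' ξ * (t₁ - t₀)) := by
    simp_rw [mul_sub]
    rw [integral_sub (hint.mul_const _) (hint.mul_continuousOn hcont'),
      integral_comp_mul_deriv_of_constant_sign ht.le hderiv hsign,
      intervalIntegral.integral_mul_const, hD]
    field_simp
  have hbound : |∫ t in t₀..t₁, ψ (x t) * (x' ξ - x' t)|
      ≤ S * (sSup A - sInf A) * (t₁ - t₀) := by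
    rw [← abs_of_pos hT, ← Real.norm_eq_abs (∫ t in t₀..t₁, _)]
    refine intervalIntegral.norm_integral_le_of_norm_le_const fun t h => ?_
    rw [uIoc_of_le ht.le] at h
    rw [norm_mul]
    exact mul_le_mul (hS _) (hosc t (Ioc_subset_Icc_self h)) (abs_nonneg _) hS0
  have hosc0 : 0 ≤ sSup A - sInf A := (abs_nonneg _).trans (hosc ξ hξ)
  rw [heq, abs_div, abs_mul, abs_of_pos hT]
  calc _ ≤ S * (sSup A - sInf A) * (t₁ - t₀) / (|x' ξ| * (t₁ - t₀)) := by gcongr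
    _ = S * (sSup A - sInf A) / |x' ξ| := mul_div_mul_right _ _ hT.ne'
    _ ≤ S * (sSup A - sInf A) / sInf A := by
      gcongr
      exact hmin ξ hξ
    _ = _ := by ring
end

section
/- There exist positive constants C_a, C_b, C such that the following holds. Let |γ| ≤ 1, a ∈ ℝ, b > 0, μ > 0, and 0 < δ ≤ 1 satisfy |a| + 1 ≤ bδ/C_a and δ ≥ C_b·√(μ/b). Let x be a differentiable function on an interval I = [t₋, t₊] satisfying x'(t) = (γ·cos(x(t)) + a + b·cos t)/μ on I, and suppose |x(s) − x(s')| ≤ 2π for all s, s' ∈ I. Then for every t̂ ∈ I with |cos t̂| ≥ δ one has t₊ − t₋ ≤ C·μ/(b·|cos t̂|). -/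
open Real Set

/-- Length bound for a segment on which the solution of
`dx/dt = (γ cos x + a + b cos t)/μ` travels a bounded distance, in terms of `|cos that|`
at any point `that` of the segment where `|cos that| ≥ δ`. -/
theorem length_bound :
    ∃ Ca Cb C : ℝ, 0 < Ca ∧ 0 < Cb ∧ 0 < C ∧
      ∀ (γ a b μ δ tminus tplus : ℝ) (x : ℝ → ℝ),
        |γ| ≤ 1 → 0 < b → 0 < μ → 0 < δ → δ ≤ 1 →
        |a| + 1 ≤ b * δ / Ca → Cb * Real.sqrt (μ / b) ≤ δ →
        tminus ≤ tplus →
        (∀ t ∈ Set.Icc tminus tplus,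
          HasDerivAt x ((γ * Real.cos (x t) + a + b * Real.cos t) / μ) t) →
        (∀ s ∈ Set.Icc tminus tplus, ∀ s' ∈ Set.Icc tminus tplus, |x s - x s'| ≤ 2 * π) →
        ∀ that ∈ Set.Icc tminus tplus, δ ≤ |Real.cos that| →
        tplus - tminus ≤ C * μ / (b * |Real.cos that|) := by
  refine ⟨4, 8, 8 * π, by norm_num, by norm_num, by positivity, ?_⟩
  intro γ a b μ δ t₀ t₁ x hγ hb hμ hδ _ ha hδμ _ hx hosc s hs hδs
  set c := |Real.cos s| with hc
  have hcpos : 0 < c := hδ.trans_le hδs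
  have hbc : 0 < b * c := mul_pos hb hcpos
  have hδb : b * δ ≤ b * c := by gcongr
  have hK : 8 * π * μ / (b * c) < c / 2 := by
    have h1 : 64 * (μ / b) ≤ c ^ 2 := by
      have h2 : (8 * √(μ / b)) ^ 2 ≤ c ^ 2 := by gcongr; exact hδμ.trans hδs
      rwa [mul_pow, Real.sq_sqrt (by positivity), show (8 : ℝ) ^ 2 = 64 by norm_num] at h2
    rw [← mul_div_assoc, div_le_iff₀ hb] at h1
    rw [div_lt_iff₀ hbc]
    nlinarith [mul_lt_mul_of_pos_right Real.pi_lt_four hμ]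
  obtain ⟨hs₀, hs₁⟩ := hs
  set l := max t₀ (s - c / 2) with hl
  set r := min t₁ (s + c / 2) with hr
  have hls : l ≤ s := max_le hs₀ (by linarith)
  have hsr : s ≤ r := le_min hs₁ (by linarith)
  have hlt₀ : t₀ ≤ l := le_max_left _ _
  have hrt₁ : r ≤ t₁ := min_le_left _ _
  have hlc : s - c / 2 ≤ l := le_max_right _ _
  have hrc : r ≤ s + c / 2 := min_le_right _ _
  have key : r - l ≤ 8 * π * μ / (b * c) := by
    rcases (hls.trans hsr).eq_or_lt with h | h
    · rw [h, sub_self]; positivity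
    obtain ⟨ξ, ⟨hξl, hξr⟩, hξ⟩ := exists_hasDerivAt_eq_slope x
      (fun t => (γ * Real.cos (x t) + a + b * Real.cos t) / μ) h
      (fun t ht => (hx t ⟨hlt₀.trans ht.1, ht.2.trans hrt₁⟩).continuousAt.continuousWithinAt)
      (fun t ht => hx t ⟨hlt₀.trans ht.1.le, ht.2.le.trans hrt₁⟩)
    have hcos : c / 2 ≤ |Real.cos ξ| := by
      have h1 := Real.abs_cos_sub_cos_le s ξ
      have h2 : |s - ξ| ≤ c / 2 := abs_le.2 ⟨by linarith, by linarith⟩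
      linarith [abs_sub_abs_le_abs_sub (Real.cos s) (Real.cos ξ)]
    have hγc : |γ * Real.cos (x ξ)| ≤ 1 := by
      rw [abs_mul]
      exact mul_le_one₀ hγ (abs_nonneg _) (Real.abs_cos_le_one _)
    have hlow : b * c / 4 ≤ |γ * Real.cos (x ξ) + a + b * Real.cos ξ| := by
      have h1 : |b * Real.cos ξ| = b * |Real.cos ξ| := by rw [abs_mul, abs_of_pos hb]
      have h2 := abs_sub_abs_le_abs_sub (b * Real.cos ξ) (-(γ * Real.cos (x ξ) + a))
      rw [sub_neg_eq_add, abs_neg, add_comm (b * Real.cos ξ)] at h2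
      have h3 := abs_add_le (γ * Real.cos (x ξ)) a
      have h4 : b * (c / 2) ≤ b * |Real.cos ξ| := by gcongr
      linarith
    have hrl : 0 < r - l := sub_pos.2 h
    have hosc' := hosc r ⟨hlt₀.trans h.le, hrt₁⟩ l ⟨hlt₀, h.le.trans hrt₁⟩
    rw [div_eq_div_iff hμ.ne' hrl.ne'] at hξ
    have habs := congrArg abs hξ
    rw [abs_mul, abs_mul, abs_of_pos hrl, abs_of_pos hμ] at habs
    rw [le_div_iff₀ hbc]
    have h5 := mul_le_mul_of_nonneg_right hlow hrl.le
    have h6 := mul_le_mul_of_nonneg_right hosc' hμ.le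
    linarith
  have hlr : l = t₀ := by
    rcases max_choice t₀ (s - c / 2) with h | h
    · exact h
    · rw [← hl] at h; linarith
  have hrr : r = t₁ := by
    rcases min_choice t₁ (s + c / 2) with h | h
    · exact h
    · rw [← hr] at h; linarith
  rwa [hlr, hrr] at key
end

section
/- There exist positive constants C_a, C_b, C such that the following holds. Let |γ| ≤ 1, a ∈ ℝ, b > 0, μ > 0, and 0 < δ ≤ 1 satisfy |a| + 1 ≤ bδ/C_a and δ ≥ C_b·√(μ/b). Let t* ∈ [0, 2π] and let x : [0, t*] → ℝ be a differentiable function with x'(t) = (γ·cos(x(t)) + a + b·cos t)/μ. Let M_δ = {t ∈ [0, t*] : |cos t| < δ}, let T = {t ∈ [0, t*] : x(t) − x(0) ∈ 2πℤ} (a set containing 0), and consider the connected components of [0, t*] \ T. Then the Lebesgue measure of the union of all components whose closure intersects M_δ is at most C·(μ/(bδ) + δ). -/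
open Real Set MeasureTheory

/-- In `[0, 2π]`, the cosine is small only near `π / 2` and `3π / 2`. -/
lemma abs_sub_le_of_abs_cos_lt {t δ : ℝ} (ht : t ∈ Icc (0 : ℝ) (2 * π)) (h : |cos t| < δ) :
    |t - π / 2| ≤ π / 2 * δ ∨ |t - 3 * π / 2| ≤ π / 2 * δ := by
  have hpi := pi_pos
  have key : ∀ u : ℝ, |u| ≤ π / 2 → |sin u| < δ → |u| ≤ π / 2 * δ := by
    intro u hu hs
    have h1 : 2 / π * |u| ≤ δ := (mul_abs_le_abs_sin hu).trans hs.le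
    calc |u| = π / 2 * (2 / π * |u|) := by field_simp
      _ ≤ π / 2 * δ := by gcongr
  obtain ⟨h0, h1⟩ := ht
  rcases le_total t π with htp | htp
  · left
    refine key _ (abs_le.2 ⟨by linarith, by linarith⟩) ?_
    rwa [sin_sub_pi_div_two, abs_neg]
  · right
    refine key _ (abs_le.2 ⟨by linarith, by linarith⟩) ?_
    rwa [show t - 3 * π / 2 = t - π - π / 2 by ring, sin_sub_pi_div_two, cos_sub_pi, neg_neg]

/-- A continuous function that moves by at least `2π` hits every residue class modulo `2π`. -/
lemma exists_eq_two_pi_mul_int {x : ℝ → ℝ} {p q : ℝ} (c : ℝ) (hpq : p ≤ q)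
    (hx : ContinuousOn x (Icc p q)) (h : 2 * π ≤ |x q - x p|) :
    ∃ t ∈ Icc p q, ∃ k : ℤ, x t - c = 2 * π * k := by
  have key : ∀ u v : ℝ, u + 2 * π ≤ v → ∃ k : ℤ, c + 2 * π * k ∈ Icc u v := by
    intro u v huv
    refine ⟨⌈(u - c) / (2 * π)⌉, ?_, ?_⟩
    · have := Int.le_ceil ((u - c) / (2 * π))
      rw [div_le_iff₀ (by positivity)] at this
      linarith
    · have := Int.ceil_lt_add_one ((u - c) / (2 * π))
      rw [← sub_lt_iff_lt_add, lt_div_iff₀ (by positivity)] at this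
      linarith
  rcases le_abs.1 h with h | h
  · obtain ⟨k, hk⟩ := key (x p) (x q) (by linarith)
    obtain ⟨t, ht, htk⟩ := intermediate_value_Icc hpq hx hk
    exact ⟨t, ht, k, by linarith⟩
  · obtain ⟨k, hk⟩ := key (x q) (x p) (by linarith)
    obtain ⟨t, ht, htk⟩ := intermediate_value_Icc' hpq hx hk
    exact ⟨t, ht, k, by linarith⟩

/-- Where `|cos t| ≥ δ`, a solution returns to its initial value modulo `2π` on every interval of
length `4πμ/(bδ)`. -/
lemma exists_return_time {γ a b μ δ p : ℝ} {x : ℝ → ℝ} (c : ℝ) (hγ : |γ| ≤ 1) (hb : 0 < b)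
    (hμ : 0 < μ) (hδ : 0 < δ) (ha : |a| + 1 ≤ b * δ / 2)
    (hcos : ∀ t ∈ Icc p (p + 4 * π * (μ / (b * δ))), δ ≤ |cos t|)
    (hx : ∀ t ∈ Icc p (p + 4 * π * (μ / (b * δ))),
      HasDerivAt x ((γ * cos (x t) + a + b * cos t) / μ) t) :
    ∃ t ∈ Icc p (p + 4 * π * (μ / (b * δ))), ∃ k : ℤ, x t - c = 2 * π * k := by
  have hL : 0 < 4 * π * (μ / (b * δ)) := by positivity
  have hcont : ContinuousOn x (Icc p (p + 4 * π * (μ / (b * δ)))) :=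
    fun t ht => (hx t ht).continuousAt.continuousWithinAt
  refine exists_eq_two_pi_mul_int c (by linarith) hcont ?_
  obtain ⟨t, ht, hslope⟩ := exists_hasDerivAt_eq_slope x _ (by linarith) hcont
    fun t ht => hx t (Ioo_subset_Icc_self ht)
  rw [add_sub_cancel_left, eq_div_iff hL.ne'] at hslope
  have hspeed : b * δ / 2 ≤ |γ * cos (x t) + a + b * cos t| := by
    have h1 : b * δ ≤ |b * cos t| := by
      rw [abs_mul, abs_of_pos hb]
      exact mul_le_mul_of_nonneg_left (hcos t (Ioo_subset_Icc_self ht)) hb.le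
    have h2 : |γ * cos (x t)| ≤ 1 := by
      rw [abs_mul]
      exact mul_le_one₀ hγ (abs_nonneg _) (abs_cos_le_one _)
    have h3 : |b * cos t| ≤ |γ * cos (x t) + a + b * cos t| + (|γ * cos (x t)| + |a|) := by
      calc |b * cos t| = |(γ * cos (x t) + a + b * cos t) - (γ * cos (x t) + a)| := by
            congr 1; ring
        _ ≤ |γ * cos (x t) + a + b * cos t| + |γ * cos (x t) + a| := abs_sub _ _
        _ ≤ _ := by gcongr; exact abs_add_le _ _
    linarith
  rw [← hslope, abs_mul, abs_div, abs_of_pos hμ, abs_of_pos hL]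
  calc 2 * π = b * δ / 2 / μ * (4 * π * (μ / (b * δ))) := by field_simp; norm_num
    _ ≤ _ := by gcongr

/-- For a solution of `dx/dt = (γ cos x + a + b cos t)/μ` on `[0, t*]`,
the union of the connected components of the complement of the return times
`T = {t : x(t) - x(0) ∈ 2πℤ}` whose closure meets `M_δ = {t : |cos t| < δ}`
(the "type 1 and type 2" segments) has Lebesgue measure at most `C (μ/(bδ) + δ)`. -/
theorem measure_type12_segments :
    ∃ Ca Cb C : ℝ, 0 < Ca ∧ 0 < Cb ∧ 0 < C ∧
      ∀ (γ a b μ δ tstar : ℝ) (x : ℝ → ℝ),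
        |γ| ≤ 1 → 0 < b → 0 < μ → 0 < δ → δ ≤ 1 →
        |a| + 1 ≤ b * δ / Ca → Cb * Real.sqrt (μ / b) ≤ δ →
        tstar ∈ Set.Icc (0 : ℝ) (2 * π) →
        (∀ t ∈ Set.Icc (0 : ℝ) tstar,
          HasDerivAt x ((γ * Real.cos (x t) + a + b * Real.cos t) / μ) t) →
        volume {s : ℝ |
            s ∈ Set.Icc (0 : ℝ) tstar \
              {t ∈ Set.Icc (0 : ℝ) tstar | ∃ k : ℤ, x t - x 0 = 2 * π * k} ∧
            (closure (connectedComponentIn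
                (Set.Icc (0 : ℝ) tstar \
                  {t ∈ Set.Icc (0 : ℝ) tstar | ∃ k : ℤ, x t - x 0 = 2 * π * k}) s) ∩
              {t ∈ Set.Icc (0 : ℝ) tstar | |Real.cos t| < δ}).Nonempty}
          ≤ ENNReal.ofReal (C * (μ / (b * δ) + δ)) := by
  refine ⟨2, 1, 16 * π, by norm_num, by norm_num, by positivity, ?_⟩
  intro γ a b μ δ tstar x hγ hb hμ hδ _ ha _ htstar hx
  set L : ℝ := 4 * π * (μ / (b * δ)) with hLdef
  have hL : 0 < L := by positivity
  set r : ℝ := π / 2 * δ + L with hr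
  have hr0 : 0 < r := by positivity
  refine (measure_mono (t := Metric.closedBall (π / 2) r ∪ Metric.closedBall (3 * π / 2) r)
    ?_).trans ?_
  · rintro s ⟨hs, m, hm, hmI, hmcos⟩
    set S := Icc (0 : ℝ) tstar \ {t ∈ Icc (0 : ℝ) tstar | ∃ k : ℤ, x t - x 0 = 2 * π * k}
    have hIS : connectedComponentIn S s ⊆ S := connectedComponentIn_subset S s
    have hsI : s ∈ connectedComponentIn S s := mem_connectedComponentIn hs
    have hord : (connectedComponentIn S s).OrdConnected :=
      isPreconnected_connectedComponentIn.ordConnected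
    have hnear : ∀ t ∈ Icc (0 : ℝ) tstar, |t - s| ≤ L → |cos t| < δ →
        s ∈ Metric.closedBall (π / 2) r ∪ Metric.closedBall (3 * π / 2) r := by
      intro t ht hts hcos
      refine (abs_sub_le_of_abs_cos_lt ⟨ht.1, ht.2.trans htstar.2⟩ hcos).imp ?_ ?_ <;>
      · intro h
        rw [Metric.mem_closedBall, Real.dist_eq]
        rw [abs_le] at *
        constructor <;> linarith
    have hinterval : ∀ p, Icc p (p + L) ⊆ connectedComponentIn S s → |p - s| ≤ L →
        |p + L - s| ≤ L → s ∈ Metric.closedBall (π / 2) r ∪ Metric.closedBall (3 * π / 2) r := by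
      intro p hp h1 h2
      by_contra hfar
      obtain ⟨t, ht, k, hk⟩ := exists_return_time (x 0) hγ hb hμ hδ ha
        (fun t ht => not_lt.1 fun hcos => hfar <| hnear t (hIS (hp ht)).1 (by
          obtain ⟨ht1, ht2⟩ := ht
          rw [abs_le] at *
          constructor <;> linarith) hcos)
        (fun t ht => hx t (hIS (hp ht)).1)
      exact (hIS (hp ht)).2 ⟨(hIS (hp ht)).1, k, hk⟩
    rcases le_or_gt |m - s| L with hms | hms
    · exact hnear m hmI hms hmcos
    · rcases lt_abs.1 hms with hms | hms
      · obtain ⟨m', hm'L, hm'⟩ := mem_closure_iff.1 hm (Ioi (s + L)) isOpen_Ioi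
          (show s + L < m by linarith)
        exact hinterval s ((Icc_subset_Icc_right (le_of_lt hm'L)).trans (hord.out hsI hm'))
          (by simpa using hL.le) (by simp [abs_of_pos hL])
      · obtain ⟨m', hm'L, hm'⟩ := mem_closure_iff.1 hm (Iio (s - L)) isOpen_Iio
          (show m < s - L by linarith)
        refine hinterval (s - L) ?_ (by simp [abs_of_pos hL]) (by simpa using hL.le)
        rw [sub_add_cancel]
        exact (Icc_subset_Icc_left (le_of_lt hm'L)).trans (hord.out hm' hsI)
  · refine (measure_union_le _ _).trans ?_
    rw [Real.volume_closedBall, Real.volume_closedBall,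
      ← ENNReal.ofReal_add (by positivity) (by positivity)]
    refine ENNReal.ofReal_le_ofReal ?_
    have : 0 < π * δ := by positivity
    rw [hr, hLdef]
    linarith
end

section
/- There exist positive constants C_a, C_b, C such that the following holds. Let |γ| ≤ 1, a ∈ ℝ, b > 0, μ > 0, and 0 < δ ≤ 1 satisfy |a| + 1 ≤ bδ/C_a and δ ≥ C_b·√(μ/b). Let [t₋, t₊] ⊆ [0, 2π] and let x be differentiable on [t₋, t₊] with x'(t) = (γ·cos(x(t)) + a + b·cos t)/μ, such that |cos t| ≥ δ for all t ∈ [t₋, t₊] and x(t₊) − x(t₋) = 2π or x(t₊) − x(t₋) = −2π. Then for every bounded measurable 2π-periodic function h : ℝ → ℝ with ∫₀^{2π} h(ξ) dξ = 0 one has | ∫_{t₋}^{t₊} h(x(τ)) dτ | ≤ (sup_{ξ} |h(ξ)|) · ∫_{t₋}^{t₊} C·( 1/(b·|cos t|) + μ/(b·cos² t) ) dt. -/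
open Real Set intervalIntegral

/-- A measurable bounded function composed with a map continuous on `[u, v]` is integrable
there. -/
theorem intervalIntegrable_comp_of_bounded_s3 {u v H : ℝ} {h x : ℝ → ℝ} (hm : Measurable h)
    (hH : ∀ ξ, |h ξ| ≤ H) (hx : ContinuousOn x (Icc u v)) (huv : u ≤ v) :
    IntervalIntegrable (fun t => h (x t)) MeasureTheory.volume u v := by
  rw [intervalIntegrable_iff_integrableOn_Icc_of_le huv]
  have hae : AEMeasurable x (MeasureTheory.volume.restrict (Icc u v)) :=
    hx.aemeasurable measurableSet_Icc
  exact MeasureTheory.Integrable.of_bound (hm.comp_aemeasurable hae).aestronglyMeasurable H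
    (Filter.Eventually.of_forall fun t => hH (x t))

/-- Over one full monotone turn of `x`, the integral of `h (x t) * x' t` vanishes when `h` is
periodic with zero average. -/
theorem integral_comp_mul_deriv_eq_zero_of_full_turn {u v : ℝ} {h x x' : ℝ → ℝ} (huv : u ≤ v)
    (hx : ∀ t ∈ Icc u v, HasDerivAt x (x' t) t) (hx' : ∀ t ∈ Icc u v, x' t ≠ 0)
    (hturn : x v - x u = 2 * π ∨ x v - x u = -(2 * π))
    (hper : Function.Periodic h (2 * π)) (hzero : (∫ ξ in (0 : ℝ)..(2 * π), h ξ) = 0) :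
    ∫ t in u..v, h (x t) * x' t = 0 := by
  have hcont : ContinuousOn x (uIcc u v) := by
    rw [uIcc_of_le huv]
    exact fun t ht => (hx t ht).continuousAt.continuousWithinAt
  have hderiv : ∀ t ∈ Ioo (min u v) (max u v), HasDerivAt x (x' t) t := by
    rw [min_eq_left huv, max_eq_right huv]
    exact fun t ht => hx t (Ioo_subset_Icc_self ht)
  have hsub : ∫ t in u..v, (h ∘ x) t * x' t = ∫ ξ in x u..x v, h ξ := by
    rcases hasDerivWithinAt_forall_lt_or_forall_gt_of_forall_ne (convex_Icc u v)
      (fun t ht => (hx t ht).hasDerivWithinAt) hx' with hneg | hpos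
    · refine integral_comp_mul_deriv_of_deriv_nonpos hcont hderiv ?_
      rw [min_eq_left huv, max_eq_right huv]
      exact fun t ht => (hneg t (Ioo_subset_Icc_self ht)).le
    · refine integral_comp_mul_deriv_of_deriv_nonneg hcont hderiv ?_
      rw [min_eq_left huv, max_eq_right huv]
      exact fun t ht => (hpos t (Ioo_subset_Icc_self ht)).le
  have hperiod : ∀ r, ∫ ξ in r..r + 2 * π, h ξ = 0 := fun r => by
    rw [hper.intervalIntegral_add_eq r 0, zero_add, hzero]
  refine hsub.trans ?_
  rcases hturn with hturn | hturn
  · rw [show x v = x u + 2 * π by linarith, hperiod]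
  · rw [show x u = x v + 2 * π by linarith, integral_symm, hperiod, neg_zero]

/-- Averaging estimate over one full turn: the integral of `h ∘ x` is controlled by the relative
deviation of the speed `x'` from a constant `c`. -/
theorem abs_integral_comp_le_of_full_turn {u v c H : ℝ} {h x x' g : ℝ → ℝ} (huv : u ≤ v)
    (hx : ∀ t ∈ Icc u v, HasDerivAt x (x' t) t) (hx'c : ContinuousOn x' (Icc u v))
    (hx' : ∀ t ∈ Icc u v, x' t ≠ 0)
    (hturn : x v - x u = 2 * π ∨ x v - x u = -(2 * π))
    (hm : Measurable h) (hH : ∀ ξ, |h ξ| ≤ H)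
    (hper : Function.Periodic h (2 * π)) (hzero : (∫ ξ in (0 : ℝ)..(2 * π), h ξ) = 0)
    (hc : c ≠ 0) (hg : ContinuousOn g (Icc u v))
    (hdev : ∀ t ∈ Icc u v, |c - x' t| ≤ |c| * g t) :
    |∫ t in u..v, h (x t)| ≤ H * ∫ t in u..v, g t := by
  have hxc : ContinuousOn x (Icc u v) := fun t ht => (hx t ht).continuousAt.continuousWithinAt
  have hhx := intervalIntegrable_comp_of_bounded_s3 hm hH hxc huv
  have hx'u : ContinuousOn x' (uIcc u v) := by rwa [uIcc_of_le huv]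
  have hgu : ContinuousOn g (uIcc u v) := by rwa [uIcc_of_le huv]
  have hprod : IntervalIntegrable (fun t => h (x t) * x' t) MeasureTheory.volume u v :=
    hhx.mul_continuousOn hx'u
  have hkey : ∫ t in u..v, h (x t) = ∫ t in u..v, h (x t) * (1 - x' t / c) := by
    have hfun : (fun t => h (x t) * (1 - x' t / c)) =
        fun t => h (x t) - h (x t) * x' t / c := by
      funext t; ring
    rw [hfun, integral_sub hhx (hprod.div_const c), integral_div,
      integral_comp_mul_deriv_eq_zero_of_full_turn huv hx hx' hturn hper hzero]
    simp
  have hint : IntervalIntegrable (fun t => h (x t) * (1 - x' t / c)) MeasureTheory.volume u v :=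
    hhx.mul_continuousOn (continuousOn_const.sub (hx'u.div_const c))
  rw [hkey, ← integral_const_mul]
  refine (abs_integral_le_integral_abs huv).trans
    (integral_mono_on huv hint.abs (hgu.intervalIntegrable.const_mul H) fun t ht => ?_)
  rw [abs_mul]
  refine mul_le_mul (hH _) ?_ (abs_nonneg _) ((abs_nonneg _).trans (hH 0))
  rw [one_sub_div hc, abs_div, div_le_iff₀ (abs_pos.2 hc), mul_comm]
  exact hdev t ht

/-- The perturbation `γ cos y + a` changes the size of `b z` at most by a factor of two. -/
theorem half_mul_abs_le_abs_add {γ a b δ y z : ℝ} (hγ : |γ| ≤ 1) (hb : 0 < b)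
    (ha : |a| + 1 ≤ b * δ / 2) (hz : δ ≤ |z|) :
    b * |z| / 2 ≤ |γ * Real.cos y + a + b * z| := by
  have h1 : |γ * Real.cos y| ≤ 1 := by
    rw [abs_mul]
    exact mul_le_one₀ hγ (abs_nonneg _) (Real.abs_cos_le_one y)
  have h2 : b * |z| = |b * z| := by rw [abs_mul, abs_of_pos hb]
  have h3 : b * δ ≤ b * |z| := mul_le_mul_of_nonneg_left hz hb.le
  have h4 : |b * z| ≤ |γ * Real.cos y + a + b * z| + |γ * Real.cos y + a| := by
    have := abs_sub (γ * Real.cos y + a + b * z) (γ * Real.cos y + a)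
    rwa [add_sub_cancel_left] at this
  have h5 := abs_add_le (γ * Real.cos y) a
  linarith

open Real Set intervalIntegral

/-- Integral estimate over a "type 3" segment: a segment staying away
from the zeros of `cos t` on which the solution makes exactly one full turn. For any
bounded measurable `2π`-periodic `h` with zero average, the integral of `h ∘ x` over the
segment is bounded via `∫ C (1/(b|cos t|) + μ/(b cos² t)) dt`. -/
theorem integral_type3_segment :
    ∃ Ca Cb C : ℝ, 0 < Ca ∧ 0 < Cb ∧ 0 < C ∧
      ∀ (γ a b μ δ tminus tplus : ℝ) (x : ℝ → ℝ),
        |γ| ≤ 1 → 0 < b → 0 < μ → 0 < δ → δ ≤ 1 →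
        |a| + 1 ≤ b * δ / Ca → Cb * Real.sqrt (μ / b) ≤ δ →
        Set.Icc tminus tplus ⊆ Set.Icc (0 : ℝ) (2 * π) → tminus ≤ tplus →
        (∀ t ∈ Set.Icc tminus tplus,
          HasDerivAt x ((γ * Real.cos (x t) + a + b * Real.cos t) / μ) t) →
        (∀ t ∈ Set.Icc tminus tplus, δ ≤ |Real.cos t|) →
        (x tplus - x tminus = 2 * π ∨ x tplus - x tminus = -(2 * π)) →
        ∀ h : ℝ → ℝ, Measurable h → BddAbove (Set.range fun ξ => |h ξ|) →
          (∀ ξ, h (ξ + 2 * π) = h ξ) → (∫ ξ in (0 : ℝ)..(2 * π), h ξ) = 0 →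
          |∫ τ in tminus..tplus, h (x τ)| ≤ (⨆ ξ, |h ξ|) *
            ∫ t in tminus..tplus,
              C * (1 / (b * |Real.cos t|) + μ / (b * Real.cos t ^ 2)) := by
  refine ⟨2, 6, 104, by norm_num, by norm_num, by norm_num, ?_⟩
  intro γ a b μ δ u v x hγ hb hμ hδ _ ha hCb _ huv hx hcos hturn h hm hbdd hper hzero
  have hπ := Real.pi_pos
  have hπ' := Real.pi_lt_d2
  have hxc : ContinuousOn x (Icc u v) := fun t ht => (hx t ht).continuousAt.continuousWithinAt
  have hlt : u < v := huv.lt_of_ne fun heq => by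
    subst heq
    rcases hturn with hturn | hturn <;> linarith
  obtain ⟨ξ, hξ, hslope⟩ := exists_hasDerivAt_eq_slope x _ hlt hxc
    fun t ht => hx t (Ioo_subset_Icc_self ht)
  have hξ' := Ioo_subset_Icc_self hξ
  have hT : 0 < v - u := sub_pos.2 hlt
  have hμT : b * |Real.cos ξ| * (v - u) ≤ 4 * π * μ := by
    have h1 := half_mul_abs_le_abs_add (y := x ξ) hγ hb ha (hcos ξ hξ')
    have h2 : |x v - x u| = 2 * π := by
      rcases hturn with hturn | hturn <;> simp [hturn, abs_of_pos hπ]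
    rw [div_eq_div_iff hμ.ne' hT.ne'] at hslope
    have h3 := congrArg abs hslope
    rw [abs_mul, abs_mul, h2, abs_of_pos hT, abs_of_pos hμ] at h3
    nlinarith
  have hsmall : v - u ≤ δ / 2 := by
    have h1 : 36 * μ ≤ b * δ ^ 2 := by
      have h2 : (6 * √(μ / b)) ^ 2 ≤ δ ^ 2 := pow_le_pow_left₀ (by positivity) hCb 2
      rw [mul_pow, Real.sq_sqrt (by positivity)] at h2
      have h3 := mul_le_mul_of_nonneg_left h2 hb.le
      have h4 : b * (6 ^ 2 * (μ / b)) = 36 * μ := by field_simp; norm_num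
      linarith
    have h2 : b * δ * (v - u) ≤ 4 * π * μ := by
      refine le_trans ?_ hμT
      gcongr
      exact hcos ξ hξ'
    have h3 : b * δ * (v - u) ≤ b * δ * (δ / 2) := by nlinarith
    exact le_of_mul_le_mul_left h3 (by positivity)
  have hdist : ∀ s ∈ Icc u v, ∀ t ∈ Icc u v, |Real.cos s - Real.cos t| ≤ v - u :=
    fun s hs t ht => (Real.abs_cos_sub_cos_le s t).trans
      (abs_le.2 ⟨by linarith [hs.1, ht.2], by linarith [hs.2, ht.1]⟩)
  have hcomp : ∀ s ∈ Icc u v, ∀ t ∈ Icc u v, |Real.cos t| / 2 ≤ |Real.cos s| := by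
    intro s hs t ht
    have h1 := abs_sub_abs_le_abs_sub (Real.cos t) (Real.cos s)
    have h2 := hdist t ht s hs
    have h3 := hcos t ht
    linarith
  have hu : u ∈ Icc u v := left_mem_Icc.2 huv
  have hcu := half_mul_abs_le_abs_add (γ := 0) (y := 0) (by simp) hb ha (hcos u hu)
  rw [zero_mul, zero_add] at hcu
  have hcos0 : ∀ t ∈ Icc u v, 0 < |Real.cos t| := fun t ht => hδ.trans_le (hcos t ht)
  have hc : a + b * Real.cos u ≠ 0 := by
    refine abs_pos.1 (lt_of_lt_of_le ?_ hcu)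
    have := hcos0 u hu
    positivity
  refine abs_integral_comp_le_of_full_turn (c := (a + b * Real.cos u) / μ) huv hx ?_ ?_ hturn hm
    (fun ξ => le_ciSup hbdd ξ) hper hzero (div_ne_zero hc hμ.ne') ?_ ?_
  · exact (((continuousOn_const.mul (Real.continuous_cos.comp_continuousOn hxc)).add
      continuousOn_const).add
      (continuous_const.mul Real.continuous_cos).continuousOn).div_const μ
  · intro t ht
    refine div_ne_zero (abs_pos.1 (lt_of_lt_of_le ?_
      (half_mul_abs_le_abs_add hγ hb ha (hcos t ht)))) hμ.ne'
    have := hcos0 t ht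
    positivity
  · refine continuousOn_const.mul ((continuousOn_const.div ?_ ?_).add
      (continuousOn_const.div ?_ ?_))
    · exact (continuous_const.mul Real.continuous_cos.abs).continuousOn
    · exact fun t ht => (mul_pos hb (hcos0 t ht)).ne'
    · exact (continuous_const.mul (Real.continuous_cos.pow 2)).continuousOn
    · exact fun t ht => mul_ne_zero hb.ne' (pow_ne_zero 2 (abs_pos.1 (hcos0 t ht)))
  · intro t ht
    have hct := hcos0 t ht
    rw [← sub_div, abs_div, abs_div, abs_of_pos hμ, div_mul_eq_mul_div]
    refine div_le_div_of_nonneg_right ?_ hμ.le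
    rw [← sq_abs (Real.cos t)]
    have hdev : |a + b * Real.cos u - (γ * Real.cos (x t) + a + b * Real.cos t)|
        ≤ b * (v - u) + 1 := by
      have h1 : |γ * Real.cos (x t)| ≤ 1 := by
        rw [abs_mul]
        exact mul_le_one₀ hγ (abs_nonneg _) (Real.abs_cos_le_one _)
      have h2 : |b * (Real.cos u - Real.cos t)| ≤ b * (v - u) := by
        rw [abs_mul, abs_of_pos hb]
        exact mul_le_mul_of_nonneg_left (hdist u hu t ht) hb.le
      calc _ = |b * (Real.cos u - Real.cos t) - γ * Real.cos (x t)| := by ring_nf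
        _ ≤ _ := (abs_sub _ _).trans (add_le_add h2 h1)
    have hlen : b * (v - u) ≤ 26 * (μ / |Real.cos t|) := by
      rw [← mul_div_assoc, le_div_iff₀ hct]
      have h1 := mul_le_mul_of_nonneg_left (hcomp ξ hξ' t ht) (mul_pos hb hT).le
      nlinarith
    have hlow : b * |Real.cos t| / 4 ≤ |a + b * Real.cos u| := by
      have h1 := mul_le_mul_of_nonneg_left (hcomp u hu t ht) hb.le
      linarith
    calc _ ≤ b * (v - u) + 1 := hdev
      _ ≤ 26 * (1 + μ / |Real.cos t|) := by linarith
      _ = b * |Real.cos t| / 4 *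
          (104 * (1 / (b * |Real.cos t|) + μ / (b * |Real.cos t| ^ 2))) := by
        field_simp
        norm_num
      _ ≤ _ := mul_le_mul_of_nonneg_right hlow (by positivity)
end

section
/- There exist positive constants C₁, C₂, K₁, K₂ such that the following holds. Let a ∈ ℝ, b > 0, μ > 0 satisfy |a| + 1 ≤ C₁·√(bμ) and b ≥ C₂·μ. Then for every t* ∈ [0, 2π] and every differentiable function x : [0, 2π] → ℝ with x'(t) = (cos(x(t)) + a + b·cos t)/μ one has | ∫₀^{t*} cos(x(t)) dt | ≤ K₁·√(μ/b) + (K₂/b)·ln(b/μ). -/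
open Real Set intervalIntegral

/-- Non-stationary phase estimate on an interval where the right-hand side `f` of `μ x' = f` is
bounded below by a multiple of the distance `σ (t - c)` to a point `c`. -/
lemma abs_integral_cos_le_of_dist_le {a b μ c σ δ p q : ℝ} {x : ℝ → ℝ} (hb : 0 < b) (hμ : 0 < μ)
    (hδ : 0 < δ) (hσ : σ = 1 ∨ σ = -1) (hpq : p ≤ q)
    (hx : ∀ t ∈ Icc p q, HasDerivAt x ((cos (x t) + a + b * cos t) / μ) t)
    (hd : ∀ t ∈ Icc p q, δ ≤ σ * (t - c) ∧ σ * (t - c) ≤ 2)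
    (hf : ∀ t ∈ Icc p q, b * (σ * (t - c)) / 4 ≤ |cos (x t) + a + b * cos t|) :
    |∫ t in p..q, cos (x t)| ≤ 4 / b * (log 2 - log δ) + 24 * (μ / (b * δ)) := by
  have hI : uIcc p q = Icc p q := uIcc_of_le hpq
  have hp : p ∈ Icc p q := ⟨le_rfl, hpq⟩
  have hq : q ∈ Icc p q := ⟨hpq, le_rfl⟩
  have hσ2 : σ * σ = 1 := by rcases hσ with rfl | rfl <;> norm_num
  set f : ℝ → ℝ := fun t => cos (x t) + a + b * cos t with hfdef
  have hd0 : ∀ t ∈ Icc p q, 0 < σ * (t - c) := fun t ht => hδ.trans_le (hd t ht).1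
  have hfpos : ∀ t ∈ Icc p q, 0 < |f t| := fun t ht =>
    lt_of_lt_of_le (by have := hd0 t ht; positivity) (hf t ht)
  have hf0 : ∀ t ∈ Icc p q, f t ≠ 0 := fun t ht => abs_pos.1 (hfpos t ht)
  have hxc : ContinuousOn x (Icc p q) := fun t ht => (hx t ht).continuousAt.continuousWithinAt
  have hfc : ContinuousOn f (Icc p q) := by fun_prop
  set r : ℝ → ℝ := fun t => sin (x t) ^ 2 / f t + μ * b * sin (x t) * sin t / f t ^ 2 with hr
  have hrc : ContinuousOn r (Icc p q) := by
    apply ContinuousOn.add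
    · exact ContinuousOn.div (by fun_prop) hfc hf0
    · exact ContinuousOn.div (by fun_prop) (by fun_prop) fun t ht => pow_ne_zero 2 (hf0 t ht)
  have hcosc : ContinuousOn (fun t => cos (x t)) (Icc p q) := by fun_prop
  have hS : ∀ t ∈ Icc p q, HasDerivAt (fun t => μ * sin (x t) / f t) (cos (x t) + r t) t := by
    intro t ht
    have h1 := hx t ht
    have hf' : HasDerivAt f (-sin (x t) * (f t / μ) + b * -sin t) t :=
      (h1.cos.add_const a).add ((hasDerivAt_cos t).const_mul b)
    refine ((h1.sin.const_mul μ).div hf' (hf0 t ht)).congr_deriv (Eq.symm ?_)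
    have := hf0 t ht
    change cos (x t) + (sin (x t) ^ 2 / f t + μ * b * sin (x t) * sin t / f t ^ 2) =
      (μ * (cos (x t) * (f t / μ)) * f t -
        μ * sin (x t) * (-sin (x t) * (f t / μ) + b * -sin t)) / f t ^ 2
    field_simp
    ring
  have hint : ∫ t in p..q, (cos (x t) + r t) = μ * sin (x q) / f q - μ * sin (x p) / f p :=
    integral_eq_sub_of_hasDerivAt (f := fun t => μ * sin (x t) / f t)
      (fun t ht => hS t (hI ▸ ht))
      ((hcosc.add hrc).intervalIntegrable_of_Icc hpq)
  rw [integral_add (hcosc.intervalIntegrable_of_Icc hpq) (hrc.intervalIntegrable_of_Icc hpq)]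
    at hint
  set m : ℝ → ℝ := fun t => 4 / b * (1 / (σ * (t - c))) + 16 * μ / b * (1 / (σ * (t - c)) ^ 2)
    with hm
  have hmc : ContinuousOn m (Icc p q) := by
    refine ContinuousOn.add (ContinuousOn.mul continuousOn_const ?_)
      (ContinuousOn.mul continuousOn_const ?_)
    · exact ContinuousOn.div (by fun_prop) (by fun_prop) fun t ht => (hd0 t ht).ne'
    · exact ContinuousOn.div (by fun_prop) (by fun_prop) fun t ht =>
        pow_ne_zero 2 (hd0 t ht).ne'
  have hM : ∀ t ∈ Icc p q, HasDerivAt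
      (fun t => 4 / b * (σ * log (σ * (t - c))) - 16 * μ / b * (σ * (σ * (t - c))⁻¹)) (m t) t := by
    intro t ht
    have h0 := (hd0 t ht).ne'
    have h1 : HasDerivAt (fun t => σ * (t - c)) (σ * 1) t :=
      ((hasDerivAt_id t).sub_const c).const_mul σ
    refine ((((h1.log h0).const_mul σ).const_mul (4 / b)).sub
      (((h1.inv h0).const_mul σ).const_mul (16 * μ / b))).congr_deriv (Eq.symm ?_)
    have e1 : σ * (σ * 1 / (σ * (t - c))) = 1 / (σ * (t - c)) := by
      rw [← mul_div_assoc, mul_one, hσ2]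
    have e2 : σ * (-(σ * 1) / (σ * (t - c)) ^ 2) = -(1 / (σ * (t - c)) ^ 2) := by
      rw [← mul_div_assoc, mul_one, mul_neg, hσ2, neg_div]
    rw [e1, e2]
    simp only [hm]
    ring
  have hmint := integral_eq_sub_of_hasDerivAt (fun t ht => hM t (hI ▸ ht))
    (hmc.intervalIntegrable_of_Icc hpq)
  have hrm : ∀ t ∈ Icc p q, |r t| ≤ m t := by
    intro t ht
    have hD := hd0 t ht
    have hF := hf t ht
    have hlow : 0 < b * (σ * (t - c)) / 4 := by positivity
    refine (abs_add_le _ _).trans (add_le_add ?_ ?_)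
    · rw [abs_div, abs_of_nonneg (sq_nonneg _)]
      calc sin (x t) ^ 2 / |f t| ≤ 1 / (b * (σ * (t - c)) / 4) :=
            div_le_div₀ zero_le_one (sin_sq_le_one _) hlow hF
        _ = _ := by field_simp
    · rw [abs_div, abs_pow, abs_mul, abs_mul, abs_of_pos (mul_pos hμ hb)]
      calc μ * b * |sin (x t)| * |sin t| / |f t| ^ 2
          ≤ μ * b * 1 * 1 / (b * (σ * (t - c)) / 4) ^ 2 := by
            gcongr
            · exact abs_sin_le_one _
            · exact abs_sin_le_one _
        _ = _ := by field_simp; norm_num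
  have hrint : |∫ t in p..q, r t| ≤ ∫ t in p..q, m t := by
    rw [← Real.norm_eq_abs]
    refine norm_integral_le_of_norm_le hpq (Filter.Eventually.of_forall fun t ht => ?_)
      (hmc.intervalIntegrable_of_Icc hpq)
    exact hrm t (Ioc_subset_Icc_self ht)
  have hbd : ∀ t ∈ Icc p q, |μ * sin (x t) / f t| ≤ 4 * (μ / (b * δ)) := by
    intro t ht
    rw [abs_div, abs_mul, abs_of_pos hμ]
    calc μ * |sin (x t)| / |f t| ≤ μ * 1 / (b * δ / 4) := by
          gcongr
          · exact abs_sin_le_one _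
          · refine le_trans ?_ (hf t ht)
            have := (hd t ht).1
            gcongr
      _ = _ := by field_simp
  have hlog : ∀ t ∈ Icc p q, log δ ≤ log (σ * (t - c)) ∧ log (σ * (t - c)) ≤ log 2 :=
    fun t ht => ⟨log_le_log hδ (hd t ht).1, log_le_log (hd0 t ht) (hd t ht).2⟩
  have hinv : ∀ t ∈ Icc p q, 0 ≤ (σ * (t - c))⁻¹ ∧ (σ * (t - c))⁻¹ ≤ δ⁻¹ :=
    fun t ht => ⟨(inv_pos.2 (hd0 t ht)).le, inv_anti₀ hδ (hd t ht).1⟩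
  have hmle : ∫ t in p..q, m t ≤ 4 / b * (log 2 - log δ) + 16 * μ / b * δ⁻¹ := by
    have e1 : σ * log (σ * (q - c)) - σ * log (σ * (p - c)) ≤ log 2 - log δ := by
      have := hlog p hp
      have := hlog q hq
      rcases hσ with h | h <;> nth_rw 1 [h] <;> nth_rw 2 [h] <;> linarith
    have e2 : σ * (σ * (p - c))⁻¹ - σ * (σ * (q - c))⁻¹ ≤ δ⁻¹ := by
      have := hinv p hp
      have := hinv q hq
      rcases hσ with rfl | rfl <;> linarith
    have e3 := mul_le_mul_of_nonneg_left e1 (by positivity : 0 ≤ 4 / b)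
    have e4 := mul_le_mul_of_nonneg_left e2 (by positivity : 0 ≤ 16 * μ / b)
    rw [hmint]
    linarith
  have e : 16 * μ / b * δ⁻¹ = 16 * (μ / (b * δ)) := by field_simp
  have b1 := abs_le.1 (hbd p hp)
  have b2 := abs_le.1 (hbd q hq)
  have b3 := abs_le.1 (hrint.trans hmle)
  rw [e] at b3
  rw [abs_le]
  constructor <;> linarith

/-- Jordan's inequality around the zeros of the cosine: `hshift` says that `c` is such a zero. -/
lemma half_dist_le_abs_cos {c σ t : ℝ} (hshift : |cos t| = |sin (σ * (t - c))|)
    (h0 : 0 ≤ σ * (t - c)) (h1 : σ * (t - c) ≤ π / 2) : σ * (t - c) / 2 ≤ |cos t| := by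
  rw [hshift]
  refine le_trans ?_ ((mul_le_sin h0 h1).trans (le_abs_self _))
  have : 1 / 2 ≤ 2 / π := by
    rw [div_le_div_iff₀ two_pos pi_pos]; linarith [pi_le_four]
  nlinarith

/-- (Proposition on smallness of `∫ cos x(t) dt` for the Josephson
equation `dx/dt = (cos x + a + b cos t)/μ`.) -/
theorem integral_cos_small :
    ∃ C₁ C₂ K₁ K₂ : ℝ, 0 < C₁ ∧ 0 < C₂ ∧ 0 < K₁ ∧ 0 < K₂ ∧
      ∀ (a b μ : ℝ), 0 < b → 0 < μ →
        |a| + 1 ≤ C₁ * Real.sqrt (b * μ) → C₂ * μ ≤ b →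
        ∀ tstar ∈ Set.Icc (0 : ℝ) (2 * π), ∀ x : ℝ → ℝ,
          (∀ t ∈ Set.Icc (0 : ℝ) (2 * π),
            HasDerivAt x ((Real.cos (x t) + a + b * Real.cos t) / μ) t) →
          |∫ t in (0 : ℝ)..tstar, Real.cos (x t)|
            ≤ K₁ * Real.sqrt (μ / b) + (K₂ / b) * Real.log (b / μ) := by
  refine ⟨1 / 4, 16, 100, 16, by norm_num, by norm_num, by norm_num, by norm_num, ?_⟩
  intro a b μ hb hμ ha hbμ T hT x hx
  set δ := √(μ / b) with hδdef
  have hδ : 0 < δ := sqrt_pos.2 (by positivity)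
  have hδ2 : δ ^ 2 = μ / b := sq_sqrt (by positivity)
  have hμb : μ = b * δ ^ 2 := by rw [hδ2]; field_simp
  have hδ4 : δ ≤ 1 / 4 := by
    have : μ / b ≤ 1 / 16 := by rw [div_le_iff₀ hb]; linarith
    nlinarith
  have hsq : √(b * μ) = b * δ := by
    rw [hμb, show b * (b * δ ^ 2) = (b * δ) ^ 2 by ring, sqrt_sq (by positivity)]
  have hμδ : μ / (b * δ) = δ := by nth_rw 1 [hμb]; field_simp
  have hL : log 2 - log δ ≤ log (b / μ) := by
    have h1 : log δ = -(log (b / μ) / 2) := by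
      rw [hδdef, log_sqrt (by positivity), ← inv_div b μ, log_inv]; ring
    have h2 : 2 * log 2 ≤ log (b / μ) := by
      have h4 : (2 : ℝ) * log 2 = log (2 ^ 2) := by rw [log_pow]; norm_num
      rw [h4]
      refine log_le_log (by norm_num) ?_
      rw [le_div_iff₀ hμ]; linarith
    linarith
  have hpi3 := pi_gt_three
  have hpi4 := pi_le_four
  have hxc : ContinuousOn (fun t => cos (x t)) (Icc 0 (2 * π)) := fun t ht =>
    (hx t ht).cos.continuousAt.continuousWithinAt
  have hii : ∀ u v, 0 ≤ u → 0 ≤ v →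
      IntervalIntegrable (fun t => cos (x t)) MeasureTheory.volume (min T u) (min T v) := by
    intro u v hu hv
    refine (hxc.mono ?_).intervalIntegrable
    intro t ht
    exact ⟨(le_min (le_min hT.1 hu) (le_min hT.1 hv)).trans ht.1,
      ht.2.trans (max_le ((min_le_left _ _).trans hT.2) ((min_le_left _ _).trans hT.2))⟩
  have hgood : ∀ c σ u v : ℝ, (σ = 1 ∨ σ = -1) → 0 ≤ u → u ≤ v → v ≤ 2 * π →
      (∀ t, |cos t| = |sin (σ * (t - c))|) →
      (∀ t ∈ Icc u v, δ ≤ σ * (t - c) ∧ σ * (t - c) ≤ π / 2) →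
      |∫ t in (min T u)..(min T v), cos (x t)| ≤ 4 / b * log (b / μ) + 24 * δ := by
    intro c σ u v hσ hu huv hv hshift hd
    have hlogpos : 0 ≤ log (b / μ) := log_nonneg (by rw [le_div_iff₀ hμ]; linarith)
    rcases le_total T u with hTu | hTu
    · rw [min_eq_left hTu, min_eq_left (hTu.trans huv), integral_same, abs_zero]
      positivity
    rw [min_eq_right hTu]
    have hsub : Icc u (min T v) ⊆ Icc u v := Icc_subset_Icc_right (min_le_right _ _)
    have := abs_integral_cos_le_of_dist_le (a := a) (c := c) (x := x) hb hμ hδ hσ (le_min hTu huv)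
      (fun t ht => hx t ⟨hu.trans ht.1, (hsub ht).2.trans hv⟩)
      (fun t ht => ⟨(hd t (hsub ht)).1, (hd t (hsub ht)).2.trans (by linarith)⟩) ?_
    · rw [hμδ] at this
      refine this.trans ?_
      gcongr
    · intro t ht
      obtain ⟨h1, h2⟩ := hd t (hsub ht)
      have hJ := half_dist_le_abs_cos (hshift t) (hδ.le.trans h1) h2
      have hJb := mul_le_mul_of_nonneg_left hJ hb.le
      have hdb := mul_le_mul_of_nonneg_left h1 hb.le
      have htri : |b * cos t| ≤ |cos (x t) + a + b * cos t| + (|a| + |cos (x t)|) := by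
        have h3 := abs_sub (cos (x t) + a + b * cos t) (cos (x t) + a)
        have h4 := abs_add_le (cos (x t)) a
        rw [add_sub_cancel_left] at h3
        linarith
      rw [abs_mul, abs_of_pos hb] at htri
      have := abs_cos_le_one (x t)
      rw [hsq] at ha
      linarith
  have hbad : ∀ u v : ℝ, u ≤ v → v - u ≤ 2 * δ →
      |∫ t in (min T u)..(min T v), cos (x t)| ≤ 2 * δ := by
    intro u v huv hle
    have h := norm_integral_le_of_norm_le_const (a := min T u) (b := min T v) (C := 1)
      (f := fun t => cos (x t)) (fun t _ => abs_cos_le_one _)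
    rw [Real.norm_eq_abs, one_mul, abs_of_nonneg (sub_nonneg.2 (min_le_min_left T huv))] at h
    refine h.trans (le_trans ?_ hle)
    rcases le_total T u with h1 | h1
    · rw [min_eq_left h1, min_eq_left (h1.trans huv)]; linarith
    · rw [min_eq_right h1]; linarith [min_le_right T v]
  have z1 : ∀ t, |cos t| = |sin (-1 * (t - π / 2))| := fun t => by
    rw [neg_one_mul, neg_sub, sin_pi_div_two_sub]
  have z2 : ∀ t, |cos t| = |sin (1 * (t - π / 2))| := fun t => by
    rw [one_mul, sin_sub_pi_div_two, abs_neg]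
  have z4 : ∀ t, |cos t| = |sin (1 * (t - 3 * π / 2))| := fun t => by
    rw [one_mul, show t - 3 * π / 2 = t + π / 2 - 2 * π by ring, sin_sub_two_pi,
      sin_add_pi_div_two]
  have z3 : ∀ t, |cos t| = |sin (-1 * (t - 3 * π / 2))| := fun t => by
    rw [neg_one_mul, sin_neg, abs_neg, z4 t, one_mul]
  have g1 := hgood (π / 2) (-1) 0 (π / 2 - δ) (.inr rfl) le_rfl (by linarith) (by linarith) z1
    fun t ht => ⟨by linarith [ht.2], by linarith [ht.1]⟩
  have g2 := hgood (π / 2) 1 (π / 2 + δ) π (.inl rfl) (by linarith) (by linarith) (by linarith) z2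
    fun t ht => ⟨by linarith [ht.1], by linarith [ht.2]⟩
  have g3 := hgood (3 * π / 2) (-1) π (3 * π / 2 - δ) (.inr rfl) (by linarith) (by linarith)
    (by linarith) z3 fun t ht => ⟨by linarith [ht.2], by linarith [ht.1]⟩
  have g4 := hgood (3 * π / 2) 1 (3 * π / 2 + δ) (2 * π) (.inl rfl) (by linarith) (by linarith)
    le_rfl z4 fun t ht => ⟨by linarith [ht.1], by linarith [ht.2]⟩
  have b1 := hbad (π / 2 - δ) (π / 2 + δ) (by linarith) (by linarith)
  have b2 := hbad (3 * π / 2 - δ) (3 * π / 2 + δ) (by linarith) (by linarith)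
  have hsplit : ∀ u v, 0 ≤ u → 0 ≤ v → (∫ t in (0 : ℝ)..(min T v), cos (x t)) =
      (∫ t in (0 : ℝ)..(min T u), cos (x t)) + ∫ t in (min T u)..(min T v), cos (x t) := by
    intro u v hu hv
    have h := hii 0 u le_rfl hu
    rw [min_eq_right hT.1] at h
    exact (integral_add_adjacent_intervals h (hii u v hu hv)).symm
  rw [min_eq_right hT.1] at g1
  have hfull : (∫ t in (0 : ℝ)..T, cos (x t)) = ∫ t in (0 : ℝ)..(min T (2 * π)), cos (x t) := by
    rw [min_eq_left hT.2]
  rw [hfull, hsplit (3 * π / 2 + δ) (2 * π) (by linarith) (by linarith),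
    hsplit (3 * π / 2 - δ) (3 * π / 2 + δ) (by linarith) (by linarith),
    hsplit π (3 * π / 2 - δ) (by linarith) (by linarith),
    hsplit (π / 2 + δ) π (by linarith) (by linarith),
    hsplit (π / 2 - δ) (π / 2 + δ) (by linarith) (by linarith)]
  have e : 16 / b * log (b / μ) = 4 * (4 / b * log (b / μ)) := by ring
  rw [abs_le] at *
  rw [e]
  constructor <;> linarith
end

section
/- There exist positive constants C₁, C₂, K₁, K₂ such that the following holds. If a ∈ ℝ, b > 0, μ > 0 satisfy |a| + 1 ≤ C₁·√(bμ) and b ≥ C₂·μ, then | a/μ − ρ_{a,b,μ} | ≤ K₁/√(bμ) + (K₂/(bμ))·ln(b/μ). -/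
open Real Filter

/-- `x` is a (global) solution of the Josephson equation `dx/dt = (cos x + a + b cos t)/μ`. -/
def IsJosephsonSol (a b μ : ℝ) (x : ℝ → ℝ) : Prop :=
  ∀ t : ℝ, HasDerivAt x ((Real.cos (x t) + a + b * Real.cos t) / μ) t

/-- `P` is the Poincaré lift of the Josephson equation: it sends `x₀` to `x(2π)`
for the solution with `x(0) = x₀`. -/
def IsPoincareLift (a b μ : ℝ) (P : ℝ → ℝ) : Prop :=
  ∀ x₀ : ℝ, ∃ x : ℝ → ℝ, IsJosephsonSol a b μ x ∧ x 0 = x₀ ∧ P x₀ = x (2 * π)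

/-- `ρ` is the rotation number of the lift `P`:
`ρ = lim (P^[n] x₀ - x₀) / (2πn)` for every `x₀`. -/
def IsRotNumber (P : ℝ → ℝ) (ρ : ℝ) : Prop :=
  ∀ x₀ : ℝ, Tendsto (fun n : ℕ => (P^[n] x₀ - x₀) / (2 * π * n)) atTop (nhds ρ)

/-- The deviation of a solution from the solution of the averaged equation `dx/dt = (a + b cos t)/μ`. -/
noncomputable def drift (a b μ : ℝ) (x : ℝ → ℝ) (t : ℝ) : ℝ :=
  x t - (a * t + b * Real.sin t) / μ

/-- The boundary term produced by integrating `cos x / μ` by parts. -/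
noncomputable def boundaryTerm (a b : ℝ) (x : ℝ → ℝ) (t : ℝ) : ℝ :=
  Real.sin (x t) / (Real.cos (x t) + a + b * Real.cos t)

lemma hasDerivAt_drift {a b μ : ℝ} {x : ℝ → ℝ} (hx : IsJosephsonSol a b μ x) (t : ℝ) :
    HasDerivAt (drift a b μ x) (Real.cos (x t) / μ) t := by
  have h := (hx t).sub
    ((((hasDerivAt_id t).const_mul a).add ((Real.hasDerivAt_sin t).const_mul b)).div_const μ)
  refine h.congr_deriv ?_
  ring

lemma hasDerivAt_drift_sub_boundaryTerm {a b μ : ℝ} {x : ℝ → ℝ} (hx : IsJosephsonSol a b μ x)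
    (hμ : μ ≠ 0) {t : ℝ} (hF : Real.cos (x t) + a + b * Real.cos t ≠ 0) :
    HasDerivAt (fun s => drift a b μ x s - boundaryTerm a b x s)
      (-(Real.sin (x t) ^ 2 / (μ * (Real.cos (x t) + a + b * Real.cos t))
        + b * Real.sin (x t) * Real.sin t / (Real.cos (x t) + a + b * Real.cos t) ^ 2)) t := by
  have hden : HasDerivAt (fun s => Real.cos (x s) + a + b * Real.cos s)
      (-Real.sin (x t) * ((Real.cos (x t) + a + b * Real.cos t) / μ) + b * -Real.sin t) t :=
    ((hx t).cos.add_const a).add ((Real.hasDerivAt_cos t).const_mul b)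
  refine ((hasDerivAt_drift hx t).sub ((hx t).sin.div hden hF)).congr_deriv ?_
  field_simp
  ring

lemma abs_cos_add_mul_of_cos_eq_zero {z ε u : ℝ} (hz : Real.cos z = 0) (hε : |ε| = 1) :
    |Real.cos (z + ε * u)| = |Real.sin u| := by
  have hs : |Real.sin z| = 1 := by
    have := Real.sin_sq_add_cos_sq z
    rw [hz] at this
    rw [← abs_one, ← sq_eq_sq_iff_abs_eq_abs]
    linarith
  rw [Real.cos_add, hz, zero_mul, zero_sub, abs_neg, abs_mul, hs, one_mul]
  rcases eq_or_eq_neg_of_abs_eq hε with rfl | rfl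
  · rw [one_mul]
  · rw [neg_one_mul, Real.sin_neg, abs_neg]

/-- A function whose derivative is at most `A / u + B / u ^ 2` on `[δ, L]`, with `δ > 0`,
varies by at most `A log (L / δ) + B / δ`. -/
lemma abs_sub_le_log_add_inv {f f' : ℝ → ℝ} {A B δ L : ℝ} (hδ : 0 < δ) (hδL : δ ≤ L) (hB : 0 ≤ B)
    (hf : ∀ u ∈ Set.Icc δ L, HasDerivAt f (f' u) u)
    (hbound : ∀ u ∈ Set.Icc δ L, |f' u| ≤ A / u + B / u ^ 2) :
    |f L - f δ| ≤ A * Real.log (L / δ) + B / δ := by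
  have hmajor : ∀ u ∈ Set.Icc δ L, HasDerivAt
      (fun v => A * (Real.log v - Real.log δ) + B * (δ⁻¹ - v⁻¹)) (A / u + B / u ^ 2) u := by
    intro u hu
    have hu0 : u ≠ 0 := (hδ.trans_le hu.1).ne'
    refine ((((Real.hasDerivAt_log hu0).sub_const _).const_mul A).add
      (((hasDerivAt_inv hu0).const_sub _).const_mul B)).congr_deriv ?_
    field_simp
  have key := image_norm_le_of_norm_deriv_right_le_deriv_boundary'
    (f := fun u => f u - f δ) (f' := f') (a := δ) (b := L)
    (B := fun v => A * (Real.log v - Real.log δ) + B * (δ⁻¹ - v⁻¹))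
    (B' := fun u => A / u + B / u ^ 2)
    (fun u hu => ((hf u hu).sub_const _).continuousAt.continuousWithinAt)
    (fun u hu => ((hf u (Set.Ico_subset_Icc_self hu)).sub_const _).hasDerivWithinAt)
    (by simp)
    (fun u hu => (hmajor u hu).continuousAt.continuousWithinAt)
    (fun u hu => (hmajor u (Set.Ico_subset_Icc_self hu)).hasDerivWithinAt)
    (fun u hu => hbound u (Set.Ico_subset_Icc_self hu))
    (Set.right_mem_Icc.2 hδL)
  have hL : 0 < L := hδ.trans_le hδL
  rw [Real.norm_eq_abs] at key
  rw [Real.log_div hL.ne' hδ.ne']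
  have hBL : 0 ≤ B * L⁻¹ := by positivity
  rw [div_eq_mul_inv B]
  linarith

lemma abs_drift_sub_le {a b μ : ℝ} {x : ℝ → ℝ} (hx : IsJosephsonSol a b μ x) (hμ : 0 < μ)
    (s t : ℝ) : |drift a b μ x t - drift a b μ x s| ≤ |t - s| / μ := by
  have h := convex_univ.norm_image_sub_le_of_norm_hasDerivWithin_le (C := 1 / μ)
    (fun u _ => (hasDerivAt_drift hx u).hasDerivWithinAt)
    (fun u _ => by
      rw [Real.norm_eq_abs, abs_div, abs_of_pos hμ]
      gcongr
      exact Real.abs_cos_le_one _)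
    (Set.mem_univ s) (Set.mem_univ t)
  simpa only [Real.norm_eq_abs, one_div_mul_eq_div] using h

/-- Bound on the drift over a quarter period adjacent to a zero `z` of the cosine. -/
lemma abs_drift_quarter_le {a b μ δ z ε : ℝ} {x : ℝ → ℝ} (hx : IsJosephsonSol a b μ x)
    (hb : 0 < b) (hμ : 0 < μ) (hδ : 0 < δ) (hδπ : δ ≤ π / 2) (ha : |a| + 1 ≤ b / π * δ)
    (hz : Real.cos z = 0) (hε : |ε| = 1) :
    |drift a b μ x (z + ε * (π / 2)) - drift a b μ x z| ≤
      δ / μ + (2 * π + π ^ 2) / (b * δ) + π / (μ * b) * Real.log (π / 2 / δ) := by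
  have hπ := Real.pi_pos
  set F : ℝ → ℝ := fun t => Real.cos (x t) + a + b * Real.cos t with hFdef
  have hF : ∀ u ∈ Set.Icc δ (π / 2), b * u / π ≤ |F (z + ε * u)| := by
    intro u hu
    have hu0 : 0 < u := hδ.trans_le hu.1
    have hcos : 2 / π * u ≤ |Real.cos (z + ε * u)| := by
      rw [abs_cos_add_mul_of_cos_eq_zero hz hε]
      exact (Real.mul_le_sin hu0.le hu.2).trans (le_abs_self _)
    have hsmall : |Real.cos (x (z + ε * u)) + a| ≤ b / π * u := by
      calc _ ≤ |Real.cos (x (z + ε * u))| + |a| := abs_add_le _ _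
        _ ≤ |a| + 1 := by linarith [Real.abs_cos_le_one (x (z + ε * u))]
        _ ≤ b / π * δ := ha
        _ ≤ b / π * u := by gcongr; exact hu.1
    have hlarge : b * (2 / π * u) ≤ |b * Real.cos (z + ε * u)| := by
      rw [abs_mul, abs_of_pos hb]
      gcongr
    have htri : |b * Real.cos (z + ε * u)| - |Real.cos (x (z + ε * u)) + a|
        ≤ |F (z + ε * u)| := by
      have h := abs_sub_abs_le_abs_sub (b * Real.cos (z + ε * u))
        (-(Real.cos (x (z + ε * u)) + a))
      rw [abs_neg] at h
      refine h.trans_eq ?_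
      rw [hFdef]
      ring_nf
    have hring : b * (2 / π * u) - b / π * u = b * u / π := by ring
    linarith
  have hlow : ∀ u ∈ Set.Icc δ (π / 2), 0 < b * u / π := fun u hu => by
    have := hδ.trans_le hu.1
    positivity
  have hboundary : ∀ u ∈ Set.Icc δ (π / 2),
      |boundaryTerm a b x (z + ε * u)| ≤ π / (b * δ) := by
    intro u hu
    have hFδ : b * δ / π ≤ |F (z + ε * u)| :=
      le_trans (by gcongr; exact hu.1) (hF u hu)
    calc |boundaryTerm a b x (z + ε * u)|
        = |Real.sin (x (z + ε * u))| / |F (z + ε * u)| := abs_div _ _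
      _ ≤ 1 / (b * δ / π) :=
        div_le_div₀ zero_le_one (Real.abs_sin_le_one _) (by positivity) hFδ
      _ = π / (b * δ) := by field_simp
  have hmain := abs_sub_le_log_add_inv (A := π / (μ * b)) (B := π ^ 2 / b) hδ hδπ (by positivity)
    (f := fun u => drift a b μ x (z + ε * u) - boundaryTerm a b x (z + ε * u))
    (f' := fun u => -(Real.sin (x (z + ε * u)) ^ 2 / (μ * F (z + ε * u))
        + b * Real.sin (x (z + ε * u)) * Real.sin (z + ε * u) / F (z + ε * u) ^ 2) * ε)
    (fun u hu => by
      have hne : F (z + ε * u) ≠ 0 := abs_pos.1 ((hlow u hu).trans_le (hF u hu))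
      have hlin : HasDerivAt (fun v => z + ε * v) ε u := by
        simpa using ((hasDerivAt_id u).const_mul ε).const_add z
      exact (hasDerivAt_drift_sub_boundaryTerm hx hμ.ne' hne).comp u hlin)
    (fun u hu => by
      have hu0 := hδ.trans_le hu.1
      have hl := hlow u hu
      have hFu := hF u hu
      have hs := Real.abs_sin_le_one (x (z + ε * u))
      have hst := Real.abs_sin_le_one (z + ε * u)
      rw [abs_mul, hε, mul_one, abs_neg]
      refine (abs_add_le _ _).trans (add_le_add ?_ ?_)
      · rw [abs_div, abs_mul, abs_of_pos hμ, abs_pow]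
        calc _ ≤ 1 / (μ * (b * u / π)) := by
              refine div_le_div₀ zero_le_one (pow_le_one₀ (abs_nonneg _) hs) (by positivity) ?_
              gcongr
          _ = π / (μ * b) / u := by field_simp
      · rw [abs_div, abs_mul, abs_mul, abs_of_pos hb, abs_pow]
        calc _ ≤ b * 1 * 1 / (b * u / π) ^ 2 := by gcongr
          _ = π ^ 2 / b / u ^ 2 := by field_simp)
  have hcore := abs_drift_sub_le hx hμ z (z + ε * δ)
  rw [add_sub_cancel_left, abs_mul, hε, one_mul, abs_of_pos hδ] at hcore
  have h1 := hboundary δ ⟨le_rfl, hδπ⟩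
  have h2 := hboundary (π / 2) ⟨hδπ, le_rfl⟩
  have hring : (2 * π + π ^ 2) / (b * δ) = π / (b * δ) + π / (b * δ) + π ^ 2 / b / δ := by
    field_simp
    ring
  rw [hring]
  rw [abs_le] at *
  constructor <;> linarith [hmain.1, hmain.2, hcore.1, hcore.2, h1.1, h1.2, h2.1, h2.2]

lemma abs_drift_period_le {a b μ δ : ℝ} {x : ℝ → ℝ} (hx : IsJosephsonSol a b μ x)
    (hb : 0 < b) (hμ : 0 < μ) (hδ : 0 < δ) (hδπ : δ ≤ π / 2) (ha : |a| + 1 ≤ b / π * δ) :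
    |x (2 * π) - x 0 - 2 * π * (a / μ)| ≤
      4 * (δ / μ + (2 * π + π ^ 2) / (b * δ) + π / (μ * b) * Real.log (π / 2 / δ)) := by
  have hz : Real.cos (π / 2 + π) = 0 := by rw [Real.cos_add_pi, Real.cos_pi_div_two, neg_zero]
  have h₁ := abs_drift_quarter_le (ε := -1) hx hb hμ hδ hδπ ha Real.cos_pi_div_two (by simp)
  have h₂ := abs_drift_quarter_le (ε := 1) hx hb hμ hδ hδπ ha Real.cos_pi_div_two (by simp)
  have h₃ := abs_drift_quarter_le (ε := -1) hx hb hμ hδ hδπ ha hz (by simp)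
  have h₄ := abs_drift_quarter_le (ε := 1) hx hb hμ hδ hδπ ha hz (by simp)
  rw [show π / 2 + -1 * (π / 2) = 0 by ring] at h₁
  rw [show π / 2 + 1 * (π / 2) = π by ring] at h₂
  rw [show π / 2 + π + -1 * (π / 2) = π by ring] at h₃
  rw [show π / 2 + π + 1 * (π / 2) = 2 * π by ring] at h₄
  have hdrift : x (2 * π) - x 0 - 2 * π * (a / μ)
      = drift a b μ x (2 * π) - drift a b μ x 0 := by
    simp only [drift, Real.sin_two_pi, Real.sin_zero]
    ring
  rw [hdrift]
  rw [abs_le] at *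
  constructor <;> linarith [h₁.1, h₁.2, h₂.1, h₂.2, h₃.1, h₃.2, h₄.1, h₄.2]

/-- A uniform bound on the displacement of a map bounds its rotation number. -/
lemma IsRotNumber.abs_sub_le {P : ℝ → ℝ} {ρ c E : ℝ} (hρ : IsRotNumber P ρ)
    (hP : ∀ y, |P y - y - 2 * π * c| ≤ E) : |c - ρ| ≤ E / (2 * π) := by
  have hiter : ∀ n : ℕ, |P^[n] 0 - 0 - 2 * π * n * c| ≤ n * E := by
    intro n
    induction n with
    | zero => simp
    | succ n ih =>
      rw [Function.iterate_succ_apply']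
      push_cast
      calc _ = |(P (P^[n] 0) - P^[n] 0 - 2 * π * c) + (P^[n] 0 - 0 - 2 * π * n * c)| := by
            ring_nf
        _ ≤ E + n * E := (abs_add_le _ _).trans (add_le_add (hP _) ih)
        _ = (n + 1) * E := by ring
  refine le_of_tendsto ((hρ 0).const_sub c).abs ?_
  filter_upwards [eventually_gt_atTop 0] with n hn
  have hn' : (0 : ℝ) < n := Nat.cast_pos.2 hn
  have hπ := Real.pi_pos
  have hrw : c - (P^[n] 0 - 0) / (2 * π * n)
      = -((P^[n] 0 - 0 - 2 * π * n * c) / (2 * π * n)) := by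
    field_simp
    ring
  rw [hrw, abs_neg, abs_div, abs_of_pos (show 0 < 2 * π * (n : ℝ) by positivity),
    div_le_div_iff₀ (by positivity) (by positivity)]
  calc _ ≤ n * E * (2 * π) := by gcongr; exact hiter n
    _ = E * (2 * π * n) := by ring

/-- (Theorem: the rotation number of the Josephson equation is close
to `a/μ` for large `b`.) -/
theorem rotation_number_close_to_a_div_mu :
    ∃ C₁ C₂ K₁ K₂ : ℝ, 0 < C₁ ∧ 0 < C₂ ∧ 0 < K₁ ∧ 0 < K₂ ∧
      ∀ (a b μ : ℝ) (P : ℝ → ℝ) (ρ : ℝ), 0 < b → 0 < μ →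
        IsPoincareLift a b μ P → IsRotNumber P ρ →
        |a| + 1 ≤ C₁ * Real.sqrt (b * μ) → C₂ * μ ≤ b →
        |a / μ - ρ| ≤ K₁ / Real.sqrt (b * μ) + (K₂ / (b * μ)) * Real.log (b / μ) := by
  have hπ := Real.pi_pos
  refine ⟨1 / π, 4, 4 * (1 + 2 * π + π ^ 2), 4 * π, by positivity, by norm_num, by positivity,
    by positivity, ?_⟩
  intro a b μ P ρ hb hμ hP hρ ha hbμ
  set r := Real.sqrt (b * μ)
  have hr0 : 0 < r := Real.sqrt_pos.2 (by positivity)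
  have hrsq : r ^ 2 = b * μ := Real.sq_sqrt (by positivity)
  have hδ : 0 < r / b := by positivity
  have hratio : 4 ≤ b / μ := (le_div_iff₀ hμ).2 hbμ
  have hδsq : (r / b) ^ 2 = (b / μ)⁻¹ := by
    rw [div_pow, hrsq]
    field_simp
  have hδhalf : r / b ≤ 1 / 2 := by
    refine abs_le_of_sq_le_sq' ?_ (by norm_num) |>.2
    rw [hδsq]
    exact (inv_anti₀ (by norm_num) hratio).trans (by norm_num)
  have hlog : Real.log (π / 2 / (r / b)) ≤ Real.log (b / μ) := by
    refine Real.log_le_log (by positivity) ?_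
    have hinv : b / μ = ((r / b) ^ 2)⁻¹ := by rw [hδsq, inv_inv]
    rw [hinv, div_le_iff₀ hδ]
    calc π / 2 ≤ 2 := by linarith [Real.pi_le_four]
      _ ≤ (r / b)⁻¹ := by
        rw [le_inv_comm₀ (by norm_num) hδ]
        linarith
      _ = ((r / b) ^ 2)⁻¹ * (r / b) := by field_simp
  have hdisp : ∀ y, |P y - y - 2 * π * (a / μ)| ≤
      4 * (r / b / μ + (2 * π + π ^ 2) / (b * (r / b))
        + π / (μ * b) * Real.log (π / 2 / (r / b))) := by
    intro y
    obtain ⟨x, hx, hx0, hPx⟩ := hP y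
    rw [hPx, ← hx0]
    refine abs_drift_period_le hx hb hμ hδ (by linarith [Real.pi_gt_three]) (ha.trans_eq ?_)
    field_simp
  have hE := hρ.abs_sub_le hdisp
  refine hE.trans ((div_le_self ((abs_nonneg _).trans (hdisp 0))
    (by linarith [Real.pi_gt_three])).trans ?_)
  have hwidth : r / b / μ = 1 / r := by
    rw [div_div, ← hrsq]
    field_simp
  rw [hwidth, mul_div_cancel₀ r hb.ne']
  calc _ ≤ 4 * (1 / r + (2 * π + π ^ 2) / r + π / (μ * b) * Real.log (b / μ)) := by gcongr
    _ = _ := by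
      field_simp
      ring
end

section
/- There exist positive constants C₁', C₂', K₁', K₂', K₃' such that the following holds. Let b > 0, μ > 0 and k ∈ ℤ satisfy |kμ| + 1 ≤ C₁'·√(bμ) and b ≥ C₂'·μ. Set J = (1/(2π)) ∫₀^{2π} cos(kt + (b/μ)·sin t) dt. (i) If a ∈ ℝ is such that the solution x of x'(t) = (cos(x(t)) + a + b·cos t)/μ with x(0) = 0 satisfies x(2π) = 2πk, then | a/μ − k + J/μ | ≤ (1/b)·( K₁' + K₂'/μ³ + K₃'·ln(b/μ) ). (ii) If a ∈ ℝ is such that the solution x with x(0) = π satisfies x(2π) = π + 2πk, then | a/μ − k − J/μ | ≤ (1/b)·( K₁' + K₂'/μ³ + K₃'·ln(b/μ) ). -/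
open Real Set intervalIntegral

open ComplexConjugate in
/-- First-derivative van der Corput estimates on an interval where the derivative `g` of the
phase is positive and decreasing: a bound for the oscillatory integral `z`, and an expansion of
the area swept by it. -/
theorem oscillatory_integral_bounds {φ g h : ℝ → ℝ} {z : ℝ → ℂ} {T : ℝ}
    (hφ : ∀ t, HasDerivAt φ (g t) t) (hg : ∀ t, HasDerivAt g (h t) t) (hh : Continuous h)
    (hz : ∀ t, HasDerivAt z (Complex.exp (φ t * Complex.I)) t) (hz0 : z 0 = 0) (hT : 0 ≤ T)
    (hpos : ∀ t ∈ Icc 0 T, 0 < g t) (hneg : ∀ t ∈ Icc 0 T, h t ≤ 0) :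
    (∀ t ∈ Icc 0 T, ‖z t‖ ≤ 2 / g t) ∧
    |(∫ t in (0 : ℝ)..T, (Complex.exp (φ t * Complex.I) * conj (z t)).im)
      - ∫ t in (0 : ℝ)..T, 1 / g t| ≤ 3 / g T ^ 2 := by
  have hφc : Continuous φ := continuous_iff_continuousAt.2 fun t => (hφ t).continuousAt
  have hgc : Continuous g := continuous_iff_continuousAt.2 fun t => (hg t).continuousAt
  have hzc : Continuous z := continuous_iff_continuousAt.2 fun t => (hz t).continuousAt
  set e : ℝ → ℂ := fun t => Complex.exp (φ t * Complex.I) with he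
  have hec : Continuous e := by fun_prop
  have hen : ∀ t, ‖e t‖ = 1 := fun t => Complex.norm_exp_ofReal_mul_I _
  have hed : ∀ t, HasDerivAt e (e t * (g t * Complex.I)) t := fun t =>
    (((hφ t).ofReal_comp).mul_const Complex.I).cexp
  set w : ℝ → ℂ := fun t => z t + e t * Complex.I / g t with hw
  have hgne : ∀ t ∈ Icc 0 T, (g t : ℂ) ≠ 0 := fun t ht => by
    exact_mod_cast (hpos t ht).ne'
  have hwd : ∀ t ∈ Icc 0 T, HasDerivAt w (-(e t * Complex.I * h t / g t ^ 2)) t := by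
    intro t ht
    have h1 := (hz t).add (((hed t).mul_const Complex.I).div (hg t).ofReal_comp (hgne t ht))
    refine h1.congr_deriv ?_
    have := hgne t ht
    simp only [he]
    field_simp
    linear_combination (g t : ℂ) ^ 2 * Complex.I_sq
  have hinv : ∀ t ∈ Icc 0 T, HasDerivAt (fun s => 1 / g s) (-h t / g t ^ 2) t := by
    intro t ht
    simp only [one_div]
    exact (hg t).inv (hpos t ht).ne'
  have hwn : ∀ t ∈ Icc 0 T, ‖-(e t * Complex.I * h t / g t ^ 2)‖ = -h t / g t ^ 2 := by
    intro t ht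
    rw [norm_neg, norm_div, norm_mul, norm_mul, hen, norm_pow, Complex.norm_real,
      Complex.norm_real, Complex.norm_I, Real.norm_eq_abs, Real.norm_eq_abs,
      abs_of_nonpos (hneg t ht), abs_of_pos (hpos t ht)]
    simp
  have hwb : ∀ t ∈ Icc 0 T, ‖w t‖ ≤ 1 / g t := by
    intro t ht
    refine image_norm_le_of_norm_deriv_right_le_deriv_boundary' (f := w)
      (B := fun s => 1 / g s) (B' := fun s => -h s / g s ^ 2)
      (fun s hs => (hwd s hs).continuousAt.continuousWithinAt)
      (fun s hs => (hwd s ⟨hs.1, hs.2.le⟩).hasDerivWithinAt) ?_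
      (fun s hs => (hinv s hs).continuousAt.continuousWithinAt)
      (fun s hs => (hinv s ⟨hs.1, hs.2.le⟩).hasDerivWithinAt)
      (fun s hs => (hwn s ⟨hs.1, hs.2.le⟩).le) ht
    have := hpos 0 ⟨le_rfl, hT⟩
    simp [hw, hz0, hen, abs_of_pos this]
  have hzb : ∀ t ∈ Icc 0 T, ‖z t‖ ≤ 2 / g t := by
    intro t ht
    have h1 : z t = w t - e t * Complex.I / g t := by simp [hw]
    have h2 : ‖e t * Complex.I / g t‖ = 1 / g t := by
      simp [hen, abs_of_pos (hpos t ht)]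
    calc ‖z t‖ ≤ ‖w t‖ + ‖e t * Complex.I / g t‖ := h1 ▸ norm_sub_le _ _
      _ ≤ 1 / g t + 1 / g t := by rw [h2]; gcongr; exact hwb t ht
      _ = 2 / g t := by ring
  refine ⟨hzb, ?_⟩
  have hTm : T ∈ Icc 0 T := ⟨hT, le_rfl⟩
  have hVd : ∀ t ∈ uIcc 0 T, HasDerivAt (fun s => (z s * conj (w s)).im)
      ((e t * conj (z t)).im - 1 / g t
        + (z t * conj (-(e t * Complex.I * h t / g t ^ 2))).im) t := by
    intro t ht
    rw [uIcc_of_le hT] at ht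
    have h1 := (hz t).mul ((hwd t ht).star)
    have h2 := Complex.imCLM.hasFDerivAt.comp_hasDerivAt t h1
    refine h2.congr_deriv ?_
    have h3 : e t * conj (e t) = 1 := by
      rw [Complex.mul_conj, Complex.normSq_eq_norm_sq, hen]; simp
    have h4 : e t * conj (w t) = e t * conj (z t) - ((1 / g t : ℝ) : ℂ) * Complex.I := by
      simp only [hw, map_add, map_mul, map_div₀, Complex.conj_I, Complex.conj_ofReal]
      push_cast
      linear_combination (- Complex.I / g t) * h3
    change (e t * conj (w t) + z t * conj _).im = _
    rw [h4]
    simp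
  have hgco : ContinuousOn (fun t => 1 / g t) (uIcc 0 T) := by
    rw [uIcc_of_le hT]
    exact fun s hs => (hinv s hs).continuousAt.continuousWithinAt
  have hRco : ContinuousOn
      (fun t => (z t * conj (-(e t * Complex.I * h t / g t ^ 2))).im) (uIcc 0 T) := by
    rw [uIcc_of_le hT]
    refine Complex.continuous_im.comp_continuousOn (hzc.continuousOn.mul
      (Complex.continuous_conj.comp_continuousOn (ContinuousOn.neg (ContinuousOn.div
        (by fun_prop) (by fun_prop) fun t ht => pow_ne_zero _ (hgne t ht)))))
  have hec' : Continuous fun t => (e t * conj (z t)).im :=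
    Complex.continuous_im.comp (hec.mul (Complex.continuous_conj.comp hzc))
  have hI1 := hec'.intervalIntegrable (μ := MeasureTheory.volume) 0 T
  have hI2 := hgco.intervalIntegrable (μ := MeasureTheory.volume)
  have hI3 := hRco.intervalIntegrable (μ := MeasureTheory.volume)
  have hF := integral_eq_sub_of_hasDerivAt hVd ((hI1.sub hI2).add hI3)
  rw [integral_add (hI1.sub hI2) hI3, integral_sub hI1 hI2] at hF
  have hsq : ∀ t ∈ uIcc 0 T, HasDerivAt (fun s => (1 / g s) ^ 2)
      (2 / g t * (-h t / g t ^ 2)) t := by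
    intro t ht
    rw [uIcc_of_le hT] at ht
    exact ((hinv t ht).pow 2).congr_deriv (by ring)
  have hsqc : ContinuousOn (fun t => 2 / g t * (-h t / g t ^ 2)) (uIcc 0 T) := by
    rw [uIcc_of_le hT]
    exact ContinuousOn.mul
      (continuousOn_const.div hgc.continuousOn fun t ht => (hpos t ht).ne')
      (hh.neg.continuousOn.div (hgc.pow 2).continuousOn
        fun t ht => pow_ne_zero _ (hpos t ht).ne')
  have hRb : |∫ t in (0 : ℝ)..T, (z t * conj (-(e t * Complex.I * h t / g t ^ 2))).im|
      ≤ (1 / g T) ^ 2 - (1 / g 0) ^ 2 := by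
    rw [← integral_eq_sub_of_hasDerivAt hsq hsqc.intervalIntegrable, ← Real.norm_eq_abs]
    refine norm_integral_le_of_norm_le hT (.of_forall fun t ht => ?_)
      hsqc.intervalIntegrable
    have ht' : t ∈ Icc 0 T := ⟨ht.1.le, ht.2⟩
    refine (Complex.abs_im_le_norm _).trans ?_
    rw [norm_mul, RCLike.norm_conj, hwn t ht']
    have := hpos t ht'
    have h5 := hneg t ht'
    gcongr
    · exact div_nonneg (by linarith) (by positivity)
    · exact hzb t ht'
  have hVb : |(z T * conj (w T)).im| ≤ 2 / g T * (1 / g T) := by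
    refine (Complex.abs_im_le_norm _).trans ?_
    rw [norm_mul, RCLike.norm_conj]
    have := hpos T hTm
    gcongr
    · exact hzb T hTm
    · exact hwb T hTm
  rw [hz0] at hF
  simp only [zero_mul, Complex.zero_im, sub_zero] at hF
  have h6 : 3 / g T ^ 2 = 2 / g T * (1 / g T) + (1 / g T) ^ 2 := by
    ring
  have h7 : 0 ≤ (1 / g 0) ^ 2 := by positivity
  rw [h6]
  rw [abs_le] at *
  constructor <;> linarith [hRb.1, hRb.2, hVb.1, hVb.2]

/-- Near `t = π / 2 - 1 / r` the cosine is still at least of order `1 / r`. -/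
theorem le_sq_mul_cos {r t : ℝ} (hr : 1 ≤ r) (ht : t ∈ Icc 0 (π / 2 - 1 / r)) :
    (3 / 5) * r ≤ r ^ 2 * Real.cos t := by
  have hr0 : 0 < r := by linarith
  have hd : 0 < 1 / r := by positivity
  have h1 : 2 / π * (1 / r) ≤ Real.cos t := by
    have h2 := Real.mul_le_sin (x := π / 2 - t) (by linarith [ht.2]) (by linarith [ht.1])
    rw [Real.sin_pi_div_two_sub] at h2
    refine le_trans ?_ h2
    gcongr
    linarith [ht.2]
  have h3 : 3 / 5 ≤ 2 / π := by
    rw [div_le_div_iff₀ (by norm_num) pi_pos]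
    linarith [pi_lt_d2]
  calc (3 / 5) * r ≤ 2 / π * r := by gcongr
    _ = r ^ 2 * (2 / π * (1 / r)) := by field_simp
    _ ≤ r ^ 2 * Real.cos t := by gcongr

open ComplexConjugate in
/-- Estimates for a curve `z` with unit velocity of phase `θ + κ t + r ^ 2 sin t` over a quarter
period. -/
theorem quarter_period_bounds {r κ θ : ℝ} {z : ℝ → ℂ} (hr : 1 ≤ r) (hκ : |κ| ≤ r / 10)
    (hz : ∀ t, HasDerivAt z
      (Complex.exp ((θ + κ * t + r ^ 2 * Real.sin t : ℝ) * Complex.I)) t) :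
    (∀ t ∈ Icc 0 (π / 2), ‖z t - z 0‖ ≤ 6 / r) ∧
    ∀ M, (∀ t ∈ Icc 0 (π / 2), ‖z t‖ ≤ M / r) →
      |(∫ t in (0 : ℝ)..π / 2,
          (Complex.exp ((θ + κ * t + r ^ 2 * Real.sin t : ℝ) * Complex.I) * conj (z t)).im)
        - ∫ t in (0 : ℝ)..π / 2 - 1 / r, 1 / (κ + r ^ 2 * Real.cos t)|
      ≤ (12 + 7 * M) / r ^ 2 := by
  have hr0 : 0 < r := by linarith
  have hd : 0 < 1 / r := by positivity
  have hd1 : 1 / r ≤ 1 := by rw [div_le_one hr0]; exact hr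
  have hpi := pi_gt_three
  set T := π / 2 - 1 / r with hTdef
  have hT : 0 ≤ T := by linarith
  set φ : ℝ → ℝ := fun t => θ + κ * t + r ^ 2 * Real.sin t
  have hφ : ∀ t, HasDerivAt φ (κ + r ^ 2 * Real.cos t) t := fun t => by
    exact ((((hasDerivAt_id t).const_mul κ).const_add θ).add
      ((Real.hasDerivAt_sin t).const_mul (r ^ 2))).congr_deriv (by ring)
  have hg : ∀ t, HasDerivAt (fun t => κ + r ^ 2 * Real.cos t) (r ^ 2 * -Real.sin t) t :=
    fun t => ((Real.hasDerivAt_cos t).const_mul (r ^ 2)).const_add κ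
  have hlow : ∀ t ∈ Icc 0 T, r / 2 ≤ κ + r ^ 2 * Real.cos t := fun t ht => by
    have := le_sq_mul_cos hr ht
    linarith [(abs_le.1 hκ).1]
  obtain ⟨hb, ha⟩ := oscillatory_integral_bounds (z := fun t => z t - z 0) hφ hg
    (by fun_prop) (fun t => (hz t).sub_const _) (sub_self _) hT
    (fun t ht => lt_of_lt_of_le (by positivity) (hlow t ht))
    (fun t ht => by
      have := Real.sin_nonneg_of_nonneg_of_le_pi ht.1 (by linarith [ht.2])
      nlinarith [sq_nonneg r])
  have hTm : T ∈ Icc 0 T := ⟨hT, le_rfl⟩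
  have hz4 : ∀ t ∈ Icc 0 T, ‖z t - z 0‖ ≤ 4 / r := fun t ht => by
    refine (hb t ht).trans ?_
    calc 2 / (κ + r ^ 2 * Real.cos t) ≤ 2 / (r / 2) := by gcongr; exact hlow t ht
      _ = 4 / r := by field_simp; norm_num
  refine ⟨fun t ht => ?_, fun M hM => ?_⟩
  · rcases le_total t T with h | h
    · refine (hz4 t ⟨ht.1, h⟩).trans ?_
      gcongr
      norm_num
    · have h1 : ‖z t - z T‖ ≤ 1 * (t - T) :=
        norm_image_sub_le_of_norm_deriv_le_segment' (fun s _ => (hz s).hasDerivWithinAt)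
          (fun s _ => (Complex.norm_exp_ofReal_mul_I _).le) t ⟨h, le_rfl⟩
      have h2 := hz4 T hTm
      calc ‖z t - z 0‖ = ‖(z t - z T) + (z T - z 0)‖ := by congr 1; ring
        _ ≤ 1 * (t - T) + 4 / r := (norm_add_le _ _).trans (add_le_add h1 h2)
        _ ≤ 1 / r + 4 / r := by linarith [ht.2]
        _ ≤ 6 / r := by rw [← add_div]; gcongr; norm_num
  · have hzc : Continuous z := continuous_iff_continuousAt.2 fun t => (hz t).continuousAt
    have hφc : Continuous φ := by fun_prop
    set e : ℝ → ℂ := fun t => Complex.exp (φ t * Complex.I) with he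
    have hec : Continuous e := by fun_prop
    have hcc := Complex.continuous_conj
    have hen : ∀ t, ‖e t‖ = 1 := fun t => Complex.norm_exp_ofReal_mul_I _
    have hfc : Continuous fun t => (e t * conj (z t)).im :=
      Complex.continuous_im.comp (hec.mul (hcc.comp hzc))
    have hM0 : 0 ≤ M / r := (norm_nonneg _).trans (hM 0 ⟨le_rfl, by positivity⟩)
    have hsplit := integral_add_adjacent_intervals
      (hfc.intervalIntegrable (μ := MeasureTheory.volume) 0 T)
      (hfc.intervalIntegrable (μ := MeasureTheory.volume) T (π / 2))
    have hN : |∫ t in T..π / 2, (e t * conj (z t)).im| ≤ M / r * (1 / r) := by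
      have h1 := norm_integral_le_of_norm_le_const (a := T) (b := π / 2)
        (f := fun t => (e t * conj (z t)).im) (C := M / r) fun t ht => by
          rw [uIoc_of_le (by linarith)] at ht
          refine (Complex.abs_im_le_norm _).trans ?_
          rw [norm_mul, RCLike.norm_conj, hen, one_mul]
          exact hM t ⟨by linarith [ht.1], ht.2⟩
      rwa [Real.norm_eq_abs, hTdef, sub_sub_cancel, abs_of_pos hd] at h1
    have hbase : (∫ t in (0 : ℝ)..T, (e t * conj (z t)).im)
        = (∫ t in (0 : ℝ)..T, (e t * conj (z t - z 0)).im)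
          + ((z T - z 0) * conj (z 0)).im := by
      have hc1 : Continuous fun t => (e t * conj (z t - z 0)).im :=
        Complex.continuous_im.comp (hec.mul (hcc.comp (hzc.sub continuous_const)))
      have hc2 : Continuous fun t => (e t * conj (z 0)).im :=
        Complex.continuous_im.comp (hec.mul continuous_const)
      have h1 : ∫ t in (0 : ℝ)..T, (e t * conj (z 0)).im = ((z T - z 0) * conj (z 0)).im := by
        rw [sub_mul, Complex.sub_im]
        exact integral_eq_sub_of_hasDerivAt (f := fun t => (z t * conj (z 0)).im)
          (fun t _ => Complex.imCLM.hasFDerivAt.comp_hasDerivAt t ((hz t).mul_const _))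
          (hc2.intervalIntegrable _ _)
      rw [← h1, ← integral_add (hc1.intervalIntegrable _ _) (hc2.intervalIntegrable _ _)]
      refine integral_congr fun t _ => ?_
      simp only [map_sub, mul_sub, Complex.sub_im]
      ring
    have hB : |((z T - z 0) * conj (z 0)).im| ≤ 4 / r * (M / r) := by
      refine (Complex.abs_im_le_norm _).trans ?_
      rw [norm_mul, RCLike.norm_conj]
      gcongr
      · exact hz4 T hTm
      · exact hM 0 ⟨le_rfl, by positivity⟩
    have h3 : 3 / (κ + r ^ 2 * Real.cos T) ^ 2 ≤ 12 / r ^ 2 := by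
      calc 3 / (κ + r ^ 2 * Real.cos T) ^ 2 ≤ 3 / (r / 2) ^ 2 := by gcongr; exact hlow T hTm
        _ = 12 / r ^ 2 := by field_simp; norm_num
    have h4 : (12 + 7 * M) / r ^ 2
        = 12 / r ^ 2 + 4 / r * (M / r) + M / r * (1 / r) + 2 * (M / r * (1 / r)) := by
      field_simp
      ring
    have h5 : 0 ≤ M / r * (1 / r) := by positivity
    rw [h4, ← hsplit, hbase]
    have ha' := ha.trans h3
    rw [abs_le] at ha' hB hN ⊢
    simp only [he] at *
    constructor <;> linarith [ha'.1, ha'.2, hB.1, hB.2, hN.1, hN.2]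

/-- The main terms for opposite values of `κ` cancel to leading order. -/
theorem abs_integral_inv_sub_le {r κ : ℝ} (hr : 1 ≤ r) (hκ : |κ| ≤ r / 10) :
    |(∫ t in (0 : ℝ)..π / 2 - 1 / r, 1 / (κ + r ^ 2 * Real.cos t))
      - ∫ t in (0 : ℝ)..π / 2 - 1 / r, 1 / (-κ + r ^ 2 * Real.cos t)| ≤ 1 / r ^ 2 := by
  have hr0 : 0 < r := by linarith
  have hd : 0 < 1 / r := by positivity
  have hd1 : 1 / r ≤ 1 := by rw [div_le_one hr0]; exact hr
  have hpi := pi_gt_three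
  set T := π / 2 - 1 / r with hTdef
  have hT : 0 ≤ T := by linarith
  have hcos : ∀ t ∈ Icc 0 T, (3 / 5) * r ≤ r ^ 2 * Real.cos t := fun t ht =>
    le_sq_mul_cos hr ht
  have hcpos : ∀ t ∈ Icc 0 T, 0 < Real.cos t := fun t ht =>
    pos_of_mul_pos_right (lt_of_lt_of_le (by positivity) (hcos t ht)) (by positivity)
  obtain ⟨hκ1, hκ2⟩ := abs_le.1 hκ
  have hi : ∀ c : ℝ, |c| ≤ r / 10 →
      IntervalIntegrable (fun t => 1 / (c + r ^ 2 * Real.cos t)) MeasureTheory.volume 0 T := by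
    intro c hc
    refine ContinuousOn.intervalIntegrable ?_
    rw [uIcc_of_le hT]
    refine continuousOn_const.div (by fun_prop) fun t ht => ne_of_gt ?_
    linarith [hcos t ht, (abs_le.1 hc).1]
  have htan : ∀ t ∈ uIcc 0 T, HasDerivAt (fun t => r / 5 / r ^ 4 * 2 * Real.tan t)
      (r / 5 / r ^ 4 * 2 * (1 / Real.cos t ^ 2)) t := by
    intro t ht
    rw [uIcc_of_le hT] at ht
    exact (Real.hasDerivAt_tan (hcpos t ht).ne').const_mul _
  have htc : IntervalIntegrable (fun t => r / 5 / r ^ 4 * 2 * (1 / Real.cos t ^ 2))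
      MeasureTheory.volume 0 T := by
    refine ContinuousOn.intervalIntegrable ?_
    rw [uIcc_of_le hT]
    exact continuousOn_const.mul (continuousOn_const.div (by fun_prop)
      fun t ht => pow_ne_zero _ (hcpos t ht).ne')
  rw [← integral_sub (hi κ hκ) (hi (-κ) (by rwa [abs_neg])), ← Real.norm_eq_abs]
  have hTm : T ∈ Icc 0 T := ⟨hT, le_rfl⟩
  have hfin : r / 5 / r ^ 4 * 2 * Real.tan T ≤ 1 / r ^ 2 := by
    have h1 := hcos T hTm
    have h2 : Real.tan T ≤ 5 / 3 * r := by
      rw [Real.tan_eq_sin_div_cos, div_le_iff₀ (hcpos T hTm)]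
      nlinarith [Real.sin_le_one T]
    calc r / 5 / r ^ 4 * 2 * Real.tan T ≤ r / 5 / r ^ 4 * 2 * (5 / 3 * r) := by gcongr
      _ = (2 / 3) / r ^ 2 := by field_simp
      _ ≤ 1 / r ^ 2 := by gcongr; norm_num
  refine le_trans ?_ hfin
  have hFTC := integral_eq_sub_of_hasDerivAt htan htc
  rw [Real.tan_zero, mul_zero, sub_zero] at hFTC
  rw [← hFTC]
  refine norm_integral_le_of_norm_le hT (.of_forall fun t ht => ?_) htc
  have ht' : t ∈ Icc 0 T := ⟨ht.1.le, ht.2⟩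
  have hc := hcos t ht'
  have hp := hcpos t ht'
  set u := r ^ 2 * Real.cos t with hu
  have hu0 : 0 < u := by positivity
  have e1 : 0 < κ + u := by linarith
  have e2 : 0 < -κ + u := by linarith
  have h1 : 1 / (κ + u) - 1 / (-κ + u) = -(2 * κ) / ((κ + u) * (-κ + u)) := by
    field_simp
    ring
  have h2 : u ^ 2 / 2 ≤ (κ + u) * (-κ + u) := by nlinarith
  rw [h1, Real.norm_eq_abs, abs_div, abs_of_pos (mul_pos e1 e2), abs_neg, abs_mul]
  calc |(2 : ℝ)| * |κ| / ((κ + u) * (-κ + u)) ≤ 2 * (r / 10) / (u ^ 2 / 2) := by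
        rw [abs_of_pos (by norm_num : (0 : ℝ) < 2)]
        gcongr
    _ = r / 5 / r ^ 4 * 2 * (1 / Real.cos t ^ 2) := by
        rw [hu]; field_simp; norm_num

open ComplexConjugate in
/-- Over a full period, the curve with unit velocity of phase `κ t + r ^ 2 sin t` has size
`O(1 / r)` and sweeps an area `O(1 / r ^ 2)`. -/
theorem full_period_bounds {r κ : ℝ} {z : ℝ → ℂ} (hr : 1 ≤ r) (hκ : |κ| ≤ r / 10)
    (hz : ∀ t, HasDerivAt z (Complex.exp ((κ * t + r ^ 2 * Real.sin t : ℝ) * Complex.I)) t)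
    (hz0 : z 0 = 0) :
    (∀ t ∈ Icc 0 (2 * π), ‖z t‖ ≤ 30 / r) ∧
    |∫ t in (0 : ℝ)..2 * π,
      (Complex.exp ((κ * t + r ^ 2 * Real.sin t : ℝ) * Complex.I) * conj (z t)).im|
      ≤ 1000 / r ^ 2 := by
  have hr0 : 0 < r := by linarith
  have hpi := pi_pos
  have hκ' : |-κ| ≤ r / 10 := by rwa [abs_neg]
  have hconj : ∀ y : ℝ, conj (Complex.exp (y * Complex.I))
      = Complex.exp ((-y : ℝ) * Complex.I) := fun y => by
    rw [← Complex.exp_conj, map_mul, Complex.conj_ofReal, Complex.conj_I]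
    push_cast
    ring_nf
  set e : ℝ → ℂ := fun t => Complex.exp ((κ * t + r ^ 2 * Real.sin t : ℝ) * Complex.I) with he
  have e1 : ∀ t, e t = Complex.exp ((0 + κ * t + r ^ 2 * Real.sin t : ℝ) * Complex.I) :=
    fun t => by simp only [he, zero_add]
  have e2 : ∀ t, e (π - t)
      = Complex.exp ((κ * π + -κ * t + r ^ 2 * Real.sin t : ℝ) * Complex.I) := fun t => by
    simp only [he, Real.sin_pi_sub]
    congr 3
    ring
  have e3 : ∀ t, conj (e (π + t))
      = Complex.exp ((-(κ * π) + -κ * t + r ^ 2 * Real.sin t : ℝ) * Complex.I) := fun t => by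
    simp only [he, hconj, add_comm π t, Real.sin_add_pi]
    congr 3
    ring
  have e4 : ∀ t, conj (e (2 * π - t))
      = Complex.exp ((-(κ * (2 * π)) + κ * t + r ^ 2 * Real.sin t : ℝ) * Complex.I) :=
    fun t => by
    simp only [he, hconj, Real.sin_two_pi_sub]
    congr 3
    ring
  obtain ⟨n1, a1⟩ := quarter_period_bounds (z := z) hr hκ (θ := 0) fun t => by
    rw [← e1]; exact hz t
  obtain ⟨n2, a2⟩ := quarter_period_bounds (z := fun t => -z (π - t)) hr hκ' (θ := κ * π)
    fun t => by
      rw [← e2]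
      exact ((hz (π - t)).comp_const_sub π t).neg.congr_deriv (neg_neg _)
  obtain ⟨n3, a3⟩ := quarter_period_bounds (z := fun t => conj (z (π + t))) hr hκ'
    (θ := -(κ * π)) fun t => by
      rw [← e3]
      exact ((hz (π + t)).comp_const_add π t).star
  obtain ⟨n4, a4⟩ := quarter_period_bounds (z := fun t => -conj (z (2 * π - t))) hr hκ
    (θ := -(κ * (2 * π))) fun t => by
      rw [← e4]
      exact ((hz (2 * π - t)).comp_const_sub (2 * π) t).star.neg.congr_deriv
        (by rw [star_neg, neg_neg]; rfl)
  simp only [← e1] at a1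
  simp only [← e2] at a2
  simp only [← e3] at a3
  simp only [← e4] at a4
  simp only [← map_sub, RCLike.norm_conj, sub_zero, add_zero, hz0] at n1 n2 n3 n4
  have m1 : ∀ t ∈ Icc 0 (π / 2), ‖z t‖ ≤ 6 / r := n1
  have m2 : ∀ t ∈ Icc 0 (π / 2), ‖z π - z (π - t)‖ ≤ 6 / r := fun t ht => by
    have := n2 t ht
    rwa [neg_sub_neg] at this
  have m4 : ∀ t ∈ Icc 0 (π / 2), ‖z (2 * π) - z (2 * π - t)‖ ≤ 6 / r := fun t ht => by
    have := n4 t ht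
    rwa [neg_sub_neg, ← map_sub, RCLike.norm_conj] at this
  have hh : π / 2 ∈ Icc 0 (π / 2) := ⟨by positivity, le_rfl⟩
  have htri : ∀ u v : ℂ, ‖u‖ ≤ ‖u - v‖ + ‖v‖ := fun u v => by
    simpa using norm_add_le (u - v) v
  have htri' : ∀ u v : ℂ, ‖u‖ ≤ ‖v - u‖ + ‖v‖ := fun u v => by
    rw [norm_sub_rev]; exact htri u v
  have p2 : ‖z π‖ ≤ 2 * (6 / r) := by
    have h1 := m2 _ hh
    have h2 := htri (z π) (z (π - π / 2))
    have h3 := m1 _ hh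
    rw [sub_half] at h1 h2
    linarith
  have p4 : ‖z (2 * π)‖ ≤ 4 * (6 / r) := by
    have h1 := m4 _ hh
    have h2 := htri (z (2 * π)) (z (2 * π - π / 2))
    have h3 := n3 _ hh
    have h4 := htri (z (π + π / 2)) (z π)
    have h5 : 2 * π - π / 2 = π + π / 2 := by ring
    rw [h5] at h1 h2
    linarith
  have q2 : ∀ t ∈ Icc 0 (π / 2), ‖z (π - t)‖ ≤ 5 * (6 / r) := fun t ht => by
    have := m2 t ht
    have := htri' (z (π - t)) (z π)
    have : 0 ≤ 6 / r := by positivity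
    linarith
  have q3 : ∀ t ∈ Icc 0 (π / 2), ‖z (π + t)‖ ≤ 5 * (6 / r) := fun t ht => by
    have := n3 t ht
    have := htri (z (π + t)) (z π)
    have : 0 ≤ 6 / r := by positivity
    linarith
  have q4 : ∀ t ∈ Icc 0 (π / 2), ‖z (2 * π - t)‖ ≤ 5 * (6 / r) := fun t ht => by
    have := m4 t ht
    have := htri' (z (2 * π - t)) (z (2 * π))
    linarith
  have h30 : 5 * (6 / r) = 30 / r := by ring
  rw [h30] at q2 q3 q4
  have q1 : ∀ t ∈ Icc 0 (π / 2), ‖z t‖ ≤ 30 / r := fun t ht => (m1 t ht).trans (by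
    gcongr
    norm_num)
  refine ⟨fun t ht => ?_, ?_⟩
  · rcases le_total t (π / 2) with h | h
    · exact q1 t ⟨ht.1, h⟩
    rcases le_total t π with h' | h'
    · simpa using q2 (π - t) ⟨by linarith, by linarith⟩
    rcases le_total t (π + π / 2) with h'' | h''
    · simpa using q3 (t - π) ⟨by linarith, by linarith⟩
    · simpa using q4 (2 * π - t) ⟨by linarith [ht.2], by linarith⟩
  · have b1 := a1 30 q1
    have b2 := a2 30 fun t ht => by rw [norm_neg]; exact q2 t ht
    have b3 := a3 30 fun t ht => by rw [RCLike.norm_conj]; exact q3 t ht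
    have b4 := a4 30 fun t ht => by rw [norm_neg, RCLike.norm_conj]; exact q4 t ht
    have hzc : Continuous z := continuous_iff_continuousAt.2 fun t => (hz t).continuousAt
    set f : ℝ → ℝ := fun t => (e t * conj (z t)).im with hf
    have hfc : Continuous f :=
      Complex.continuous_im.comp ((by fun_prop : Continuous e).mul
        (Complex.continuous_conj.comp hzc))
    have f2 : ∫ t in (0 : ℝ)..π / 2, (e (π - t) * conj (-z (π - t))).im
        = -∫ t in π / 2..π, f t := by
      have h1 := integral_comp_sub_left f (a := 0) (b := π / 2) π
      rw [sub_half, sub_zero] at h1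
      rw [← h1, ← intervalIntegral.integral_neg]
      refine integral_congr fun t _ => ?_
      simp [hf]
    have f3 : ∫ t in (0 : ℝ)..π / 2, (conj (e (π + t)) * conj (conj (z (π + t)))).im
        = -∫ t in π..π + π / 2, f t := by
      have h1 := integral_comp_add_left f (a := 0) (b := π / 2) π
      rw [add_zero] at h1
      rw [← h1, ← intervalIntegral.integral_neg]
      refine integral_congr fun t _ => ?_
      simp only [hf]
      rw [← map_mul, Complex.conj_im]
    have f4 : ∫ t in (0 : ℝ)..π / 2, (conj (e (2 * π - t)) * conj (-conj (z (2 * π - t)))).im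
        = ∫ t in π + π / 2..2 * π, f t := by
      have h1 := integral_comp_sub_left f (a := 0) (b := π / 2) (2 * π)
      rw [sub_zero, show 2 * π - π / 2 = π + π / 2 by ring] at h1
      rw [← h1]
      refine integral_congr fun t _ => ?_
      simp only [hf]
      rw [← map_mul, Complex.conj_im, mul_neg, Complex.neg_im, neg_neg]
    rw [f2] at b2
    rw [f3] at b3
    rw [f4] at b4
    have hi : ∀ a b, IntervalIntegrable f MeasureTheory.volume a b :=
      fun a b => hfc.intervalIntegrable a b
    rw [← integral_add_adjacent_intervals (hi 0 (π / 2)) (hi (π / 2) (2 * π)),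
      ← integral_add_adjacent_intervals (hi (π / 2) π) (hi π (2 * π)),
      ← integral_add_adjacent_intervals (hi π (π + π / 2)) (hi (π + π / 2) (2 * π))]
    have hc := abs_integral_inv_sub_le hr hκ
    have h1000 : 1000 / r ^ 2
        = 4 * ((12 + 7 * 30) / r ^ 2) + 2 * (1 / r ^ 2) + 110 * (1 / r ^ 2) := by ring
    have hp : 0 < 1 / r ^ 2 := by positivity
    rw [h1000]
    rw [abs_le] at b1 b2 b3 b4 hc ⊢
    constructor <;> linarith [b1.1, b1.2, b2.1, b2.2, b3.1, b3.2, b4.1, b4.2, hc.1, hc.2]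

/-- Real form of `full_period_bounds`, for the primitives `C` and `S` of the cosine and the sine
of the phase. -/
theorem full_period_real_bounds {r κ : ℝ} {φ C S : ℝ → ℝ} (hr : 1 ≤ r) (hκ : |κ| ≤ r / 10)
    (hφ : ∀ t, φ t = κ * t + r ^ 2 * Real.sin t)
    (hC : ∀ t, HasDerivAt C (Real.cos (φ t)) t) (hS : ∀ t, HasDerivAt S (Real.sin (φ t)) t)
    (hC0 : C 0 = 0) (hS0 : S 0 = 0) :
    (∀ t ∈ Icc 0 (2 * π), |C t| ≤ 30 / r) ∧ (∀ t ∈ Icc 0 (2 * π), |S t| ≤ 30 / r) ∧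
    |∫ t in (0 : ℝ)..2 * π, S t * Real.cos (φ t)| ≤ 1000 / r ^ 2 := by
  have hφ' : φ = fun t => κ * t + r ^ 2 * Real.sin t := funext hφ
  have hφc : Continuous φ := by rw [hφ']; fun_prop
  have hCc : Continuous C := continuous_iff_continuousAt.2 fun t => (hC t).continuousAt
  have hSc : Continuous S := continuous_iff_continuousAt.2 fun t => (hS t).continuousAt
  have hexp : ∀ y : ℝ, Complex.exp (y * Complex.I)
      = (Real.cos y : ℂ) + (Real.sin y : ℂ) * Complex.I := fun y => by
    rw [Complex.exp_mul_I, Complex.ofReal_cos, Complex.ofReal_sin]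
  obtain ⟨hn, ha⟩ := full_period_bounds (z := fun t => (C t : ℂ) + S t * Complex.I) hr hκ
    (fun t => by
      rw [← hφ, hexp]
      exact (hC t).ofReal_comp.add ((hS t).ofReal_comp.mul_const _))
    (by simp [hC0, hS0])
  have hCb : ∀ t ∈ Icc 0 (2 * π), |C t| ≤ 30 / r := fun t ht => by
    simpa using (Complex.abs_re_le_norm _).trans (hn t ht)
  have hSb : ∀ t ∈ Icc 0 (2 * π), |S t| ≤ 30 / r := fun t ht => by
    simpa using (Complex.abs_im_le_norm _).trans (hn t ht)
  refine ⟨hCb, hSb, ?_⟩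
  have hfun : ∀ t, (Complex.exp ((κ * t + r ^ 2 * Real.sin t : ℝ) * Complex.I) *
      (starRingEnd ℂ) ((C t : ℂ) + S t * Complex.I)).im
      = (Real.cos (φ t) * S t + C t * Real.sin (φ t)) - 2 * (S t * Real.cos (φ t)) :=
    fun t => by
    rw [← hφ, hexp]
    simp [Complex.mul_im, -Complex.ofReal_cos, -Complex.ofReal_sin]
    ring
  simp only [hfun] at ha
  have hi1 : Continuous fun t => Real.cos (φ t) * S t + C t * Real.sin (φ t) := by fun_prop
  have hi2 : Continuous fun t => S t * Real.cos (φ t) := by fun_prop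
  rw [integral_sub (hi1.intervalIntegrable _ _)
    ((hi2.const_mul 2).intervalIntegrable _ _), intervalIntegral.integral_const_mul,
    integral_eq_sub_of_hasDerivAt (f := fun t => C t * S t) (fun t _ => (hC t).mul (hS t))
      (hi1.intervalIntegrable _ _), hC0, zero_mul, sub_zero] at ha
  have hm : 2 * π ∈ Icc 0 (2 * π) := ⟨by positivity, le_rfl⟩
  have hCS : |C (2 * π) * S (2 * π)| ≤ 30 / r * (30 / r) := by
    rw [abs_mul]
    gcongr
    · exact hCb _ hm
    · exact hSb _ hm
  have h1 : 2 * (1000 / r ^ 2) = 30 / r * (30 / r) + 1000 / r ^ 2 + 100 / r ^ 2 := by ring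
  have h2 : 0 ≤ 100 / r ^ 2 := by positivity
  rw [abs_le] at *
  constructor <;> linarith [ha.1, ha.2, hCS.1, hCS.2]

/-- Comparison of `∫ cos (φ + d)` with `∫ cos φ` for a `2π`-periodic slow perturbation `d` of
the phase `φ t = κ t + r ^ 2 sin t`. -/
theorem abs_integral_cos_add_sub_le {r κ μ σ m : ℝ} {φ d : ℝ → ℝ} (hr : 1 ≤ r)
    (hκ : |κ| ≤ r / 10) (hμ : 0 < μ) (hσ : |σ| = 1)
    (hφ : ∀ t, φ t = κ * t + r ^ 2 * Real.sin t)
    (hd : ∀ t, HasDerivAt d ((σ * Real.cos (φ t + d t) - m) / μ) t)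
    (hd0 : d 0 = 0) (hd1 : d (2 * π) = 0) :
    2 * π * m = σ * ∫ t in (0 : ℝ)..2 * π, Real.cos (φ t + d t) ∧
    |(∫ t in (0 : ℝ)..2 * π, Real.cos (φ t + d t)) - ∫ t in (0 : ℝ)..2 * π, Real.cos (φ t)|
      ≤ 3000000 / r ^ 2 * (1 / μ + 1 / μ ^ 2 + 1 / μ ^ 3) := by
  have hr0 : 0 < r := by linarith
  have hpi := pi_pos
  have hpi4 := pi_lt_d2
  have hφ' : φ = fun t => κ * t + r ^ 2 * Real.sin t := funext hφ
  have hφc : Continuous φ := by rw [hφ']; fun_prop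
  have hdc : Continuous d := continuous_iff_continuousAt.2 fun t => (hd t).continuousAt
  have hii : ∀ {f : ℝ → ℝ} (a b : ℝ), Continuous f →
      IntervalIntegrable f MeasureTheory.volume a b := fun a b hf => hf.intervalIntegrable a b
  have hcφ : Continuous fun t => Real.cos (φ t) := by fun_prop
  have hsφ : Continuous fun t => Real.sin (φ t) := by fun_prop
  have hcd : Continuous fun t => Real.cos (φ t + d t) := by fun_prop
  set C : ℝ → ℝ := fun t => ∫ s in (0 : ℝ)..t, Real.cos (φ s) with hCdef
  set S : ℝ → ℝ := fun t => ∫ s in (0 : ℝ)..t, Real.sin (φ s) with hSdef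
  have hC : ∀ t, HasDerivAt C (Real.cos (φ t)) t := fun t => hcφ.integral_hasStrictDerivAt 0 t
    |>.hasDerivAt
  have hS : ∀ t, HasDerivAt S (Real.sin (φ t)) t := fun t => hsφ.integral_hasStrictDerivAt 0 t
    |>.hasDerivAt
  have hC0 : C 0 = 0 := by simp [hCdef]
  have hS0 : S 0 = 0 := by simp [hSdef]
  have hCc : Continuous C := continuous_iff_continuousAt.2 fun t => (hC t).continuousAt
  have hSc : Continuous S := continuous_iff_continuousAt.2 fun t => (hS t).continuousAt
  obtain ⟨hCb, hSb, hA⟩ := full_period_real_bounds hr hκ hφ hC hS hC0 hS0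
  set ε := 30 / r with hε
  have hε0 : 0 ≤ ε := by positivity
  set d' : ℝ → ℝ := fun t => (σ * Real.cos (φ t + d t) - m) / μ with hd'
  have hd'c : Continuous d' := by
    simp only [hd']
    fun_prop
  have hm2 : 2 * π ∈ Icc 0 (2 * π) := ⟨by positivity, le_rfl⟩
  have hdint : ∀ t, d t = (σ * (∫ s in (0 : ℝ)..t, Real.cos (φ s + d s)) - m * t) / μ := by
    intro t
    have h1 := integral_eq_sub_of_hasDerivAt (a := 0) (b := t) (fun s _ => hd s)
      (hii 0 t hd'c)
    rw [hd0, sub_zero] at h1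
    rw [← h1, intervalIntegral.integral_div, integral_sub (hii _ _ (hcd.const_mul σ))
      (hii _ _ continuous_const), intervalIntegral.integral_const_mul,
      intervalIntegral.integral_const]
    simp [mul_comm]
  have hmean : 2 * π * m = σ * ∫ t in (0 : ℝ)..2 * π, Real.cos (φ t + d t) := by
    have h1 := hdint (2 * π)
    rw [hd1, eq_comm, div_eq_zero_iff, or_iff_left hμ.ne'] at h1
    linarith
  refine ⟨hmean, ?_⟩
  have h2π : 0 < 2 * π := by positivity
  have hmabs : 2 * π * |m| = |∫ t in (0 : ℝ)..2 * π, Real.cos (φ t + d t)| := by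
    have h1 := congrArg abs hmean
    rwa [abs_mul, abs_of_pos h2π, abs_mul, hσ, one_mul] at h1
  have hm1 : |m| ≤ 1 := by
    have h1 := norm_integral_le_of_norm_le_const (a := 0) (b := 2 * π)
      (f := fun t => Real.cos (φ t + d t)) (C := 1) fun t _ => Real.abs_cos_le_one _
    rw [Real.norm_eq_abs, sub_zero, one_mul, abs_of_pos h2π, ← hmabs] at h1
    nlinarith
  have hd'b : ∀ t, |d' t| ≤ 2 / μ := fun t => by
    simp only [hd']
    rw [abs_div, abs_of_pos hμ]
    gcongr
    refine (abs_sub _ _).trans ?_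
    rw [abs_mul, hσ]
    linarith [Real.abs_cos_le_one (φ t + d t)]
  have hparts : ∀ t, (∫ s in (0 : ℝ)..t, Real.cos (φ s + d s))
      = C t * Real.cos (d t) - S t * Real.sin (d t)
        + ∫ s in (0 : ℝ)..t, (C s * Real.sin (d s) + S s * Real.cos (d s)) * d' s := by
    intro t
    have h1 : ∀ s, HasDerivAt (fun s => C s * Real.cos (d s) - S s * Real.sin (d s))
        (Real.cos (φ s + d s) - (C s * Real.sin (d s) + S s * Real.cos (d s)) * d' s) s := by
      intro s
      refine (((hC s).mul (hd s).cos).sub ((hS s).mul (hd s).sin)).congr_deriv ?_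
      simp only [Real.cos_add, hd']
      ring
    have hc : Continuous fun s => (C s * Real.sin (d s) + S s * Real.cos (d s)) * d' s := by
      fun_prop
    have h2 := integral_eq_sub_of_hasDerivAt (a := 0) (b := t) (fun s _ => h1 s)
      (hii 0 t (hcd.sub hc))
    rw [integral_sub (hii _ _ hcd) (hii _ _ hc), hC0, hS0] at h2
    linarith
  have hsum : ∀ t ∈ Icc 0 (2 * π), ∀ u v : ℝ, |u| ≤ 1 → |v| ≤ 1 →
      |C t * u + S t * v| ≤ 2 * ε := fun t ht u v hu hv => by
    refine (abs_add_le _ _).trans ?_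
    rw [abs_mul, abs_mul]
    have h1 := mul_le_mul (hCb t ht) hu (abs_nonneg _) hε0
    have h2 := mul_le_mul (hSb t ht) hv (abs_nonneg _) hε0
    linarith
  set X := 2 * ε + 2 * ε * (2 / μ) * (2 * π) with hX
  have hX0 : 0 ≤ X := by positivity
  have hJ : ∀ t ∈ Icc 0 (2 * π), |∫ s in (0 : ℝ)..t, Real.cos (φ s + d s)| ≤ X := by
    intro t ht
    rw [hparts t]
    refine (abs_add_le _ _).trans (add_le_add ?_ ?_)
    · rw [sub_eq_add_neg, ← mul_neg]
      exact hsum t ht _ _ (Real.abs_cos_le_one _) (by rw [abs_neg]; exact Real.abs_sin_le_one _)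
    · have h1 := norm_integral_le_of_norm_le_const (a := 0) (b := t)
        (f := fun s => (C s * Real.sin (d s) + S s * Real.cos (d s)) * d' s)
        (C := 2 * ε * (2 / μ)) fun s hs => by
          rw [uIoc_of_le ht.1] at hs
          rw [Real.norm_eq_abs, abs_mul]
          gcongr
          · exact hsum s ⟨hs.1.le, hs.2.trans ht.2⟩ _ _ (Real.abs_sin_le_one _)
              (Real.abs_cos_le_one _)
          · exact hd'b s
      rw [Real.norm_eq_abs, sub_zero, abs_of_nonneg ht.1] at h1
      refine h1.trans ?_
      gcongr
      exact ht.2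
  have hmX : 2 * π * |m| ≤ X := by
    rw [hmabs]
    exact hJ _ hm2
  set D := 2 * X / μ with hD
  have hD0 : 0 ≤ D := by positivity
  have hdb : ∀ t ∈ Icc 0 (2 * π), |d t| ≤ D := by
    intro t ht
    rw [hdint t, abs_div, abs_of_pos hμ]
    simp only [hD]
    gcongr
    refine (abs_sub _ _).trans ?_
    rw [abs_mul, abs_mul, hσ, abs_of_nonneg ht.1]
    have h1 := hJ t ht
    have h2 : |m| * t ≤ |m| * (2 * π) := by gcongr; exact ht.2
    linarith
  have hE : (∫ t in (0 : ℝ)..2 * π, Real.cos (φ t + d t)) - ∫ t in (0 : ℝ)..2 * π, Real.cos (φ t)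
      = ∫ s in (0 : ℝ)..2 * π, (C s * Real.sin (d s) + S s * Real.cos (d s)) * d' s := by
    rw [hparts (2 * π), hd1]
    simp [hCdef]
  have hsin : ∀ t ∈ Icc 0 (2 * π), |Real.sin (d t)| ≤ D := fun t ht =>
    Real.abs_sin_le_abs.trans (hdb t ht)
  have hlip : ∀ x y : ℝ, |Real.cos (x + y) - Real.cos x| ≤ |y| := fun x y => by
    have h1 := Real.cos_sub_cos (x + y) x
    have h2 := Real.abs_sin_le_one ((x + y + x) / 2)
    have h3 : |Real.sin ((x + y - x) / 2)| ≤ |y| / 2 := by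
      refine Real.abs_sin_le_abs.trans (le_of_eq ?_)
      rw [add_sub_cancel_left, abs_div, abs_two]
    rw [h1, abs_mul, abs_mul, abs_neg, abs_two]
    nlinarith [abs_nonneg y, abs_nonneg (Real.sin ((x + y - x) / 2))]
  have hcos1 : ∀ t ∈ Icc 0 (2 * π), |Real.cos (d t) - 1| ≤ D := fun t ht => by
    have := hlip 0 (d t)
    rw [zero_add, Real.cos_zero] at this
    exact this.trans (hdb t ht)
  have hc1 : Continuous fun s => (C s * Real.sin (d s) + S s * Real.cos (d s)) * d' s := by
    fun_prop
  have hc2 : Continuous fun s => σ / μ * (S s * Real.cos (φ s)) - m / μ * S s := by fun_prop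
  have hdiff : |(∫ s in (0 : ℝ)..2 * π, (C s * Real.sin (d s) + S s * Real.cos (d s)) * d' s)
      - ∫ s in (0 : ℝ)..2 * π, (σ / μ * (S s * Real.cos (φ s)) - m / μ * S s)|
      ≤ 5 * (ε * D / μ) * (2 * π) := by
    rw [← integral_sub (hii _ _ hc1) (hii _ _ hc2)]
    have h1 := norm_integral_le_of_norm_le_const (a := 0) (b := 2 * π)
      (f := fun s => (C s * Real.sin (d s) + S s * Real.cos (d s)) * d' s
        - (σ / μ * (S s * Real.cos (φ s)) - m / μ * S s))
      (C := 5 * (ε * D / μ)) fun s hs => by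
        rw [uIoc_of_le (by positivity)] at hs
        have hs' : s ∈ Icc 0 (2 * π) := ⟨hs.1.le, hs.2⟩
        have e1 : (C s * Real.sin (d s) + S s * Real.cos (d s)) * d' s
            - (σ / μ * (S s * Real.cos (φ s)) - m / μ * S s)
            = C s * Real.sin (d s) * d' s + S s * (Real.cos (d s) - 1) * d' s
              + S s * (σ * (Real.cos (φ s + d s) - Real.cos (φ s))) / μ := by
          simp only [hd']
          ring
        have t1 : |C s * Real.sin (d s) * d' s| ≤ ε * D * (2 / μ) := by
          rw [abs_mul, abs_mul]
          gcongr
          exacts [hCb s hs', hsin s hs', hd'b s]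
        have t2 : |S s * (Real.cos (d s) - 1) * d' s| ≤ ε * D * (2 / μ) := by
          rw [abs_mul, abs_mul]
          gcongr
          exacts [hSb s hs', hcos1 s hs', hd'b s]
        have t3 : |S s * (σ * (Real.cos (φ s + d s) - Real.cos (φ s))) / μ| ≤ ε * D / μ := by
          rw [abs_div, abs_mul, abs_mul, hσ, one_mul, abs_of_pos hμ]
          gcongr
          exacts [hSb s hs', (hlip _ _).trans (hdb s hs')]
        rw [e1, Real.norm_eq_abs]
        calc _ ≤ ε * D * (2 / μ) + ε * D * (2 / μ) + ε * D / μ :=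
              (abs_add_le _ _).trans (add_le_add ((abs_add_le _ _).trans (add_le_add t1 t2)) t3)
          _ = 5 * (ε * D / μ) := by ring
    rwa [Real.norm_eq_abs, sub_zero, abs_of_pos h2π] at h1
  have hmain : |∫ s in (0 : ℝ)..2 * π, (σ / μ * (S s * Real.cos (φ s)) - m / μ * S s)|
      ≤ 1 / μ * (1000 / r ^ 2) + X * ε / μ := by
    have hSi : |∫ s in (0 : ℝ)..2 * π, S s| ≤ ε * (2 * π) := by
      have h1 := norm_integral_le_of_norm_le_const (a := 0) (b := 2 * π) (f := S) (C := ε)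
        fun s hs => by
          rw [uIoc_of_le (by positivity)] at hs
          exact hSb s ⟨hs.1.le, hs.2⟩
      rwa [Real.norm_eq_abs, sub_zero, abs_of_pos h2π] at h1
    rw [integral_sub (hii _ _ (by fun_prop)) (hii _ _ (by fun_prop)),
      intervalIntegral.integral_const_mul, intervalIntegral.integral_const_mul]
    refine (abs_sub _ _).trans (add_le_add ?_ ?_)
    · rw [abs_mul, abs_div, hσ, abs_of_pos hμ]
      gcongr
    · rw [abs_mul, abs_div, abs_of_pos hμ]
      calc |m| / μ * |∫ s in (0 : ℝ)..2 * π, S s| ≤ |m| / μ * (ε * (2 * π)) := by gcongr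
        _ = (2 * π * |m|) * ε / μ := by ring
        _ ≤ X * ε / μ := by gcongr
  rw [hE]
  have hXb : X ≤ 2 * ε * (1 + 13 / μ) := by
    have h1 : 2 / μ * (2 * π) ≤ 13 / μ := by
      rw [div_mul_eq_mul_div]
      gcongr
      linarith
    calc X = 2 * ε * (1 + 2 / μ * (2 * π)) := by rw [hX]; ring
      _ ≤ 2 * ε * (1 + 13 / μ) := by gcongr
  have hi0 : 0 < 1 / μ := by positivity
  have hr2 : 0 < 1 / r ^ 2 := by positivity
  calc _ ≤ 5 * (ε * D / μ) * (2 * π) + (1 / μ * (1000 / r ^ 2) + X * ε / μ) := by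
        have := (abs_le.1 hdiff)
        have := (abs_le.1 hmain)
        rw [abs_le]
        constructor <;> linarith
    _ = ε * X * (20 * π * (1 / μ) ^ 2 + 1 / μ) + 1 / μ * (1000 / r ^ 2) := by
        rw [hD]; ring
    _ ≤ ε * (2 * ε * (1 + 13 / μ)) * (63 * (1 / μ) ^ 2 + 1 / μ) + 1 / μ * (1000 / r ^ 2) := by
        gcongr
        linarith
    _ = 1 / r ^ 2 * (2800 * (1 / μ) + 136800 * (1 / μ) ^ 2 + 1474200 * (1 / μ) ^ 3) := by
        rw [hε]; ring
    _ ≤ 1 / r ^ 2 * (3000000 * (1 / μ) + 3000000 * (1 / μ) ^ 2 + 3000000 * (1 / μ) ^ 3) := by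
        gcongr <;> norm_num
    _ = _ := by ring

/-- A solution of the Josephson equation starting at a point `x₀` where `cos (x₀ + ·) = σ cos`,
and with rotation number `k`, satisfies the Bessel asymptotics with sign `σ`. -/
theorem IsJosephsonSol.abs_sub_add_bessel_le {a b μ σ x₀ : ℝ} {k : ℤ} {x : ℝ → ℝ}
    (hb : 0 < b) (hμ : 0 < μ) (hk : |(k : ℝ) * μ| + 1 ≤ 1 / 10 * √(b * μ)) (hbμ : 1 * μ ≤ b)
    (hσ : |σ| = 1) (hcos : ∀ y, Real.cos (x₀ + y) = σ * Real.cos y)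
    (hx : IsJosephsonSol a b μ x) (hx0 : x 0 = x₀) (hx1 : x (2 * π) = x₀ + 2 * π * k) :
    |a / μ - k + σ * ((1 / (2 * π)) *
        ∫ t in (0 : ℝ)..(2 * π), Real.cos (k * t + (b / μ) * Real.sin t)) / μ|
      ≤ (1 / b) * (3000000 + 3000000 / μ ^ 3 + 1 * Real.log (b / μ)) := by
  set r := √(b / μ)
  have hr2 : r ^ 2 = b / μ := Real.sq_sqrt (by positivity)
  have hβ : 1 ≤ b / μ := by rw [le_div_iff₀ hμ]; exact hbμ
  have hr : 1 ≤ r := Real.one_le_sqrt.2 hβ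
  have hr0 : 0 < r := by linarith
  have hsq : √(b * μ) = r * μ := by
    rw [Real.sqrt_eq_iff_mul_self_eq (by positivity) (by positivity)]
    calc b * μ = r ^ 2 * μ ^ 2 := by rw [hr2]; field_simp
      _ = r * μ * (r * μ) := by ring
  have hκ : |(k : ℝ)| ≤ r / 10 := by
    rw [hsq, abs_mul, abs_of_pos hμ] at hk
    have : |(k : ℝ)| * μ ≤ r / 10 * μ := by linarith
    exact le_of_mul_le_mul_right this hμ
  set φ : ℝ → ℝ := fun t => k * t + r ^ 2 * Real.sin t with hφ
  set d : ℝ → ℝ := fun t => x t - x₀ - φ t with hd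
  have hxd : ∀ t, Real.cos (x t) = σ * Real.cos (φ t + d t) := fun t => by
    rw [← hcos]
    congr 1
    simp only [hd]
    ring
  have hdd : ∀ t, HasDerivAt d ((σ * Real.cos (φ t + d t) - (k * μ - a)) / μ) t := by
    intro t
    refine (((hx t).sub_const x₀).sub (((hasDerivAt_id t).const_mul (k : ℝ)).add
      ((Real.hasDerivAt_sin t).const_mul (r ^ 2)))).congr_deriv ?_
    rw [← hxd, hr2]
    field_simp
    ring
  obtain ⟨hm, hE⟩ := abs_integral_cos_add_sub_le hr hκ hμ hσ (fun _ => rfl) hdd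
    (by simp [hd, hφ, hx0]) (by simp [hd, hφ, hx1]; ring)
  have hI : (∫ t in (0 : ℝ)..(2 * π), Real.cos (k * t + (b / μ) * Real.sin t))
      = ∫ t in (0 : ℝ)..2 * π, Real.cos (φ t) := by simp only [hφ, hr2]
  rw [hI]
  set I := ∫ t in (0 : ℝ)..2 * π, Real.cos (φ t)
  set J := ∫ t in (0 : ℝ)..2 * π, Real.cos (φ t + d t)
  have hpi := pi_gt_three
  have hkey : a / μ - k + σ * ((1 / (2 * π)) * I) / μ = -(σ * (J - I)) / (2 * π * μ) := by
    field_simp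
    linear_combination -hm
  have hlog : 0 ≤ Real.log (b / μ) := Real.log_nonneg hβ
  rw [hkey, abs_div, abs_neg, abs_mul, hσ, one_mul, abs_of_pos (by positivity : 0 < 2 * π * μ),
    div_le_iff₀ (by positivity)]
  refine hE.trans ?_
  set v := 1 / μ with hv
  have hv0 : 0 < v := by positivity
  have h1 : v + v ^ 2 + v ^ 3 ≤ 6 * (1 + v ^ 3) := by
    rcases le_total v 1 with h | h <;> nlinarith [pow_pos hv0 2, pow_pos hv0 3, mul_pos hv0 hv0]
  rw [hr2]
  calc 3000000 / (b / μ) * (v + 1 / μ ^ 2 + 1 / μ ^ 3)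
      = 3000000 * (μ / b) * (v + v ^ 2 + v ^ 3) := by
        rw [hv]; field_simp
    _ ≤ 3000000 * (μ / b) * (6 * (1 + v ^ 3)) := by gcongr
    _ = 1 / b * (3000000 + 3000000 / μ ^ 3) * (6 * μ) := by
        rw [hv]; field_simp
    _ ≤ 1 / b * (3000000 + 3000000 / μ ^ 3 + 1 * Real.log (b / μ)) * (2 * π * μ) := by
        have h2 : 3000000 + 3000000 / μ ^ 3
            ≤ 3000000 + 3000000 / μ ^ 3 + 1 * Real.log (b / μ) := by linarith
        have h3 : 6 ≤ 2 * π := by linarith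
        exact mul_le_mul (mul_le_mul_of_nonneg_left h2 (by positivity))
          (mul_le_mul_of_nonneg_right h3 hμ.le) (by positivity)
          (mul_nonneg (by positivity) (le_trans (by positivity) h2))

/-- Bessel asymptotics for the boundaries of the `k`-th Arnold tongue of
the Josephson equation: here `J = J_k(-b/μ)` is the Bessel function value,
(i) concerns the boundary on which the Poincaré map fixes `0`,
(ii) the boundary on which it fixes `π`. -/
theorem bessel_asymptotics_of_tongue_boundaries :
    ∃ C₁' C₂' K₁' K₂' K₃' : ℝ,
      0 < C₁' ∧ 0 < C₂' ∧ 0 < K₁' ∧ 0 < K₂' ∧ 0 < K₃' ∧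
      ∀ (b μ : ℝ) (k : ℤ), 0 < b → 0 < μ →
        |(k : ℝ) * μ| + 1 ≤ C₁' * Real.sqrt (b * μ) → C₂' * μ ≤ b →
        (∀ (a : ℝ) (x : ℝ → ℝ), IsJosephsonSol a b μ x →
          x 0 = 0 → x (2 * π) = 2 * π * k →
          |a / μ - k +
              ((1 / (2 * π)) *
                ∫ t in (0 : ℝ)..(2 * π), Real.cos (k * t + (b / μ) * Real.sin t)) / μ|
            ≤ (1 / b) * (K₁' + K₂' / μ ^ 3 + K₃' * Real.log (b / μ))) ∧
        (∀ (a : ℝ) (x : ℝ → ℝ), IsJosephsonSol a b μ x →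
          x 0 = π → x (2 * π) = π + 2 * π * k →
          |a / μ - k -
              ((1 / (2 * π)) *
                ∫ t in (0 : ℝ)..(2 * π), Real.cos (k * t + (b / μ) * Real.sin t)) / μ|
            ≤ (1 / b) * (K₁' + K₂' / μ ^ 3 + K₃' * Real.log (b / μ))) := by
  refine ⟨1 / 10, 1, 3000000, 3000000, 1, by norm_num, by norm_num, by norm_num, by norm_num,
    by norm_num, fun b μ k hb hμ hk hbμ => ⟨fun a x hx h0 h1 => ?_, fun a x hx h0 h1 => ?_⟩⟩
  · have := hx.abs_sub_add_bessel_le (σ := 1) hb hμ hk hbμ abs_one (fun y => by simp) h0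
      (by rw [h1, zero_add])
    rwa [one_mul] at this
  · have := hx.abs_sub_add_bessel_le (σ := -1) hb hμ hk hbμ (by simp)
      (fun y => by rw [add_comm, Real.cos_add_pi]; ring) h0 h1
    rwa [neg_one_mul, neg_div, ← sub_eq_add_neg] at this
end

section
/- Fix any positive constants L₀, L₁, L₂, L₃. Then there exist positive constants C₁, C₂, K₁, K₂ depending only on L₀, L₁, L₂, L₃ such that the following holds. Let f, g : ℝ → ℝ be 2π-periodic functions with ∫₀^{2π} f(x) dx = 0 and ∫₀^{2π} g(t) dt = 0, where f is Lipschitz continuous and g is continuous, such that: (1) |f(x)| ≤ L₁ and |g(t)| ≤ L₁ for all x, t; (2) |g(t₁) − g(t₂)| ≤ L₂·|t₁ − t₂| for all t₁, t₂; (3) for every δ < 1/L₀ the Lebesgue measure of {t ∈ [0, 2π] : |g(t)| < δ} is at most L₃·δ. Consider the equation dx/dt = (f(x) + a + b·g(t))/μ and its rotation number ρ_{a,b,μ}. If a ∈ ℝ, b > 0, μ > 0 satisfy |a| + 1 ≤ C₁·√(bμ) and b ≥ C₂·μ, then | a/μ − ρ_{a,b,μ} | ≤ K₁/√(bμ) +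 (K₂/(bμ))·ln(b/μ). -/
open Real Filter intervalIntegral MeasureTheory

/-- The primitive of a continuous `T`-periodic function of mean zero is bounded. -/
lemma abs_primitive_le_of_periodic {f : ℝ → ℝ} {T L : ℝ} (hT : 0 < T) (hf : Continuous f)
    (hper : Function.Periodic f T) (hmean : ∫ u in (0 : ℝ)..T, f u = 0)
    (hL : ∀ u, |f u| ≤ L) (u : ℝ) : |∫ s in (0 : ℝ)..u, f s| ≤ T * L := by
  have hprim : Function.Periodic (fun u => ∫ s in (0 : ℝ)..u, f s) T := by
    intro v
    have h1 := integral_add_adjacent_intervals (hf.intervalIntegrable (μ := volume) 0 v)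
      (hf.intervalIntegrable (μ := volume) v (v + T))
    have h2 := hper.intervalIntegral_add_eq v 0
    rw [zero_add] at h2
    simp only
    linarith
  obtain ⟨y, hy, hyu⟩ := hprim.exists_mem_Ico₀ hT u
  rw [hyu]
  have hL0 : 0 ≤ L := (abs_nonneg _).trans (hL 0)
  have h := norm_integral_le_of_norm_le_const (a := 0) (b := y) (f := f) (C := L)
    (fun s _ => by simpa using hL s)
  rw [Real.norm_eq_abs, sub_zero, abs_of_nonneg hy.1] at h
  nlinarith [hy.2, hy.1]

/-- Layer-cake bound for `∫ 1 / (g² + δ²)` from a linear bound on the sublevel sets of `|g|`. -/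
lemma integral_inv_sq_add_sq_le {g : ℝ → ℝ} {T M δ : ℝ} (hT : 0 ≤ T) (hg : Continuous g)
    (hδ : 0 < δ)
    (hM : ∀ s, 0 < s → volume.real {t ∈ Set.Icc (0 : ℝ) T | |g t| < s} ≤ M * s) :
    ∫ t in (0 : ℝ)..T, 1 / (g t ^ 2 + δ ^ 2) ≤ 2 * M / δ := by
  have hpos : ∀ t, 0 < g t ^ 2 + δ ^ 2 := fun t => by positivity
  have hcont : Continuous fun t => 1 / (g t ^ 2 + δ ^ 2) :=
    continuous_const.div (by fun_prop) fun t => (hpos t).ne'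
  rw [integral_of_le hT, ← integral_Icc_eq_integral_Ioc]
  rw [Integrable.integral_eq_integral_Ioc_meas_le (M := 1 / δ ^ 2) hcont.integrableOn_Icc
    (Eventually.of_forall fun t => by have := hpos t; simp only [Pi.zero_apply]; positivity)
    (Eventually.of_forall fun t => one_div_le_one_div_of_le (by positivity)
      (by nlinarith [sq_nonneg (g t)]))]
  have hint : IntervalIntegrable (fun s : ℝ => M * s ^ (-(1 / 2) : ℝ)) volume 0 (1 / δ ^ 2) :=
    (intervalIntegrable_rpow' (by norm_num)).const_mul M
  calc _ ≤ ∫ s in Set.Ioc 0 (1 / δ ^ 2), M * s ^ (-(1 / 2) : ℝ) := by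
        refine integral_mono_of_nonneg (Eventually.of_forall fun s => measureReal_nonneg)
          ((intervalIntegrable_iff_integrableOn_Ioc_of_le (by positivity)).1 hint) ?_
        filter_upwards [ae_restrict_mem measurableSet_Ioc] with s hs
        have hs0 : 0 < s := hs.1
        rw [measureReal_restrict_apply (measurableSet_le measurable_const hcont.measurable)]
        have hsr : s ^ (-(1 / 2) : ℝ) = 1 / √s := by
          rw [rpow_neg hs0.le, ← sqrt_eq_rpow, one_div]
        rw [hsr]
        refine le_trans (measureReal_mono ?_ ?_) (hM (1 / √s) (by positivity))
        · rintro t ⟨ht1, ht2⟩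
          refine ⟨ht2, ?_⟩
          have ht1 : s ≤ 1 / (g t ^ 2 + δ ^ 2) := ht1
          rw [le_div_iff₀ (hpos t)] at ht1
          refine abs_lt_of_sq_lt_sq ?_ (by positivity)
          rw [div_pow, sq_sqrt hs0.le, one_pow, lt_div_iff₀ hs0]
          nlinarith [mul_pos hs0 (pow_pos hδ 2)]
        · exact ((measure_mono (Set.sep_subset _ _)).trans_lt measure_Icc_lt_top).ne
    _ = 2 * M / δ := by
        rw [← integral_of_le (by positivity), intervalIntegral.integral_const_mul,
          integral_rpow (by norm_num), zero_rpow (by norm_num)]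
        have : (-(1 / 2) + 1 : ℝ) = 1 / 2 := by norm_num
        rw [this, ← sqrt_eq_rpow, sqrt_div zero_le_one, sqrt_sq hδ.le, sqrt_one]
        field_simp
        ring

/-- Layer-cake bound for `∫ 1 / √(g² + δ²)` from a linear bound on the sublevel sets of `|g|`. -/
lemma integral_inv_sqrt_sq_add_sq_le {g : ℝ → ℝ} {T M δ : ℝ} (hT : 0 ≤ T) (hg : Continuous g)
    (hδ : 0 < δ) (hδ1 : δ ≤ 1)
    (hM : ∀ s, 0 < s → volume.real {t ∈ Set.Icc (0 : ℝ) T | |g t| < s} ≤ M * s) :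
    ∫ t in (0 : ℝ)..T, 1 / √(g t ^ 2 + δ ^ 2) ≤ T + M * log (1 / δ) := by
  have hpos : ∀ t, 0 < g t ^ 2 + δ ^ 2 := fun t => by positivity
  have hpos' : ∀ t, 0 < √(g t ^ 2 + δ ^ 2) := fun t => sqrt_pos.2 (hpos t)
  have hcont : Continuous fun t => 1 / √(g t ^ 2 + δ ^ 2) :=
    continuous_const.div (by fun_prop) fun t => (hpos' t).ne'
  have h1δ : 1 ≤ 1 / δ := by rwa [le_div_iff₀ hδ, one_mul]
  rw [integral_of_le hT, ← integral_Icc_eq_integral_Ioc]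
  rw [Integrable.integral_eq_integral_Ioc_meas_le (M := 1 / δ) hcont.integrableOn_Icc
    (Eventually.of_forall fun t => by have := hpos' t; simp only [Pi.zero_apply]; positivity)
    (Eventually.of_forall fun t => one_div_le_one_div_of_le hδ
      (le_sqrt_of_sq_le (by nlinarith [sq_nonneg (g t)])))]
  set m : ℝ → ℝ := fun s => (volume.restrict (Set.Icc 0 T)).real
    {t | s ≤ 1 / √(g t ^ 2 + δ ^ 2)} with hm
  have hanti : Antitone m := fun s s' hss => measureReal_mono
    (fun t (ht : s' ≤ _) => hss.trans ht)
  have hmi : ∀ c d, IntervalIntegrable m volume c d := fun c d => hanti.intervalIntegrable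
  rw [← integral_of_le (by positivity), ← integral_add_adjacent_intervals (hmi 0 1) (hmi 1 (1 / δ))]
  have hb1 : ∫ s in (0 : ℝ)..1, m s ≤ T := by
    have : ∫ s in (0 : ℝ)..1, m s ≤ ∫ s in (0 : ℝ)..1, T := by
      refine integral_mono zero_le_one (hmi 0 1) (by simp) fun s => ?_
      refine (measureReal_mono (Set.subset_univ _)).trans ?_
      simp [hT]
    simpa using this
  have hint : IntervalIntegrable (fun s : ℝ => M * s⁻¹) volume 1 (1 / δ) := by
    refine (intervalIntegrable_inv (fun x hx => ?_) continuousOn_id).const_mul M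
    rw [Set.uIcc_of_le h1δ] at hx
    exact (zero_lt_one.trans_le hx.1).ne'
  have hb2 : ∫ s in (1 : ℝ)..(1 / δ), m s ≤ M * log (1 / δ) := by
    have : ∫ s in (1 : ℝ)..(1 / δ), m s ≤ ∫ s in (1 : ℝ)..(1 / δ), M * s⁻¹ := by
      refine integral_mono_on h1δ (hmi _ _) hint fun s hs => ?_
      have hs0 : 0 < s := zero_lt_one.trans_le hs.1
      simp only [hm]
      rw [measureReal_restrict_apply (measurableSet_le measurable_const hcont.measurable)]
      refine le_trans (measureReal_mono ?_ ?_) (hM s⁻¹ (by positivity))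
      · rintro t ⟨ht1, ht2⟩
        refine ⟨ht2, ?_⟩
        have ht1 : s ≤ 1 / √(g t ^ 2 + δ ^ 2) := ht1
        rw [le_div_iff₀ (hpos' t), mul_comm, ← le_div_iff₀ hs0, one_div] at ht1
        refine lt_of_lt_of_le ?_ ht1
        exact lt_sqrt_of_sq_lt (by rw [sq_abs]; nlinarith)
      · exact ((measure_mono (Set.sep_subset _ _)).trans_lt measure_Icc_lt_top).ne
    refine this.trans_eq ?_
    rw [intervalIntegral.integral_const_mul, integral_inv_of_pos one_pos (by positivity), div_one]
  linarith

/-- The function `u ↦ u / (u² + η²)`, a smooth bounded regularization of `u⁻¹`. -/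
noncomputable def regInv (η u : ℝ) : ℝ := u / (u ^ 2 + η ^ 2)

lemma hasDerivAt_regInv {η : ℝ} (hη : 0 < η) (u : ℝ) :
    HasDerivAt (regInv η) ((η ^ 2 - u ^ 2) / (u ^ 2 + η ^ 2) ^ 2) u := by
  have h := (hasDerivAt_id u).div (((hasDerivAt_id u).pow 2).add_const (η ^ 2))
    (by simp only [id, Pi.pow_apply]; positivity)
  convert! h using 1
  simp
  ring

lemma abs_deriv_regInv_le {η : ℝ} (hη : 0 < η) (u : ℝ) :
    |(η ^ 2 - u ^ 2) / (u ^ 2 + η ^ 2) ^ 2| ≤ 1 / (u ^ 2 + η ^ 2) := by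
  have hpos : 0 < u ^ 2 + η ^ 2 := by positivity
  rw [abs_div, abs_of_pos (pow_pos hpos 2), div_le_div_iff₀ (pow_pos hpos 2) hpos, one_mul, sq (_ + _)]
  refine mul_le_mul_of_nonneg_right ?_ hpos.le
  rw [abs_le]
  constructor <;> nlinarith [sq_nonneg u, sq_nonneg η]

lemma lipschitzWith_regInv {η : ℝ} (hη : 0 < η) :
    LipschitzWith (Real.toNNReal (1 / η ^ 2)) (regInv η) := by
  refine lipschitzWith_of_nnnorm_deriv_le (fun u => (hasDerivAt_regInv hη u).differentiableAt)
    fun u => ?_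
  rw [← NNReal.coe_le_coe, coe_nnnorm, Real.coe_toNNReal _ (by positivity),
    (hasDerivAt_regInv hη u).deriv, Real.norm_eq_abs]
  exact (abs_deriv_regInv_le hη u).trans
    (one_div_le_one_div_of_le (by positivity) (by nlinarith [sq_nonneg u]))

lemma abs_regInv_le {η : ℝ} (hη : 0 < η) (u : ℝ) : |regInv η u| ≤ 1 / √(u ^ 2 + η ^ 2) := by
  have hpos : 0 < u ^ 2 + η ^ 2 := by positivity
  have hs : |u| ≤ √(u ^ 2 + η ^ 2) := abs_le_sqrt (by nlinarith [sq_nonneg η])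
  rw [regInv, abs_div, abs_of_pos hpos, div_le_div_iff₀ hpos (sqrt_pos.2 hpos), one_mul]
  nlinarith [sq_sqrt hpos.le, sqrt_nonneg (u ^ 2 + η ^ 2)]

lemma sq_mul_add_sq_le {a b δ y : ℝ} (ha : |a| ≤ b * δ) :
    b ^ 2 * (y ^ 2 + δ ^ 2) ≤ 3 * ((a + b * y) ^ 2 + (b * δ) ^ 2) := by
  have h : a ^ 2 ≤ (b * δ) ^ 2 := sq_le_sq' (by linarith [neg_abs_le a]) ((le_abs_self a).trans ha)
  nlinarith [sq_nonneg (2 * a + b * y), sq_nonneg (b * y + a)]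

/-- Averaging estimate along a solution of `x' = (f(x) + a + b g(t)) / (b δ²)`, in terms of two
singular integrals of `g`. -/
lemma abs_integral_comp_solution_le {f g x : ℝ → ℝ} {a b δ L₁ L₂ B T S R : ℝ} (hT : 0 ≤ T)
    (hb : 0 < b) (hδ : 0 < δ) (hL₁ : 0 ≤ L₁) (hL₂ : 0 ≤ L₂) (hf : Continuous f)
    (hfL : ∀ u, |f u| ≤ L₁) (hB : ∀ u, |∫ s in (0 : ℝ)..u, f s| ≤ B)
    (hgL : ∀ t₁ t₂, |g t₁ - g t₂| ≤ L₂ * |t₁ - t₂|)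
    (ha : |a| ≤ b * δ)
    (hx : ∀ t, HasDerivAt x ((f (x t) + a + b * g t) / (b * δ ^ 2)) t)
    (hS : ∫ t in (0 : ℝ)..T, 1 / (g t ^ 2 + δ ^ 2) ≤ S)
    (hR : ∫ t in (0 : ℝ)..T, 1 / √(g t ^ 2 + δ ^ 2) ≤ R) :
    |∫ t in (0 : ℝ)..T, f (x t)| ≤
      2 * B * δ + 3 * B * L₂ * δ ^ 2 * S + 2 * L₁ ^ 2 / b * R + 3 * L₁ * δ ^ 2 * S := by
  have hB0 : 0 ≤ B := (abs_nonneg _).trans (hB 0)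
  have hη : 0 < b * δ := mul_pos hb hδ
  have hglip : LipschitzWith L₂.toNNReal g := LipschitzWith.of_dist_le_mul fun s t => by
    rw [Real.dist_eq, Real.dist_eq, Real.coe_toNNReal _ hL₂]; exact hgL s t
  have hg : Continuous g := hglip.continuous
  have hxc : Continuous x := continuous_iff_continuousAt.2 fun t => (hx t).continuousAt
  have hq : ∀ t, 0 < g t ^ 2 + δ ^ 2 := fun t => by positivity
  have hφc : Continuous fun t => 1 / (g t ^ 2 + δ ^ 2) :=
    continuous_const.div (by fun_prop) fun t => (hq t).ne'
  have hψc : Continuous fun t => 1 / √(g t ^ 2 + δ ^ 2) :=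
    continuous_const.div (by fun_prop) fun t => (sqrt_pos.2 (hq t)).ne'
  set H : ℝ → ℝ := fun t => regInv (b * δ) (a + b * g t) with hH
  set F : ℝ → ℝ := fun u => ∫ s in (0 : ℝ)..u, f s with hF
  have hFd : ∀ u, HasDerivAt F (f u) u := fun u => hf.integral_hasStrictDerivAt 0 u |>.hasDerivAt
  have hwlip : LipschitzWith (b.toNNReal * L₂.toNNReal) (fun t => a + b * g t) :=
    LipschitzWith.of_dist_le_mul fun s t => by
      rw [Real.dist_eq, Real.dist_eq, NNReal.coe_mul, Real.coe_toNNReal _ hL₂,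
        Real.coe_toNNReal _ hb.le, add_sub_add_left_eq_sub, ← mul_sub, abs_mul, abs_of_pos hb,
        mul_assoc]
      exact mul_le_mul_of_nonneg_left (hgL s t) hb.le
  have hHlip := (lipschitzWith_regInv hη).comp hwlip
  have hHc : Continuous H := hHlip.continuous
  have hHac : AbsolutelyContinuousOnInterval H 0 T :=
    hHlip.lipschitzOnWith.absolutelyContinuousOnInterval
  -- pointwise bounds on the regularized inverse and its derivative
  have hinv : ∀ t, 1 / ((a + b * g t) ^ 2 + (b * δ) ^ 2) ≤ 3 / b ^ 2 * (1 / (g t ^ 2 + δ ^ 2)) := by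
    intro t
    have := sq_mul_add_sq_le (y := g t) ha
    rw [div_mul_div_comm, mul_one, div_le_div_iff₀ (by positivity) (by have := hq t; positivity)]
    linarith
  have hHb : ∀ t, |H t| ≤ 2 / b * (1 / √(g t ^ 2 + δ ^ 2)) := by
    intro t
    refine (abs_regInv_le hη _).trans ?_
    have hs := sqrt_pos.2 (hq t)
    rw [div_mul_div_comm, mul_one, div_le_div_iff₀ (by positivity) (by positivity), one_mul]
    have h2 : b * √(g t ^ 2 + δ ^ 2) = √(b ^ 2 * (g t ^ 2 + δ ^ 2)) := by
      rw [sqrt_mul (by positivity), sqrt_sq hb.le]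
    have h3 : 2 * √((a + b * g t) ^ 2 + (b * δ) ^ 2)
        = √(2 ^ 2 * ((a + b * g t) ^ 2 + (b * δ) ^ 2)) := by
      rw [sqrt_mul (by positivity), sqrt_sq (by norm_num)]
    rw [h2, h3]
    have := sq_mul_add_sq_le (y := g t) ha
    exact sqrt_le_sqrt (by nlinarith [sq_nonneg (a + b * g t), sq_nonneg (b * δ)])
  have hHη : ∀ t, |H t| ≤ 1 / (b * δ) := by
    intro t
    refine (abs_regInv_le hη _).trans (one_div_le_one_div_of_le hη ?_)
    exact le_sqrt_of_sq_le (by nlinarith [sq_nonneg (a + b * g t)])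
  have hdH : ∀ᵐ t, |deriv H t| ≤ 3 * L₂ / b * (1 / (g t ^ 2 + δ ^ 2)) := by
    filter_upwards [hglip.ae_differentiableAt_real] with t ht
    have h1 := (hasDerivAt_regInv hη (a + b * g t)).comp t
      ((ht.hasDerivAt.const_mul b).const_add a)
    have h2 : deriv H t = _ := h1.deriv
    have h3 : |deriv g t| ≤ L₂ := by
      simpa [Real.coe_toNNReal _ hL₂] using norm_deriv_le_of_lipschitz (x₀ := t) hglip
    rw [h2, abs_mul, abs_mul, abs_of_pos hb]
    calc _ ≤ (3 / b ^ 2 * (1 / (g t ^ 2 + δ ^ 2))) * (b * L₂) := by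
          refine mul_le_mul ((abs_deriv_regInv_le hη _).trans (hinv t))
            (mul_le_mul_of_nonneg_left h3 hb.le) (by positivity) (by have := hq t; positivity)
      _ = _ := by have := (hq t).ne'; field_simp
  -- integration by parts
  have hFx : ∀ t, HasDerivAt (fun t => F (x t))
      (f (x t) * ((f (x t) + a + b * g t) / (b * δ ^ 2))) t := fun t => (hFd (x t)).comp t (hx t)
  have hFxderiv : deriv (fun t => F (x t)) =
      fun t => f (x t) * ((f (x t) + a + b * g t) / (b * δ ^ 2)) := funext fun t => (hFx t).deriv
  have hFxac : AbsolutelyContinuousOnInterval (fun t => F (x t)) 0 T := by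
    refine ContDiffOn.absolutelyContinuousOnInterval (ContDiff.contDiffOn ?_)
    refine contDiff_one_iff_deriv.2 ⟨fun t => (hFx t).differentiableAt, ?_⟩
    rw [hFxderiv]
    fun_prop
  have hparts := hHac.integral_mul_deriv_eq_deriv_mul hFxac
  rw [hFxderiv] at hparts
  have hint2 : |∫ t in (0 : ℝ)..T, deriv H t * F (x t)| ≤ B * (3 * L₂ / b) * S := by
    have h := norm_integral_le_of_norm_le (f := fun t => deriv H t * F (x t)) (μ := volume)
      (g := fun t => B * (3 * L₂ / b) * (1 / (g t ^ 2 + δ ^ 2))) hT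
      (by
        filter_upwards [hdH] with t ht _
        rw [Real.norm_eq_abs, abs_mul, mul_comm B, mul_right_comm]
        exact mul_le_mul ht (hB _) (abs_nonneg _) ((abs_nonneg _).trans ht))
      ((hφc.const_mul _).intervalIntegrable _ _)
    rw [intervalIntegral.integral_const_mul] at h
    exact h.trans (mul_le_mul_of_nonneg_left hS (by positivity))
  have hbd : ∀ t, |H t * F (x t)| ≤ B / (b * δ) := fun t => by
    rw [abs_mul, div_eq_mul_one_div, mul_comm B]
    exact mul_le_mul (hHη t) (hB _) (abs_nonneg _) (by positivity)
  have hI1 : |∫ t in (0 : ℝ)..T, H t * (f (x t) * ((f (x t) + a + b * g t) / (b * δ ^ 2)))| ≤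
      2 * B / (b * δ) + B * (3 * L₂ / b) * S := by
    rw [hparts]
    refine (abs_sub _ _).trans (add_le_add ((abs_sub _ _).trans ?_) hint2)
    have := hbd T
    have := hbd 0
    rw [mul_div_assoc]
    linarith
  have hI2 : |∫ t in (0 : ℝ)..T, f (x t) ^ 2 * H t| ≤ L₁ ^ 2 * (2 / b) * R := by
    have h := norm_integral_le_of_norm_le (f := fun t => f (x t) ^ 2 * H t) (μ := volume)
      (g := fun t => L₁ ^ 2 * (2 / b) * (1 / √(g t ^ 2 + δ ^ 2))) hT
      (Eventually.of_forall fun t _ => by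
        rw [Real.norm_eq_abs, abs_mul, abs_pow, mul_assoc]
        exact mul_le_mul (pow_le_pow_left₀ (abs_nonneg _) (hfL _) 2) (hHb t) (abs_nonneg _)
          (by positivity))
      ((hψc.const_mul _).intervalIntegrable _ _)
    rw [intervalIntegral.integral_const_mul] at h
    exact h.trans (mul_le_mul_of_nonneg_left hR (by positivity))
  set Φ : ℝ → ℝ := fun t => f (x t) * ((b * δ) ^ 2 * (1 / ((a + b * g t) ^ 2 + (b * δ) ^ 2)))
    with hΦ
  have hΦc : Continuous Φ := by
    refine (hf.comp hxc).mul (continuous_const.mul (continuous_const.div (by fun_prop) fun t => ?_))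
    positivity
  have hI3 : |∫ t in (0 : ℝ)..T, Φ t| ≤ L₁ * (3 * δ ^ 2) * S := by
    have h := norm_integral_le_of_norm_le (f := Φ) (μ := volume)
      (g := fun t => L₁ * (3 * δ ^ 2) * (1 / (g t ^ 2 + δ ^ 2))) hT
      (Eventually.of_forall fun t _ => by
        rw [Real.norm_eq_abs, hΦ, abs_mul, mul_assoc]
        refine mul_le_mul (hfL _) ?_ (abs_nonneg _) hL₁
        rw [abs_of_nonneg (by positivity)]
        calc _ ≤ (b * δ) ^ 2 * (3 / b ^ 2 * (1 / (g t ^ 2 + δ ^ 2))) :=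
              mul_le_mul_of_nonneg_left (hinv t) (by positivity)
          _ = _ := by have := (hq t).ne'; field_simp)
      ((hφc.const_mul _).intervalIntegrable _ _)
    rw [intervalIntegral.integral_const_mul] at h
    exact h.trans (mul_le_mul_of_nonneg_left hS (by positivity))
  have hsplit : ∫ t in (0 : ℝ)..T, f (x t) =
      b * δ ^ 2 * (∫ t in (0 : ℝ)..T, H t * (f (x t) * ((f (x t) + a + b * g t) / (b * δ ^ 2))))
        - (∫ t in (0 : ℝ)..T, f (x t) ^ 2 * H t) + ∫ t in (0 : ℝ)..T, Φ t := by
    rw [← intervalIntegral.integral_const_mul, ← intervalIntegral.integral_sub,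
      ← intervalIntegral.integral_add]
    · refine integral_congr fun t _ => ?_
      have : (a + b * g t) ^ 2 + (b * δ) ^ 2 ≠ 0 := by positivity
      simp only [hH, hΦ, regInv]
      field_simp
      ring
    all_goals exact Continuous.intervalIntegrable (by fun_prop) _ _
  rw [hsplit]
  have hmul := mul_le_mul_of_nonneg_left hI1 (by positivity : 0 ≤ b * δ ^ 2)
  have heq : b * δ ^ 2 * (2 * B / (b * δ) + B * (3 * L₂ / b) * S) + L₁ ^ 2 * (2 / b) * R
      + L₁ * (3 * δ ^ 2) * S
      = 2 * B * δ + 3 * B * L₂ * δ ^ 2 * S + 2 * L₁ ^ 2 / b * R + 3 * L₁ * δ ^ 2 * S := by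
    field_simp
  rw [← heq]
  refine (abs_add_le _ _).trans (add_le_add ((abs_sub _ _).trans (add_le_add ?_ hI2)) hI3)
  rw [abs_mul, abs_of_pos (by positivity : 0 < b * δ ^ 2)]
  exact hmul

/-- A map whose displacement is uniformly within `E` of `c` has translation number within `E`
of `c`. -/
lemma abs_sub_le_of_tendsto_iterate {P : ℝ → ℝ} {c E x₀ r : ℝ}
    (hP : ∀ y, |P y - y - c| ≤ E)
    (hr : Tendsto (fun n : ℕ => (P^[n] x₀ - x₀) / n) atTop (nhds r)) : |c - r| ≤ E := by
  have hn : ∀ n : ℕ, |P^[n] x₀ - x₀ - n * c| ≤ n * E := by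
    intro n
    induction n with
    | zero => simp
    | succ n ih =>
      rw [Function.iterate_succ_apply', Nat.cast_add_one]
      have h := (abs_add_le _ _).trans (add_le_add (hP (P^[n] x₀)) ih)
      convert! h using 1
      · congr 1
        ring
      · ring
  have hlim : Tendsto (fun n : ℕ => |c - (P^[n] x₀ - x₀) / n|) atTop (nhds |c - r|) :=
    (tendsto_const_nhds.sub hr).abs
  refine le_of_tendsto hlim ((eventually_gt_atTop 0).mono fun n hn0 => ?_)
  have hn0' : (0 : ℝ) < n := Nat.cast_pos.2 hn0
  have heq : c - (P^[n] x₀ - x₀) / n = -((P^[n] x₀ - x₀ - n * c) / n) := by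
    field_simp
    ring
  rw [heq, abs_neg, abs_div, abs_of_pos hn0', div_le_iff₀ hn0', mul_comm E]
  exact hn n

/-- A linear bound for the measure of small sublevel sets of `|g|` extends to all levels. -/
lemma measureReal_sublevel_le {g : ℝ → ℝ} {T L₀ L₃ : ℝ} (hT : 0 ≤ T) (hL₀ : 0 < L₀)
    (hL₃ : 0 ≤ L₃)
    (h : ∀ δ : ℝ, δ < 1 / L₀ →
      volume {t ∈ Set.Icc (0 : ℝ) T | |g t| < δ} ≤ ENNReal.ofReal (L₃ * δ))
    (s : ℝ) (hs : 0 < s) :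
    volume.real {t ∈ Set.Icc (0 : ℝ) T | |g t| < s} ≤ (L₃ + T * L₀) * s := by
  rcases lt_or_ge s (1 / L₀) with hlt | hge
  · have h1 : volume.real {t ∈ Set.Icc (0 : ℝ) T | |g t| < s} ≤ L₃ * s :=
      ENNReal.toReal_le_of_le_ofReal (by positivity) (h s hlt)
    have : 0 ≤ T * L₀ * s := by positivity
    linarith
  · have h1 : volume.real {t ∈ Set.Icc (0 : ℝ) T | |g t| < s} ≤ T := by
      refine (measureReal_mono (Set.sep_subset _ _) measure_Icc_lt_top.ne).trans ?_
      simp [hT]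
    rw [div_le_iff₀ hL₀] at hge
    have : 0 ≤ L₃ * s := by positivity
    nlinarith

/-- (Generalized Theorem 1: rotation number of
`dx/dt = (f(x) + a + b g(t))/μ` is close to `a/μ`, with constants depending only on
the constants `L₀, L₁, L₂, L₃` quantifying the assumptions on `f` and `g`.) -/
theorem rotation_number_close_general
    (L₀ L₁ L₂ L₃ : ℝ) (hL₀ : 0 < L₀) (hL₁ : 0 < L₁) (hL₂ : 0 < L₂) (hL₃ : 0 < L₃) :
    ∃ C₁ C₂ K₁ K₂ : ℝ, 0 < C₁ ∧ 0 < C₂ ∧ 0 < K₁ ∧ 0 < K₂ ∧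
      ∀ f g : ℝ → ℝ,
        (∃ K : NNReal, LipschitzWith K f) → Continuous g →
        (∀ u : ℝ, f (u + 2 * π) = f u) → (∀ t : ℝ, g (t + 2 * π) = g t) →
        (∫ u in (0 : ℝ)..(2 * π), f u) = 0 → (∫ t in (0 : ℝ)..(2 * π), g t) = 0 →
        (∀ u : ℝ, |f u| ≤ L₁) → (∀ t : ℝ, |g t| ≤ L₁) →
        (∀ t₁ t₂ : ℝ, |g t₁ - g t₂| ≤ L₂ * |t₁ - t₂|) →
        (∀ δ : ℝ, δ < 1 / L₀ →
          volume {t ∈ Set.Icc (0 : ℝ) (2 * π) | |g t| < δ} ≤ ENNReal.ofReal (L₃ * δ)) →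
        ∀ (a b μ : ℝ) (P : ℝ → ℝ) (ρ : ℝ), 0 < b → 0 < μ →
          (∀ x₀ : ℝ, ∃ x : ℝ → ℝ,
            (∀ t : ℝ, HasDerivAt x ((f (x t) + a + b * g t) / μ) t) ∧
            x 0 = x₀ ∧ P x₀ = x (2 * π)) →
          (∀ x₀ : ℝ,
            Tendsto (fun n : ℕ => (P^[n] x₀ - x₀) / (2 * π * n)) atTop (nhds ρ)) →
          |a| + 1 ≤ C₁ * Real.sqrt (b * μ) → C₂ * μ ≤ b →
          |a / μ - ρ| ≤ K₁ / Real.sqrt (b * μ) + (K₂ / (b * μ)) * Real.log (b / μ) := by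
  set M : ℝ := L₃ + 2 * π * L₀ with hMdef
  have hπ : 0 < 2 * π := by positivity
  have hM0 : 0 < M := by positivity
  refine ⟨1, exp 1, (2 * (2 * π * L₁) + 6 * (2 * π * L₁) * L₂ * M + 6 * L₁ * M) / (2 * π),
    2 * L₁ ^ 2 * (2 * π + M) / (2 * π), one_pos, exp_pos 1, by positivity, by positivity, ?_⟩
  rintro f g ⟨K, hK⟩ hg hfper - hfmean hgmean hfL - hgL hgM a b μ P ρ hb hμ hP hρ ha hbμ
  have hf := hK.continuous
  obtain ⟨δ, hδ, rfl⟩ : ∃ δ, 0 < δ ∧ μ = b * δ ^ 2 :=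
    ⟨√(μ / b), sqrt_pos.2 (by positivity), by rw [sq_sqrt (by positivity)]; field_simp⟩
  have hsqrt : √(b * (b * δ ^ 2)) = b * δ := by
    rw [← sqrt_sq (by positivity : 0 ≤ b * δ)]
    congr 1
    ring
  have hratio : b / (b * δ ^ 2) = (1 / δ) ^ 2 := by field_simp
  have hlog : log (b / (b * δ ^ 2)) = 2 * log (1 / δ) := by
    rw [hratio, log_pow]
    norm_num
  have hlog1 : 1 ≤ log (b / (b * δ ^ 2)) := by
    rw [le_log_iff_exp_le (by positivity), le_div_iff₀ hμ]
    exact hbμ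
  have hδ1 : δ ≤ 1 := by
    by_contra! hlt
    have := log_neg (x := 1 / δ) (by positivity) (by rwa [div_lt_one (by positivity)])
    linarith
  rw [hsqrt] at ha ⊢
  have hsub := measureReal_sublevel_le hπ.le hL₀ hL₃.le hgM
  rw [← hMdef] at hsub
  have hS := integral_inv_sq_add_sq_le hπ.le hg hδ hsub
  have hR := integral_inv_sqrt_sq_add_sq_le hπ.le hg hδ hδ1 hsub
  have hB := abs_primitive_le_of_periodic hπ hf hfper hfmean hfL
  set ℓ := log (b / (b * δ ^ 2)) with hℓ
  set E : ℝ := ((2 * (2 * π * L₁) + 6 * (2 * π * L₁) * L₂ * M + 6 * L₁ * M) * δ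
    + 2 * L₁ ^ 2 * (2 * π + M) / b * ℓ) / (b * δ ^ 2) with hE
  have hdisp : ∀ y, |P y - y - 2 * π * (a / (b * δ ^ 2))| ≤ E := by
    intro y
    obtain ⟨x, hx, hx0, hPx⟩ := hP y
    have hxc : Continuous x := continuous_iff_continuousAt.2 fun t => (hx t).continuousAt
    have hmain := abs_integral_comp_solution_le hπ.le hb hδ hL₁.le hL₂.le hf hfL hB hgL
      (by linarith) hx hS hR
    have hincr : P y - y - 2 * π * (a / (b * δ ^ 2)) =
        (∫ t in (0 : ℝ)..(2 * π), f (x t)) / (b * δ ^ 2) := by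
      have hftc := integral_eq_sub_of_hasDerivAt (a := 0) (b := 2 * π) (fun t _ => hx t)
        (Continuous.intervalIntegrable (by fun_prop) _ _)
      rw [intervalIntegral.integral_div, intervalIntegral.integral_add
        (Continuous.intervalIntegrable (by fun_prop) _ _)
        (Continuous.intervalIntegrable (by fun_prop) _ _), intervalIntegral.integral_add
        (Continuous.intervalIntegrable (by fun_prop) _ _)
        (Continuous.intervalIntegrable (by fun_prop) _ _), intervalIntegral.integral_const_mul,
        hgmean, intervalIntegral.integral_const, smul_eq_mul, hx0, ← hPx] at hftc
      rw [← hftc]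
      ring
    rw [hincr, abs_div, abs_of_pos hμ, hE]
    refine div_le_div_of_nonneg_right (hmain.trans ?_) hμ.le
    have h1 : 2 * π + M * log (1 / δ) ≤ (2 * π + M) * ℓ := by nlinarith
    have h2 := mul_le_mul_of_nonneg_left h1 (by positivity : 0 ≤ 2 * L₁ ^ 2 / b)
    have h3 : δ ^ 2 * (2 * M / δ) = 2 * M * δ := by field_simp
    have h4 : 2 * L₁ ^ 2 * (2 * π + M) / b * ℓ = 2 * L₁ ^ 2 / b * ((2 * π + M) * ℓ) := by ring
    rw [mul_assoc _ (δ ^ 2), mul_assoc _ (δ ^ 2), h3, h4]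
    linarith
  have hr : Tendsto (fun n : ℕ => (P^[n] 0 - 0) / n) atTop (nhds (2 * π * ρ)) := by
    refine ((hρ 0).const_mul (2 * π)).congr fun n => ?_
    rw [mul_div_assoc', mul_div_mul_left _ _ hπ.ne']
  have hfin := abs_sub_le_of_tendsto_iterate hdisp hr
  rw [← mul_sub, abs_mul, abs_of_pos hπ, ← le_div_iff₀' hπ] at hfin
  refine hfin.trans_eq ?_
  rw [hE]
  field_simp
end

section
/- Let g : [0, 2π] → ℝ be measurable and suppose there are ε₀ > 0 and L > 0 such that for every ε with 0 < ε ≤ ε₀ the Lebesgue measure of {t ∈ [0, 2π] : |g(t)| ≤ ε} is at most L·ε. Then for every δ with 0 < δ ≤ ε₀ one has ∫_{{t ∈ [0,2π] : |g(t)| ≥ δ}} 1/g(t)² dt ≤ 2π/ε₀² + 2L/δ. -/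
open Real Set MeasureTheory

theorem lintegral_Ioc_const_mul_rpow_neg_half {b L : ℝ} (hb : 0 ≤ b) (hL : 0 ≤ L) :
    (∫⁻ s in Ioc 0 b, ENNReal.ofReal (L * s ^ (-(1 / 2) : ℝ)))
      = ENNReal.ofReal (2 * L * √b) := by
  have hint : IntervalIntegrable (fun s : ℝ => L * s ^ (-(1 / 2) : ℝ)) volume 0 b :=
    (intervalIntegral.intervalIntegrable_rpow' (by norm_num)).const_mul L
  rw [← ofReal_integral_eq_lintegral_ofReal
    ((intervalIntegrable_iff_integrableOn_Ioc_of_le hb).1 hint)]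
  · rw [← intervalIntegral.integral_of_le hb, intervalIntegral.integral_const_mul,
      integral_rpow (Or.inl (by norm_num)), Real.sqrt_eq_rpow]
    congr 1
    norm_num
    ring
  · filter_upwards [ae_restrict_mem measurableSet_Ioc] with s hs
    exact mul_nonneg hL (rpow_nonneg hs.1.le _)

theorem abs_le_rpow_neg_half_of_le_one_div_sq {s x : ℝ} (hs : 0 < s) (h : s ≤ 1 / x ^ 2) :
    |x| ≤ s ^ (-(1 / 2) : ℝ) := by
  have hx : 0 < x ^ 2 := one_div_pos.1 (hs.trans_le h)
  rw [rpow_neg hs.le, ← Real.sqrt_eq_rpow, ← Real.sqrt_inv]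
  refine Real.abs_le_sqrt ?_
  rwa [le_inv_comm₀ hx hs, ← one_div]

/-- Layer-cake integral estimate: if the sublevel sets of `|g|` on
`[0, 2π]` satisfy `mes {|g| ≤ ε} ≤ Lε` for `0 < ε ≤ ε₀`, then
`∫_{|g| ≥ δ} dt/g² ≤ 2π/ε₀² + 2L/δ` for every `0 < δ ≤ ε₀`. -/
theorem layer_cake_transversality_estimate
    (g : ℝ → ℝ) (hg : Measurable g) (ε₀ L : ℝ) (hε₀ : 0 < ε₀) (hL : 0 < L)
    (hmes : ∀ ε : ℝ, 0 < ε → ε ≤ ε₀ →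
      volume {t ∈ Set.Icc (0 : ℝ) (2 * π) | |g t| ≤ ε} ≤ ENNReal.ofReal (L * ε)) :
    ∀ δ : ℝ, 0 < δ → δ ≤ ε₀ →
      (∫⁻ t in {t ∈ Set.Icc (0 : ℝ) (2 * π) | δ ≤ |g t|},
          ENNReal.ofReal (1 / g t ^ 2))
        ≤ ENNReal.ofReal (2 * π / ε₀ ^ 2 + 2 * L / δ) := by
  intro δ hδ _
  set S := {t ∈ Set.Icc (0 : ℝ) (2 * π) | δ ≤ |g t|}
  have hF : Measurable fun t => 1 / g t ^ 2 := (hg.pow_const 2).const_div 1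
  rw [lintegral_eq_lintegral_meas_le _ (.of_forall fun t => by positivity) hF.aemeasurable]
  have hset (s : ℝ) : volume.restrict S {t | s ≤ 1 / g t ^ 2}
      = volume ({t | s ≤ 1 / g t ^ 2} ∩ S) :=
    Measure.restrict_apply (measurableSet_le measurable_const hF)
  simp only [hset]
  have hlow : (∫⁻ s in Ioc 0 (1 / ε₀ ^ 2), volume ({t | s ≤ 1 / g t ^ 2} ∩ S))
      ≤ ENNReal.ofReal (2 * π / ε₀ ^ 2) := by
    calc _ ≤ ∫⁻ _ in Ioc 0 (1 / ε₀ ^ 2), ENNReal.ofReal (2 * π) := by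
          refine lintegral_mono fun s => (measure_mono (t := Icc 0 (2 * π)) ?_).trans ?_
          · exact fun t ht => ht.2.1
          · simp
      _ = _ := by
          rw [setLIntegral_const, Real.volume_Ioc, ← ENNReal.ofReal_mul (by positivity)]
          congr 1
          ring
  have hmid : (∫⁻ s in Ioc (1 / ε₀ ^ 2) (1 / δ ^ 2), volume ({t | s ≤ 1 / g t ^ 2} ∩ S))
      ≤ ENNReal.ofReal (2 * L / δ) := by
    calc _ ≤ ∫⁻ s in Ioc (1 / ε₀ ^ 2) (1 / δ ^ 2),
            ENNReal.ofReal (L * s ^ (-(1 / 2) : ℝ)) := by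
          refine setLIntegral_mono' measurableSet_Ioc fun s hs => ?_
          have hs0 : 0 < s := lt_trans (by positivity) hs.1
          refine (measure_mono ?_).trans (hmes _ (rpow_pos_of_pos hs0 _) ?_)
          · exact fun t ht => ⟨ht.2.1, abs_le_rpow_neg_half_of_le_one_div_sq hs0 ht.1⟩
          · rw [rpow_neg hs0.le, ← Real.sqrt_eq_rpow, ← Real.sqrt_inv]
            refine Real.sqrt_le_iff.2 ⟨hε₀.le, ?_⟩
            rw [inv_le_comm₀ hs0 (by positivity), ← one_div]
            exact hs.1.le
      _ ≤ ∫⁻ s in Ioc 0 (1 / δ ^ 2), ENNReal.ofReal (L * s ^ (-(1 / 2) : ℝ)) :=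
          lintegral_mono_set (Ioc_subset_Ioc_left (by positivity))
      _ = _ := by
          rw [lintegral_Ioc_const_mul_rpow_neg_half (by positivity) hL.le,
            Real.sqrt_div zero_le_one, Real.sqrt_one, Real.sqrt_sq hδ.le, mul_one_div]
  have hhigh : (∫⁻ s in Ioi (1 / δ ^ 2), volume ({t | s ≤ 1 / g t ^ 2} ∩ S)) = 0 := by
    refine setLIntegral_eq_zero measurableSet_Ioi fun s hs => ?_
    refine (congrArg volume (eq_empty_of_forall_notMem fun t ht => ?_)).trans measure_empty
    have hsq : δ ^ 2 ≤ g t ^ 2 := by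
      rw [← sq_abs (g t)]
      exact pow_le_pow_left₀ hδ.le ht.2.2 2
    exact (ht.1.trans (one_div_le_one_div_of_le (by positivity) hsq)).not_gt hs
  have hcover : Ioi (0 : ℝ) ⊆
      Ioc 0 (1 / ε₀ ^ 2) ∪ Ioc (1 / ε₀ ^ 2) (1 / δ ^ 2) ∪ Ioi (1 / δ ^ 2) := by
    intro s hs
    simp only [mem_union, mem_Ioc, mem_Ioi] at hs ⊢
    grind
  calc _ ≤ _ := lintegral_mono_set hcover
    _ ≤ _ := lintegral_union_le _ _ _
    _ ≤ _ := add_le_add (lintegral_union_le _ _ _) hhigh.le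
    _ ≤ _ := by
      rw [add_zero, ENNReal.ofReal_add (by positivity) (by positivity)]
      exact add_le_add hlow hmid
end

section
/- Let b ∈ ℝ, μ > 0, and let p, q ∈ ℤ with q ≥ 2 and gcd(p, q) = 1. Then the set { a ∈ ℝ : ρ_{a,b,μ} = p/q } contains at most one element; in particular it has empty interior, so no phase lock occurs for non-integer rational values of the rotation number of the Josephson equation. -/
open Real Filter

/-- The point of the unit circle at half-angle `x / 2`. -/
noncomputable def halfAngleVec (x : ℝ) : Fin 2 → ℝ := ![cos (x / 2), sin (x / 2)]

theorem exists_int_of_smul_halfAngleVec_eq {x y c d : ℝ} (hc : 0 < c)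
    (h : c • halfAngleVec y = d • halfAngleVec x) : ∃ k : ℤ, y = x + 2 * π * k := by
  have h0 := congrFun h 0
  have h1 := congrFun h 1
  simp only [halfAngleVec, Pi.smul_apply, smul_eq_mul, Matrix.cons_val_zero,
    Matrix.cons_val_one] at h0 h1
  have hs : sin ((y - x) / 2) = 0 := by
    have : c * sin ((y - x) / 2) = 0 := by
      rw [sub_div, sin_sub]
      linear_combination cos (x / 2) * h1 - sin (x / 2) * h0
    exact (mul_eq_zero.mp this).resolve_left hc.ne'
  obtain ⟨k, hk⟩ := sin_eq_zero_iff.mp hs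
  exact ⟨k, by linarith⟩

theorem halfAngleVec_add_two_pi_mul_int (x : ℝ) (k : ℤ) :
    halfAngleVec (x + 2 * π * k) = cos (k * π) • halfAngleVec x := by
  have h : (x + 2 * π * k) / 2 = x / 2 + k * π := by ring
  simp only [halfAngleVec, h, cos_add, sin_add, sin_int_mul_pi]
  ext i
  fin_cases i <;> simp <;> ring

theorem halfAngleVec_ne_zero (x : ℝ) : halfAngleVec x ≠ 0 := by
  intro h
  have h0 : cos (x / 2) = 0 := congrFun h 0
  have h1 : sin (x / 2) = 0 := congrFun h 1
  simpa [h0, h1] using sin_sq_add_cos_sq (x / 2)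

theorem exists_eq_smul_halfAngleVec (v : Fin 2 → ℝ) :
    ∃ r x : ℝ, v = r • halfAngleVec x := by
  refine ⟨‖(⟨v 0, v 1⟩ : ℂ)‖, 2 * Complex.arg ⟨v 0, v 1⟩, ?_⟩
  ext i
  have h := Complex.norm_mul_cos_arg ⟨v 0, v 1⟩
  have h' := Complex.norm_mul_sin_arg ⟨v 0, v 1⟩
  fin_cases i <;> simp [halfAngleVec, h, h']

theorem exists_pow_eq_smul_add_smul (M : Matrix (Fin 2) (Fin 2) ℝ) (n : ℕ) :
    ∃ α β : ℝ, M ^ n = α • M + β • (1 : Matrix (Fin 2) (Fin 2) ℝ) := by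
  induction n with
  | zero => exact ⟨0, 1, by simp⟩
  | succ n ih =>
    obtain ⟨α, β, h⟩ := ih
    refine ⟨α * M.trace + β, -α * M.det, ?_⟩
    rw [pow_succ, h]
    ext i j
    fin_cases i <;> fin_cases j <;>
      simp [Matrix.mul_apply, Fin.sum_univ_two, Matrix.trace, Matrix.det_fin_two] <;> ring

/-- A primitive of a continuous function, exponentiated: an integrating factor. -/
theorem exists_integrating_factor {k : ℝ → ℝ} (hk : Continuous k) :
    ∃ E : ℝ → ℝ, (∀ t, 0 < E t) ∧ E 0 = 1 ∧ ∀ t, HasDerivAt E (E t * k t) t := by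
  refine ⟨fun t => exp (∫ s in (0 : ℝ)..t, k s), fun t => exp_pos _, by simp, fun t => ?_⟩
  exact (hk.integral_hasStrictDerivAt 0 t).hasDerivAt.exp

namespace IsJosephsonSol

variable {a a' b μ : ℝ} {x y : ℝ → ℝ}

theorem continuous (hx : IsJosephsonSol a b μ x) : Continuous x :=
  continuous_iff_continuousAt.mpr fun t => (hx t).continuousAt

theorem exists_weighted_difference (hx : IsJosephsonSol a b μ x)
    (hy : IsJosephsonSol a' b μ y) :
    ∃ E : ℝ → ℝ, (∀ t, 0 < E t) ∧
      ∀ t, HasDerivAt (fun t => E t * (y t - x t)) (E t * ((a' - a) / μ)) t := by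
  have hxc := hx.continuous
  have hyc := hy.continuous
  obtain ⟨E, hE, -, hE'⟩ := exists_integrating_factor
    (k := fun t => sin ((y t + x t) / 2) * sinc ((y t - x t) / 2) / μ)
    (((by fun_prop : Continuous fun t => sin ((y t + x t) / 2)).mul
      (continuous_sinc.comp (by fun_prop : Continuous fun t => (y t - x t) / 2))).div_const μ)
  refine ⟨E, hE, fun t => ?_⟩
  refine ((hE' t).mul ((hy t).sub (hx t))).congr_deriv ?_
  have h1 := cos_sub_cos (y t) (x t)
  have h2 : sin ((y t - x t) / 2) = (y t - x t) / 2 * sinc ((y t - x t) / 2) := by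
    by_cases h : (y t - x t) / 2 = 0
    · simp [h]
    · rw [sinc_of_ne_zero h, mul_div_cancel₀ _ h]
  rw [h2] at h1
  simp only [Pi.sub_apply, div_eq_mul_inv] at h1 ⊢
  linear_combination (E t * μ⁻¹) * h1

theorem le_of_le (hμ : 0 < μ) (hx : IsJosephsonSol a b μ x) (hy : IsJosephsonSol a' b μ y)
    (ha : a ≤ a') {s t : ℝ} (hst : s ≤ t) (h : x s ≤ y s) : x t ≤ y t := by
  obtain ⟨E, hE, hE'⟩ := hx.exists_weighted_difference hy
  have hm := monotone_of_hasDerivAt_nonneg hE'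
    (fun t => mul_nonneg (hE t).le (div_nonneg (sub_nonneg.mpr ha) hμ.le)) hst
  have := (mul_nonneg (hE s).le (sub_nonneg.mpr h)).trans hm
  exact sub_nonneg.mp ((mul_nonneg_iff_of_pos_left (hE t)).mp this)

theorem lt_of_le (hμ : 0 < μ) (hx : IsJosephsonSol a b μ x) (hy : IsJosephsonSol a' b μ y)
    (ha : a < a') {s t : ℝ} (hst : s < t) (h : x s ≤ y s) : x t < y t := by
  obtain ⟨E, hE, hE'⟩ := hx.exists_weighted_difference hy
  have hm := strictMono_of_hasDerivAt_pos hE'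
    (fun t => mul_pos (hE t) (div_pos (sub_pos.mpr ha) hμ)) hst
  have := (mul_nonneg (hE s).le (sub_nonneg.mpr h)).trans_lt hm
  exact sub_pos.mp ((mul_pos_iff_of_pos_left (hE t)).mp this)

theorem add_two_pi (hx : IsJosephsonSol a b μ x) :
    IsJosephsonSol a b μ (fun t => x t + 2 * π) := fun t => by
  simpa using (hx t).add_const (2 * π)

theorem shift_two_pi (hx : IsJosephsonSol a b μ x) :
    IsJosephsonSol a b μ (fun t => x (t - 2 * π)) := fun t => by
  simpa using (hx (t - 2 * π)).comp_sub_const t (2 * π)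

/-- The half angle of a solution is the polar angle of a solution of a traceless linear system. -/
theorem exists_linear_lift (hx : IsJosephsonSol a b μ x) :
    ∃ r : ℝ → ℝ, (∀ t, 0 < r t) ∧ r 0 = 1 ∧ ∀ t,
      HasDerivAt (fun t => r t * cos (x t / 2))
        ((1 - (a + b * cos t)) / (2 * μ) * (r t * sin (x t / 2))) t ∧
      HasDerivAt (fun t => r t * sin (x t / 2))
        ((1 + (a + b * cos t)) / (2 * μ) * (r t * cos (x t / 2))) t := by
  have hxc := hx.continuous
  obtain ⟨r, hr, hr0, hr'⟩ := exists_integrating_factor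
    (k := fun t => sin (x t) / (2 * μ)) (by fun_prop)
  refine ⟨r, hr, hr0, fun t => ?_⟩
  have h2 : HasDerivAt (fun t => x t / 2) _ t := (hx t).div_const 2
  have hs : sin (x t) = 2 * sin (x t / 2) * cos (x t / 2) := by
    rw [← sin_two_mul]; congr 1; ring
  have hc : cos (x t) = 2 * cos (x t / 2) ^ 2 - 1 := by
    rw [← cos_two_mul]; congr 1; ring
  have h1 := sin_sq_add_cos_sq (x t / 2)
  constructor
  · refine ((hr' t).mul h2.cos).congr_deriv ?_
    rw [hs, hc]
    simp only [div_eq_mul_inv, mul_inv]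
    ring
  · refine ((hr' t).mul h2.sin).congr_deriv ?_
    rw [hs, hc]
    simp only [div_eq_mul_inv, mul_inv] at h1 ⊢
    linear_combination (r t * cos (x t * 2⁻¹) * μ⁻¹) * h1

end IsJosephsonSol

namespace IsPoincareLift

variable {a a' b μ : ℝ} {P P' : ℝ → ℝ}

theorem monotone (hμ : 0 < μ) (hP : IsPoincareLift a b μ P) : Monotone P := fun s t hst => by
  obtain ⟨x, hx, hx0, hxP⟩ := hP s
  obtain ⟨y, hy, hy0, hyP⟩ := hP t
  rw [hxP, hyP]
  exact hx.le_of_le hμ hy le_rfl two_pi_pos.le (by rwa [hx0, hy0])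

theorem apply_eq (hμ : 0 < μ) (hP : IsPoincareLift a b μ P) {x : ℝ → ℝ}
    (hx : IsJosephsonSol a b μ x) : P (x 0) = x (2 * π) := by
  obtain ⟨y, hy, hy0, hyP⟩ := hP (x 0)
  rw [hyP]
  exact le_antisymm (hy.le_of_le hμ hx le_rfl two_pi_pos.le hy0.le)
    (hx.le_of_le hμ hy le_rfl two_pi_pos.le hy0.ge)

theorem map_add_two_pi (hμ : 0 < μ) (hP : IsPoincareLift a b μ P) (s : ℝ) :
    P (s + 2 * π) = P s + 2 * π := by
  obtain ⟨x, hx, hx0, hxP⟩ := hP s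
  have := hP.apply_eq hμ hx.add_two_pi
  rwa [hx0, ← hxP] at this

theorem surjective (hμ : 0 < μ) (hP : IsPoincareLift a b μ P) : Function.Surjective P :=
  fun s => by
    obtain ⟨x, hx, hx0, -⟩ := hP s
    exact ⟨_, (hP.apply_eq hμ hx.shift_two_pi).trans (by simpa using hx0)⟩

theorem lt_of_lt (hμ : 0 < μ) (hP : IsPoincareLift a b μ P) (hP' : IsPoincareLift a' b μ P')
    (ha : a < a') (s : ℝ) : P s < P' s := by
  obtain ⟨x, hx, hx0, hxP⟩ := hP s
  obtain ⟨y, hy, hy0, hyP⟩ := hP' s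
  rw [hxP, hyP]
  exact hx.lt_of_le hμ hy ha two_pi_pos (by rw [hx0, hy0])

theorem iterate_lt_iterate (hμ : 0 < μ) (hP : IsPoincareLift a b μ P)
    (hP' : IsPoincareLift a' b μ P') (ha : a < a') {n : ℕ} (hn : n ≠ 0) (s : ℝ) :
    P^[n] s < P'^[n] s := by
  obtain ⟨k, rfl⟩ := Nat.exists_eq_succ_of_ne_zero hn
  rw [Function.iterate_succ_apply', Function.iterate_succ_apply']
  exact (hP.lt_of_lt hμ hP' ha _).trans_le (hP'.monotone hμ
    ((hP.monotone hμ).iterate_le_of_le (fun t => (hP.lt_of_lt hμ hP' ha t).le) k s))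

/-- The Poincaré map is the projectivization of a linear map of the plane. -/
theorem exists_monodromy (hP : IsPoincareLift a b μ P) :
    ∃ M : Matrix (Fin 2) (Fin 2) ℝ, ∀ s, ∃ r : ℝ, 0 < r ∧
      M.mulVec (halfAngleVec s) = r • halfAngleVec (P s) := by
  have wronskian {x y : ℝ → ℝ} {r ρ : ℝ → ℝ}
      (hr : ∀ t, HasDerivAt (fun t => r t * cos (x t / 2))
        ((1 - (a + b * cos t)) / (2 * μ) * (r t * sin (x t / 2))) t ∧
      HasDerivAt (fun t => r t * sin (x t / 2))
        ((1 + (a + b * cos t)) / (2 * μ) * (r t * cos (x t / 2))) t)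
      (hρ : ∀ t, HasDerivAt (fun t => ρ t * cos (y t / 2))
        ((1 - (a + b * cos t)) / (2 * μ) * (ρ t * sin (y t / 2))) t ∧
      HasDerivAt (fun t => ρ t * sin (y t / 2))
        ((1 + (a + b * cos t)) / (2 * μ) * (ρ t * cos (y t / 2))) t) (t : ℝ) :
      r t * cos (x t / 2) * (ρ t * sin (y t / 2)) - r t * sin (x t / 2) * (ρ t * cos (y t / 2))
        = r 0 * cos (x 0 / 2) * (ρ 0 * sin (y 0 / 2))
          - r 0 * sin (x 0 / 2) * (ρ 0 * cos (y 0 / 2)) := by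
    have hd (t : ℝ) := ((hr t).1.mul (hρ t).2).sub ((hr t).2.mul (hρ t).1)
    refine is_const_of_deriv_eq_zero (fun t => (hd t).differentiableAt)
      (fun t => (hd t).deriv.trans ?_) t 0
    ring
  obtain ⟨x, hx, hx0, -⟩ := hP 0
  obtain ⟨y, hy, hy0, -⟩ := hP π
  obtain ⟨r, -, hr0, hr⟩ := hx.exists_linear_lift
  obtain ⟨ρ, -, hρ0, hρ⟩ := hy.exists_linear_lift
  set T := 2 * π
  refine ⟨!![r T * cos (x T / 2), ρ T * cos (y T / 2); r T * sin (x T / 2), ρ T * sin (y T / 2)],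
    fun s => ?_⟩
  obtain ⟨z, hz, hz0, hzP⟩ := hP s
  obtain ⟨σ, hσpos, hσ0, hσ⟩ := hz.exists_linear_lift
  refine ⟨σ T, hσpos T, ?_⟩
  have h1 := wronskian hr hρ T
  have h2 := wronskian hr hσ T
  have h3 := wronskian hσ hρ T
  simp only [hx0, hy0, hz0, hr0, hρ0, hσ0, zero_div, cos_zero, sin_zero, cos_pi_div_two,
    sin_pi_div_two, one_mul, mul_one, mul_zero, zero_mul, sub_zero] at h1 h2 h3
  rw [hzP]
  ext i
  fin_cases i
  · simp [halfAngleVec, Matrix.mulVec, dotProduct, Fin.sum_univ_two]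
    rw [← h2, ← h3]
    linear_combination (σ T * cos (z T / 2)) * h1
  · simp [halfAngleVec, Matrix.mulVec, dotProduct, Fin.sum_univ_two]
    rw [← h2, ← h3]
    linear_combination (σ T * sin (z T / 2)) * h1

theorem iterate_monodromy {M : Matrix (Fin 2) (Fin 2) ℝ}
    (hM : ∀ s, ∃ r : ℝ, 0 < r ∧ M.mulVec (halfAngleVec s) = r • halfAngleVec (P s))
    (n : ℕ) (s : ℝ) :
    ∃ r : ℝ, 0 < r ∧ (M ^ n).mulVec (halfAngleVec s) = r • halfAngleVec (P^[n] s) := by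
  induction n with
  | zero => exact ⟨1, one_pos, by simp⟩
  | succ n ih =>
    obtain ⟨r, hr, h⟩ := ih
    obtain ⟨r', hr', h'⟩ := hM (P^[n] s)
    refine ⟨r * r', mul_pos hr hr', ?_⟩
    rw [pow_succ', ← Matrix.mulVec_mulVec, h, Matrix.mulVec_smul, h',
      Function.iterate_succ_apply', smul_smul]

/-- The Poincaré lift, rescaled to commute with the translation by `1`. -/
noncomputable def circleDeg1Lift (hμ : 0 < μ) (hP : IsPoincareLift a b μ P) :
    CircleDeg1Lift where
  toFun s := P (2 * π * s) / (2 * π)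
  monotone' s t hst := by
    have := hP.monotone hμ (mul_le_mul_of_nonneg_left hst two_pi_pos.le)
    dsimp only
    gcongr
  map_add_one' s := by
    rw [mul_add, mul_one, hP.map_add_two_pi hμ]
    field_simp

theorem circleDeg1Lift_pow_apply (hμ : 0 < μ) (hP : IsPoincareLift a b μ P) (n : ℕ) (s : ℝ) :
    (hP.circleDeg1Lift hμ ^ n) s = P^[n] (2 * π * s) / (2 * π) := by
  have h : Function.Semiconj (fun s => 2 * π * s) (hP.circleDeg1Lift hμ) P := fun s =>
    mul_div_cancel₀ _ two_pi_pos.ne'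
  rw [CircleDeg1Lift.coe_pow, ← (h.iterate_right n).eq s, mul_div_cancel_left₀ _ two_pi_pos.ne']

theorem continuous_circleDeg1Lift (hμ : 0 < μ) (hP : IsPoincareLift a b μ P) :
    Continuous (hP.circleDeg1Lift hμ) := by
  have := (hP.monotone hμ).continuous_of_surjective (hP.surjective hμ)
  exact (this.comp (continuous_const_mul (2 * π))).div_const _

theorem translationNumber_eq (hμ : 0 < μ) (hP : IsPoincareLift a b μ P) {ρ : ℝ}
    (hρ : IsRotNumber P ρ) : (hP.circleDeg1Lift hμ).translationNumber = ρ := by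
  refine tendsto_nhds_unique ((hP.circleDeg1Lift hμ).tendsto_translationNumber 0) ?_
  refine (hρ 0).congr fun n => ?_
  rw [circleDeg1Lift_pow_apply, mul_zero, sub_zero, sub_zero, div_div]

theorem translationNumber_of_iterate_eq (hμ : 0 < μ) (hP : IsPoincareLift a b μ P) {n : ℕ}
    (hn : 0 < n) {s : ℝ} {m : ℤ} (h : P^[n] s = s + 2 * π * m) :
    (hP.circleDeg1Lift hμ).translationNumber = m / n := by
  have hπ := two_pi_pos.ne'
  refine CircleDeg1Lift.translationNumber_of_map_pow_eq_add_int _ (x := s / (2 * π)) ?_ hn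
  rw [circleDeg1Lift_pow_apply, mul_div_cancel₀ _ hπ, h, add_div, mul_div_cancel_left₀ _ hπ]

/-- For a non-integer rational rotation number `p / q`, every orbit is periodic. -/
theorem iterate_eq_add (hμ : 0 < μ) (hP : IsPoincareLift a b μ P) {ρ : ℝ}
    (hρ : IsRotNumber P ρ) {p : ℤ} {n : ℕ} (hn : 0 < n) (hρn : ρ = p / n)
    (hρ' : ∀ k : ℤ, ρ ≠ k) (s : ℝ) : P^[n] s = s + 2 * π * p := by
  have hπ := two_pi_pos.ne'
  have hτ := hP.translationNumber_eq hμ hρ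
  obtain ⟨M, hM⟩ := hP.exists_monodromy
  have no_eigenvector (v : Fin 2 → ℝ) (hv : v ≠ 0) (c : ℝ) : M.mulVec v ≠ c • v := by
    obtain ⟨r, x, rfl⟩ := exists_eq_smul_halfAngleVec v
    intro h
    have hr : r ≠ 0 := fun h => hv (by simp [h])
    obtain ⟨d, hd, h'⟩ := hM x
    rw [Matrix.mulVec_smul, smul_comm c r] at h
    rw [smul_right_injective _ hr h] at h'
    obtain ⟨k, hk⟩ := exists_int_of_smul_halfAngleVec_eq hd h'.symm
    refine hρ' k ?_
    rw [← hτ, hP.translationNumber_of_iterate_eq hμ one_pos (s := x) (m := k) (by simpa using hk)]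
    simp
  obtain ⟨z, hz⟩ := (CircleDeg1Lift.translationNumber_eq_rat_iff _
    (hP.continuous_circleDeg1Lift hμ) hn).mp (hτ.trans hρn)
  rw [circleDeg1Lift_pow_apply, div_eq_iff hπ] at hz
  obtain ⟨α, β, hαβ⟩ := exists_pow_eq_smul_add_smul M n
  have hα : α = 0 := by
    by_contra hα
    obtain ⟨r, hr, h⟩ := iterate_monodromy hM n (2 * π * z)
    have hz' : P^[n] (2 * π * z) = 2 * π * z + 2 * π * p := by rw [hz]; ring
    rw [hz', halfAngleVec_add_two_pi_mul_int, hαβ, Matrix.add_mulVec, Matrix.smul_mulVec,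
      Matrix.smul_mulVec, Matrix.one_mulVec, smul_smul, ← eq_sub_iff_add_eq, ← sub_smul] at h
    refine no_eigenvector _ (halfAngleVec_ne_zero (2 * π * z)) (α⁻¹ * (r * cos (p * π) - β)) ?_
    rw [mul_smul, ← h, inv_smul_smul₀ hα]
  obtain ⟨r, hr, h⟩ := iterate_monodromy hM n s
  rw [hαβ, hα, zero_smul, zero_add, Matrix.smul_mulVec, Matrix.one_mulVec] at h
  obtain ⟨k, hk⟩ := exists_int_of_smul_halfAngleVec_eq hr h.symm
  have hkp := (hP.translationNumber_of_iterate_eq hμ hn hk).symm.trans (hτ.trans hρn)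
  have hn' : (n : ℝ) ≠ 0 := by positivity
  rw [hk, (div_left_inj' hn').mp hkp]

end IsPoincareLift

/-- No phase lock for non-integer rational rotation numbers: for
`p/q` with `q ≥ 2` and `gcd(p,q) = 1`, the set of `a` with `ρ_{a,b,μ} = p/q` has at most
one point, hence empty interior. -/
theorem no_phase_lock_nonintegerrational
    (b μ : ℝ) (hμ : 0 < μ) (p q : ℤ) (hq : 2 ≤ q) (hpq : Int.gcd p q = 1)
    (P : ℝ → ℝ → ℝ) (ρ : ℝ → ℝ)
    (hP : ∀ a : ℝ, IsPoincareLift a b μ (P a))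
    (hρ : ∀ a : ℝ, IsRotNumber (P a) (ρ a)) :
    Set.Subsingleton {a : ℝ | ρ a = (p : ℝ) / (q : ℝ)} ∧
    interior {a : ℝ | ρ a = (p : ℝ) / (q : ℝ)} = ∅ := by

  have hq0 : 0 < q.toNat := by omega
  have hqc : ((q.toNat : ℕ) : ℝ) = q := by
    exact_mod_cast congrArg (Int.cast : ℤ → ℝ) (Int.toNat_of_nonneg (by omega : 0 ≤ q))
  have hint (k : ℤ) : (p : ℝ) / q ≠ k := by
    intro h
    rw [div_eq_iff (by exact_mod_cast (by omega : q ≠ 0))] at h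
    have h' : p = k * q := by exact_mod_cast h
    rw [h', Int.gcd_mul_left_left] at hpq
    omega
  have periodic {a : ℝ} (ha : ρ a = p / q) (s : ℝ) : (P a)^[q.toNat] s = s + 2 * π * p :=
    (hP a).iterate_eq_add hμ (hρ a) hq0 (by rw [ha, hqc]) (fun k => ha ▸ hint k) s
  have hsub : Set.Subsingleton {a : ℝ | ρ a = (p : ℝ) / (q : ℝ)} := by
    intro a ha a' ha'
    rcases lt_trichotomy a a' with h | h | h
    · have := (hP a).iterate_lt_iterate hμ (hP a') h hq0.ne' 0
      rw [periodic ha, periodic ha'] at this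
      exact absurd this (lt_irrefl _)
    · exact h
    · have := (hP a').iterate_lt_iterate hμ (hP a) h hq0.ne' 0
      rw [periodic ha, periodic ha'] at this
      exact absurd this (lt_irrefl _)
  exact ⟨hsub, interior_eq_empty_iff_dense_compl.mpr (hsub.countable.dense_compl ℝ)⟩
end

section
/- For every a ∈ ℝ, b ∈ ℝ, μ > 0 there exists a real 2×2 matrix M = [[m₁₁, m₁₂], [m₂₁, m₂₂]] with determinant 1 such that for every solution x of the Josephson equation there exists λ ≠ 0 with (sin(x(2π)/2), cos(x(2π)/2)) = λ · ( m₁₁·sin(x(0)/2) + m₁₂·cos(x(0)/2), m₂₁·sin(x(0)/2) + m₂₂·cos(x(0)/2) ). In other words, in the projective coordinate u = tan(x/2) the Poincaré map of the Josephson equation acts as a single Möbius transformation. -/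
open Real

open Set

theorem exists_hasDerivWithinAt_cos_add_div {p : ℝ → ℝ} (hp : Continuous p) {μ T : ℝ}
    (hμ : 0 < μ) (hT : 0 ≤ T) (y₀ : ℝ) :
    ∃ y : ℝ → ℝ, y 0 = y₀ ∧
      ∀ t ∈ Icc 0 T, HasDerivWithinAt y ((cos (y t) + p t) / μ) (Icc 0 T) t := by
  obtain ⟨C, hC⟩ := isCompact_Icc.exists_bound_of_continuousOn (hp.continuousOn (s := Icc 0 T))
  have hC0 : 0 ≤ C := (norm_nonneg _).trans (hC 0 (left_mem_Icc.2 hT))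
  have hL : 0 ≤ (1 + C) / μ := by positivity
  have hpl : IsPicardLindelof (fun t x ↦ (cos x + p t) / μ) (⟨0, left_mem_Icc.2 hT⟩ : Icc 0 T) y₀
      ((1 + C) / μ * T).toNNReal 0 ((1 + C) / μ).toNNReal (1 / μ).toNNReal := by
    refine ⟨fun t _ ↦ ?_, fun x _ ↦ by fun_prop, fun t ht x _ ↦ ?_, ?_⟩
    · refine LipschitzOnWith.of_dist_le_mul fun x _ y _ ↦ ?_
      rw [Real.dist_eq, Real.dist_eq, coe_toNNReal _ (by positivity), ← sub_div,
        add_sub_add_right_eq_sub, abs_div, abs_of_pos hμ, one_div_mul_eq_div]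
      exact div_le_div_of_nonneg_right (abs_cos_sub_cos_le x y) hμ.le
    · rw [Real.norm_eq_abs, abs_div, abs_of_pos hμ, coe_toNNReal _ hL]
      exact div_le_div_of_nonneg_right
        ((abs_add_le _ _).trans (add_le_add (abs_cos_le_one x) (hC t ht))) hμ.le
    · rw [coe_toNNReal _ hL, coe_toNNReal _ (mul_nonneg hL hT)]
      simp [hT]
  exact hpl.exists_eq_forall_mem_Icc_hasDerivWithinAt₀

theorem exists_hasDerivWithinAt_of_continuousOn_Icc {k : ℝ → ℝ} {T : ℝ} (hT : 0 ≤ T)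
    (hk : ContinuousOn k (Icc 0 T)) :
    ∃ G : ℝ → ℝ, G 0 = 0 ∧ ∀ t ∈ Icc 0 T, HasDerivWithinAt G (k t) (Icc 0 T) t := by
  have hc : Continuous (IccExtend hT ((Icc 0 T).domRestrict k)) := hk.domRestrict.Icc_extend'
  refine ⟨fun t ↦ ∫ s in (0 : ℝ)..t, IccExtend hT ((Icc 0 T).domRestrict k) s, by simp,
    fun t ht ↦ ?_⟩
  have h := (hc.integral_hasStrictDerivAt 0 t).hasDerivAt.hasDerivWithinAt (s := Icc 0 T)
  rwa [IccExtend_of_mem _ _ ht] at h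

/-- Half the difference of two solutions has a sine which evolves by exponential factors,
one for each solution. -/
theorem sin_half_sub_eq_exp_mul {p x y G H : ℝ → ℝ} {μ T : ℝ} (hT : 0 ≤ T)
    (hx : ∀ t ∈ Icc 0 T, HasDerivWithinAt x ((cos (x t) + p t) / μ) (Icc 0 T) t)
    (hy : ∀ t ∈ Icc 0 T, HasDerivWithinAt y ((cos (y t) + p t) / μ) (Icc 0 T) t)
    (hG0 : G 0 = 0) (hH0 : H 0 = 0)
    (hG : ∀ t ∈ Icc 0 T, HasDerivWithinAt G (-sin (x t) / (2 * μ)) (Icc 0 T) t)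
    (hH : ∀ t ∈ Icc 0 T, HasDerivWithinAt H (-sin (y t) / (2 * μ)) (Icc 0 T) t) :
    sin (x T / 2 - y T / 2) = exp (G T) * exp (H T) * sin (x 0 / 2 - y 0 / 2) := by
  have hderiv : ∀ t ∈ Icc 0 T, HasDerivWithinAt
      (fun t ↦ sin (x t / 2 - y t / 2) * exp (-(G t + H t))) 0 (Icc 0 T) t := by
    intro t ht
    have h := (((hx t ht).div_const 2).sub ((hy t ht).div_const 2)).sin.mul
      ((hG t ht).add (hH t ht)).neg.exp
    refine HasDerivWithinAt.congr_deriv h ?_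
    simp only [Pi.sub_apply, Pi.add_apply, Pi.neg_apply]
    have hX : x t = 2 * (x t / 2) := by ring
    have hY : y t = 2 * (y t / 2) := by ring
    generalize x t / 2 = X at hX ⊢
    generalize y t / 2 = Y at hY ⊢
    have key : cos (X - Y) * (cos (x t) - cos (y t)) =
        - (sin (x t) + sin (y t)) * sin (X - Y) := by
      rw [hX, hY, cos_two_mul, cos_two_mul, sin_two_mul, sin_two_mul, cos_sub, sin_sub]
      have h1 := sin_sq_add_cos_sq X
      have h2 := sin_sq_add_cos_sq Y
      grind
    linear_combination (exp (-(G t + H t)) / (2 * μ)) * key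
  have hconst := constant_of_derivWithin_zero (fun t ht ↦ (hderiv t ht).differentiableWithinAt)
    (fun t ht ↦ (hderiv t (Ico_subset_Icc_self ht)).derivWithin
      (uniqueDiffOn_Icc (ht.1.trans_lt ht.2) t (Ico_subset_Icc_self ht))) T (right_mem_Icc.2 hT)
  simp only [hG0, hH0, add_zero, neg_zero, exp_zero, mul_one] at hconst
  rw [← hconst, ← exp_add, mul_left_comm, ← exp_add, add_neg_cancel, exp_zero, mul_one]

theorem exists_hasDerivWithinAt_neg_sin_div {v y : ℝ → ℝ} {T : ℝ} (hT : 0 ≤ T) (μ : ℝ)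
    (hy : ∀ t ∈ Icc 0 T, HasDerivWithinAt y (v t) (Icc 0 T) t) :
    ∃ G : ℝ → ℝ, G 0 = 0 ∧
      ∀ t ∈ Icc 0 T, HasDerivWithinAt G (-sin (y t) / (2 * μ)) (Icc 0 T) t :=
  exists_hasDerivWithinAt_of_continuousOn_Icc hT <|
    (continuous_sin.comp_continuousOn fun t ht ↦ (hy t ht).continuousWithinAt).neg.div_const _

/-- The Poincaré map of the Josephson equation is a single Möbius
transformation: there is a matrix `[[m₁₁, m₁₂], [m₂₁, m₂₂]]` of determinant `1` such that
for every solution `x`, the vector `(sin(x(2π)/2), cos(x(2π)/2))` is proportional (by a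
nonzero factor) to the image of `(sin(x(0)/2), cos(x(0)/2))` under this matrix. -/
theorem poincare_map_is_moebius (a b μ : ℝ) (hμ : 0 < μ) :
    ∃ m₁₁ m₁₂ m₂₁ m₂₂ : ℝ, m₁₁ * m₂₂ - m₁₂ * m₂₁ = 1 ∧
      ∀ x : ℝ → ℝ,
        (∀ t : ℝ, HasDerivAt x ((Real.cos (x t) + a + b * Real.cos t) / μ) t) →
        ∃ l : ℝ, l ≠ 0 ∧
          Real.sin (x (2 * π) / 2)
            = l * (m₁₁ * Real.sin (x 0 / 2) + m₁₂ * Real.cos (x 0 / 2)) ∧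
          Real.cos (x (2 * π) / 2)
            = l * (m₂₁ * Real.sin (x 0 / 2) + m₂₂ * Real.cos (x 0 / 2)) := by
  have hT : (0 : ℝ) ≤ 2 * π := two_pi_pos.le
  have hp : Continuous fun t ↦ a + b * cos t := by fun_prop
  obtain ⟨y, hy0, hy⟩ := exists_hasDerivWithinAt_cos_add_div hp hμ hT 0
  obtain ⟨z, hz0, hz⟩ := exists_hasDerivWithinAt_cos_add_div hp hμ hT π
  obtain ⟨G, hG0, hG⟩ := exists_hasDerivWithinAt_neg_sin_div hT μ hy
  obtain ⟨H, hH0, hH⟩ := exists_hasDerivWithinAt_neg_sin_div hT μ hz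
  have hzy := sin_half_sub_eq_exp_mul hT hz hy hH0 hG0 hH hG
  rw [hz0, hy0, zero_div, sub_zero, sin_pi_div_two, mul_one, sin_sub] at hzy
  have hGe := (exp_pos (G (2 * π))).ne'
  have hHe := (exp_pos (H (2 * π))).ne'
  have hdet : sin (z (2 * π) / 2) / exp (H (2 * π)) * (cos (y (2 * π) / 2) / exp (G (2 * π))) -
      sin (y (2 * π) / 2) / exp (G (2 * π)) * (cos (z (2 * π) / 2) / exp (H (2 * π))) = 1 := by
    field_simp
    linear_combination hzy
  refine ⟨sin (z (2 * π) / 2) / exp (H (2 * π)), sin (y (2 * π) / 2) / exp (G (2 * π)),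
    cos (z (2 * π) / 2) / exp (H (2 * π)), cos (y (2 * π) / 2) / exp (G (2 * π)), hdet,
    fun x hx ↦ ?_⟩
  have hx' : ∀ t ∈ Icc 0 (2 * π), HasDerivWithinAt x ((cos (x t) + (a + b * cos t)) / μ)
      (Icc 0 (2 * π)) t := fun t _ ↦ by
    rw [← add_assoc]
    exact (hx t).hasDerivWithinAt
  obtain ⟨K, hK0, hK⟩ := exists_hasDerivWithinAt_neg_sin_div hT μ hx'
  have hxy := sin_half_sub_eq_exp_mul hT hx' hy hK0 hG0 hK hG
  have hxz := sin_half_sub_eq_exp_mul hT hx' hz hK0 hH0 hK hH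
  rw [hy0, zero_div, sub_zero, sin_sub] at hxy
  rw [hz0, sin_sub_pi_div_two, sin_sub] at hxz
  refine ⟨exp (K (2 * π)), (exp_pos _).ne', ?_, ?_⟩
  · field_simp
    linear_combination (-sin (x (2 * π) / 2)) * hzy + sin (z (2 * π) / 2) * hxy -
      sin (y (2 * π) / 2) * hxz
  · field_simp
    linear_combination (-cos (x (2 * π) / 2)) * hzy + cos (z (2 * π) / 2) * hxy -
      cos (y (2 * π) / 2) * hxz
end

section
/- Let a ∈ ℝ, b ∈ ℝ, μ > 0, and let x be a solution of the Josephson equation dx/dt = (cos x + a + b·cos t)/μ on an open interval I such that x(t) ∉ π + 2πℤ for all t ∈ I. Then the function u(t) = tan(x(t)/2) satisfies the Riccati equation u'(t) = ( (a + b·cos t + 1) + (a + b·cos t − 1)·u(t)² ) / (2μ) on I. -/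
open Real Set

/-- The substitution `u = tan(x/2)` transforms the Josephson equation
`dx/dt = (cos x + a + b cos t)/μ` into the Riccati equation
`u' = ((a + b cos t + 1) + (a + b cos t - 1) u²) / (2μ)`. -/
theorem josephson_to_riccati
    (a b μ : ℝ) (hμ : 0 < μ) (t₀ t₁ : ℝ) (x : ℝ → ℝ)
    (hsol : ∀ t ∈ Set.Ioo t₀ t₁,
      HasDerivAt x ((Real.cos (x t) + a + b * Real.cos t) / μ) t)
    (hx : ∀ t ∈ Set.Ioo t₀ t₁, ∀ k : ℤ, x t ≠ π + 2 * π * k) :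
    ∀ t ∈ Set.Ioo t₀ t₁,
      HasDerivAt (fun s => Real.tan (x s / 2))
        (((a + b * Real.cos t + 1) + (a + b * Real.cos t - 1) * Real.tan (x t / 2) ^ 2)
          / (2 * μ)) t := by
  intro t ht
  have hc : Real.cos (x t / 2) ≠ 0 := by
    rw [Real.cos_ne_zero_iff]
    intro k hk
    exact hx t ht k (by linarith)
  have hμ₀ : μ ≠ 0 := hμ.ne'
  have hcos : Real.cos (x t) = 2 * Real.cos (x t / 2) ^ 2 - 1 := by
    rw [← Real.cos_two_mul, mul_div_cancel₀ _ two_ne_zero]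
  refine ((Real.hasDerivAt_tan hc).comp t ((hsol t ht).div_const 2)).congr_deriv ?_
  rw [Real.tan_eq_sin_div_cos, div_pow, Real.sin_sq, hcos]
  field_simp
  ring
end
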